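/- Let φ be a norm on ℝ², let Ω ⊆ ℝ² be a bounded convex open set, let m ∈ [0, |Ω|], and let E be a minimizer of problem (10), identified with its set of Lebesgue-density-1 points. Then exactly one of the following descriptions holds: (a) if m > |Ω^{R_Ω}|, then the closure of E equals the closure of Ω^{r_m}, where r_m ∈ [r_Ω, R_Ω] is the unique radius with |Ω^{r_m}| = m; (b) if m ∈ [R_Ω²·|W_φ|, |Ω^{R_Ω}|], then the closure of E is the closure of a convex set F which is a union of Wulff balls of radius R_Ω (i.e. F is convex and F = F^{R_Ω}); (c) if m ≤ R_Ω²·|W_φ|, then the closure of E equals the closed Wulff ball cl(W_{√(m/|W_φ|)}(x)) for some x ∈ Ω. -/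

import Mathlib

open MeasureTheory Set ENNReal Filter

noncomputable section

/-- `φ` is a norm on `ℝⁿ` (represented as `Fin n → ℝ`). -/
structure IsNorm {n : ℕ} (φ : (Fin n → ℝ) → ℝ) : Prop where
  nonneg : ∀ x, 0 ≤ φ x
  eq_zero_iff : ∀ x, φ x = 0 ↔ x = 0
  smul_eq : ∀ (a : ℝ) (x : Fin n → ℝ), φ (a • x) = |a| * φ x
  add_le : ∀ x y, φ (x + y) ≤ φ x + φ y

/-- The divergence of a vector field `η : ℝⁿ → ℝⁿ`. -/
def diverg {n : ℕ} (η : (Fin n → ℝ) → (Fin n → ℝ)) (x : Fin n → ℝ) : ℝ :=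
  ∑ i, fderiv ℝ η x (Pi.single i 1) i

/-- The anisotropic total variation `∫ φ*(Du)` of `u : ℝⁿ → ℝ`:
`sup { ∫ u div η dx : η ∈ C¹_c(ℝⁿ;ℝⁿ), φ(η(x)) ≤ 1 ∀ x }`, as an extended real. -/
def anisoTV {n : ℕ} (φ : (Fin n → ℝ) → ℝ) (u : (Fin n → ℝ) → ℝ) : ℝ≥0∞ :=
  ⨆ η ∈ {η : (Fin n → ℝ) → (Fin n → ℝ) |
      ContDiff ℝ 1 η ∧ HasCompactSupport η ∧ ∀ x, φ (η x) ≤ 1},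
    ENNReal.ofReal (∫ x, u x * diverg η x)

/-- `u ∈ BV(ℝⁿ)` (with respect to the anisotropic total variation). -/
def IsBV {n : ℕ} (φ : (Fin n → ℝ) → ℝ) (u : (Fin n → ℝ) → ℝ) : Prop :=
  Integrable u volume ∧ anisoTV φ u ≠ ⊤

/-- `u` is admissible for problem (1): `u ∈ BV(ℝⁿ)`, `u = 0` a.e. outside `Ω`,
`u` is a.e. `ℕ`-valued, and `∫_Ω u = m`. -/
def Admissible {n : ℕ} (φ : (Fin n → ℝ) → ℝ) (Ω : Set (Fin n → ℝ)) (m : ℝ)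
    (u : (Fin n → ℝ) → ℝ) : Prop :=
  IsBV φ u ∧ (∀ᵐ x ∂volume, x ∉ Ω → u x = 0) ∧
    (∀ᵐ x ∂volume, ∃ k : ℕ, u x = k) ∧ (∫ x in Ω, u x) = m

/-- `u` is a minimizer of problem (1). -/
def IsMinimizer {n : ℕ} (φ : (Fin n → ℝ) → ℝ) (Ω : Set (Fin n → ℝ)) (m : ℝ)
    (u : (Fin n → ℝ) → ℝ) : Prop :=
  Admissible φ Ω m u ∧ ∀ v, Admissible φ Ω m v → anisoTV φ u ≤ anisoTV φ v

/-- The anisotropic perimeter `P_φ(E)` of a set `E ⊆ ℝⁿ`. -/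
def anisoPerimeter {n : ℕ} (φ : (Fin n → ℝ) → ℝ) (E : Set (Fin n → ℝ)) : ℝ≥0∞ :=
  anisoTV φ (E.indicator (1 : (Fin n → ℝ) → ℝ))

/-- The Wulff ball `W_r(x) = {y : φ(y-x) < r}`. -/
def wulffBall {n : ℕ} (φ : (Fin n → ℝ) → ℝ) (x : Fin n → ℝ) (r : ℝ) : Set (Fin n → ℝ) :=
  {y | φ (y - x) < r}

/-- `E` satisfies the `rW_φ`-condition. -/
def rWCond {n : ℕ} (φ : (Fin n → ℝ) → ℝ) (E : Set (Fin n → ℝ)) (r : ℝ) : Prop :=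
  ∀ x ∈ frontier E, ∃ y, wulffBall φ y r ⊆ E ∧ x ∈ frontier (wulffBall φ y r)

/-- The Wulff plaquette `E^r`, the union of all Wulff balls of radius `r` contained
in `E` (with `E^0 = E`). -/
def plaquette {n : ℕ} (φ : (Fin n → ℝ) → ℝ) (E : Set (Fin n → ℝ)) (r : ℝ) :
    Set (Fin n → ℝ) :=
  if r = 0 then E else ⋃ (x) (_ : wulffBall φ x r ⊆ E), wulffBall φ x r

/-- `R_Ω`: the maximal `R > 0` such that some Wulff ball of radius `R` is contained in `Ω`. -/
def maxInradius {n : ℕ} (φ : (Fin n → ℝ) → ℝ) (Ω : Set (Fin n → ℝ)) : ℝ :=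
  sSup {R | 0 < R ∧ ∃ x, wulffBall φ x R ⊆ Ω}

/-- `r_Ω`: the maximal `r > 0` such that `Ω` satisfies the `rW_φ`-condition
(`0` if there is none, since `sSup ∅ = 0`). -/
def maxRollRadius {n : ℕ} (φ : (Fin n → ℝ) → ℝ) (Ω : Set (Fin n → ℝ)) : ℝ :=
  sSup {r | 0 < r ∧ rWCond φ Ω r}

/-- The set of points of Lebesgue density `1` of `E`. -/
def densityPoints {n : ℕ} (E : Set (Fin n → ℝ)) : Set (Fin n → ℝ) :=
  {x | Tendsto (fun r : ℝ => volume (E ∩ Metric.ball x r) / volume (Metric.ball x r))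
    (nhdsWithin 0 (Ioi 0)) (nhds 1)}

/-- `E` is a minimizer of problem (10): the constrained isoperimetric problem
minimizing `P_φ` among measurable subsets of `Ω` of prescribed measure `m`. -/
def IsIsopMinimizer {n : ℕ} (φ : (Fin n → ℝ) → ℝ) (Ω : Set (Fin n → ℝ)) (m : ℝ)
    (E : Set (Fin n → ℝ)) : Prop :=
  MeasurableSet E ∧ E ⊆ Ω ∧ (volume E).toReal = m ∧
    ∀ F, MeasurableSet F → F ⊆ Ω → (volume F).toReal = m →
      anisoPerimeter φ E ≤ anisoPerimeter φ F

/-- The Euclidean norm on `ℝ²`. -/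
def euclNorm (v : Fin 2 → ℝ) : ℝ := Real.sqrt (v 0 ^ 2 + v 1 ^ 2)

/-- The crystalline norm `φ(ν) = |ν₁| + |ν₂|` on `ℝ²`. -/
def crysNorm (v : Fin 2 → ℝ) : ℝ := |v 0| + |v 1|

/-- The open unit square `(0,1)² ⊆ ℝ²`. -/
def unitSquare : Set (Fin 2 → ℝ) := univ.pi fun _ => Ioo (0 : ℝ) 1

/-- The closed unit square `[0,1]² ⊆ ℝ²`. -/
def closedUnitSquare : Set (Fin 2 → ℝ) := univ.pi fun _ => Icc (0 : ℝ) 1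

/-- `j` is the essential supremum `‖u‖_∞` of `u`. -/
def IsEssSup (u : (Fin 2 → ℝ) → ℝ) (j : ℕ) : Prop :=
  (∀ᵐ x ∂volume, u x ≤ (j : ℝ)) ∧ ∀ c : ℝ, (∀ᵐ x ∂volume, u x ≤ c) → (j : ℝ) ≤ c

section PlanarIsoperimetry

open scoped Pointwise

/-- The plane. -/
abbrev Plane := Fin 2 → ℝ

namespace IsNorm

section General

variable {n : ℕ} {φ : (Fin n → ℝ) → ℝ} (hφ : IsNorm φ)

theorem map_zero (hφ : IsNorm φ) : φ 0 = 0 := (hφ.eq_zero_iff 0).2 rfl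

theorem map_neg (hφ : IsNorm φ) (x : Fin n → ℝ) : φ (-x) = φ x := by
  have := hφ.smul_eq (-1) x
  simpa using this

theorem sub_le (hφ : IsNorm φ) (x y z : Fin n → ℝ) : φ (x - z) ≤ φ (x - y) + φ (y - z) := by
  have := hφ.add_le (x - y) (y - z)
  simpa using this

theorem sum_le (hφ : IsNorm φ) {ι : Type*} (s : Finset ι) (f : ι → Fin n → ℝ) :
    φ (∑ i ∈ s, f i) ≤ ∑ i ∈ s, φ (f i) := by
  classical
  induction s using Finset.induction_on with
  | empty => simp [hφ.map_zero]
  | insert a s ha ih =>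
    rw [Finset.sum_insert ha, Finset.sum_insert ha]
    exact (hφ.add_le _ _).trans (by gcongr)

theorem exists_le_norm (hφ : IsNorm φ) : ∃ A > 0, ∀ x, φ x ≤ A * ‖x‖ := by
  refine ⟨∑ i, φ (Pi.single i 1) + 1, ?_, fun x => ?_⟩
  · have : 0 ≤ ∑ i, φ (Pi.single i 1 : Fin n → ℝ) := Finset.sum_nonneg fun i _ => hφ.nonneg _
    linarith
  have hx : x = ∑ i, x i • (Pi.single i 1 : Fin n → ℝ) := by
    ext j; simp [Finset.sum_apply, Pi.single_apply]
  calc φ x = φ (∑ i, x i • (Pi.single i 1 : Fin n → ℝ)) := by rw [← hx]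
    _ ≤ ∑ i, φ (x i • (Pi.single i 1 : Fin n → ℝ)) := hφ.sum_le _ _
    _ ≤ ∑ i, ‖x‖ * φ (Pi.single i 1 : Fin n → ℝ) := by
        gcongr with i
        rw [hφ.smul_eq]
        gcongr
        · exact hφ.nonneg _
        · exact norm_le_pi_norm x i
    _ ≤ _ := by
        rw [← Finset.mul_sum, add_mul, mul_comm]
        linarith [norm_nonneg x]

theorem continuous (hφ : IsNorm φ) : Continuous φ := by
  obtain ⟨A, hA, h⟩ := hφ.exists_le_norm
  have : LipschitzWith A.toNNReal φ := by
    refine LipschitzWith.of_le_add_mul _ fun x y => ?_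
    have h1 := hφ.add_le (x - y) y
    rw [sub_add_cancel] at h1
    have h2 := h (x - y)
    rw [dist_eq_norm]
    rw [Real.coe_toNNReal _ hA.le]
    linarith
  exact this.continuous

theorem exists_norm_le (hφ : IsNorm φ) : ∃ c > 0, ∀ x, c * ‖x‖ ≤ φ x := by
  rcases (Metric.sphere (0 : Fin n → ℝ) 1).eq_empty_or_nonempty with he | hne
  · refine ⟨1, one_pos, fun x => ?_⟩
    by_cases hx : x = 0
    · simp [hx, hφ.map_zero]
    · exfalso
      have : (‖x‖⁻¹ • x) ∈ Metric.sphere (0 : Fin n → ℝ) 1 := by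
        simp [norm_smul, hx]
      rw [he] at this
      exact this
  · obtain ⟨x0, hx0, hmin⟩ := (isCompact_sphere (0 : Fin n → ℝ) 1).exists_isMinOn hne
      hφ.continuous.continuousOn
    have hx0' : x0 ≠ 0 := by
      rintro rfl; simp at hx0
    refine ⟨φ x0, ?_, fun x => ?_⟩
    · exact lt_of_le_of_ne (hφ.nonneg _) fun h => hx0' ((hφ.eq_zero_iff _).1 h.symm)
    · by_cases hx : x = 0
      · simp [hx, hφ.map_zero]
      have hxn : 0 < ‖x‖ := norm_pos_iff.2 hx
      have hm : (‖x‖⁻¹ • x) ∈ Metric.sphere (0 : Fin n → ℝ) 1 := by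
        simp [norm_smul, hx]
      have := hmin hm
      simp only [mem_ofPred_eq, hφ.smul_eq, abs_inv, abs_norm] at this
      rw [← div_eq_inv_mul, le_div_iff₀ hxn] at this
      exact this

end General

end IsNorm

section Balls

variable {n : ℕ} {φ : (Fin n → ℝ) → ℝ}

theorem mem_wulffBall {x y : Fin n → ℝ} {r : ℝ} : y ∈ wulffBall φ x r ↔ φ (y - x) < r := Iff.rfl

theorem isOpen_wulffBall (hφ : IsNorm φ) (x : Fin n → ℝ) (r : ℝ) : IsOpen (wulffBall φ x r) :=
  isOpen_lt (hφ.continuous.comp (continuous_id.sub continuous_const)) continuous_const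

theorem convex_wulffBall (hφ : IsNorm φ) (x : Fin n → ℝ) (r : ℝ) :
    Convex ℝ (wulffBall φ x r) := by
  intro y hy z hz a b ha hb hab
  rw [mem_wulffBall] at *
  have e : a • y + b • z - x = a • (y - x) + b • (z - x) := by
    have : x = a • x + b • x := by rw [← add_smul, hab, one_smul]
    nth_rewrite 1 [this]
    rw [smul_sub, smul_sub]; abel
  rw [e]
  have h1 := hφ.add_le (a • (y - x)) (b • (z - x))
  rw [hφ.smul_eq, hφ.smul_eq, abs_of_nonneg ha, abs_of_nonneg hb] at h1
  rcases ha.eq_or_lt with rfl | ha'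
  · have : b = 1 := by linarith
    subst this; linarith
  · have h2 : a * φ (y - x) < a * r := mul_lt_mul_of_pos_left hy ha'
    have h3 : b * φ (z - x) ≤ b * r := mul_le_mul_of_nonneg_left hz.le hb
    have h4 : a * r + b * r = r := by rw [← add_mul, hab, one_mul]
    linarith

theorem mem_wulffBall_self (hφ : IsNorm φ) (x : Fin n → ℝ) {r : ℝ} (hr : 0 < r) :
    x ∈ wulffBall φ x r := by
  rw [mem_wulffBall, sub_self, hφ.map_zero]; exact hr

theorem wulffBall_mono (x : Fin n → ℝ) {r s : ℝ} (h : r ≤ s) :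
    wulffBall φ x r ⊆ wulffBall φ x s := fun _ hy => lt_of_lt_of_le hy h

theorem wulffBall_eq_empty (hφ : IsNorm φ) (x : Fin n → ℝ) {r : ℝ} (hr : r ≤ 0) :
    wulffBall φ x r = ∅ := by
  ext y; simp only [mem_wulffBall, mem_empty_iff_false, iff_false, not_lt]
  exact hr.trans (hφ.nonneg _)

theorem isBounded_wulffBall (hφ : IsNorm φ) (x : Fin n → ℝ) (r : ℝ) :
    Bornology.IsBounded (wulffBall φ x r) := by
  obtain ⟨c, hc, h⟩ := hφ.exists_norm_le
  refine (Metric.isBounded_ball (x := x) (r := r / c)).subset fun y hy => ?_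
  rw [Metric.mem_ball, dist_eq_norm, lt_div_iff₀ hc, mul_comm]
  exact (h _).trans_lt hy

theorem exists_ball_subset_wulffBall (hφ : IsNorm φ) :
    ∃ c > 0, ∀ (x : Fin n → ℝ) (r : ℝ), Metric.ball x (c * r) ⊆ wulffBall φ x r := by
  obtain ⟨A, hA, h⟩ := hφ.exists_le_norm
  refine ⟨A⁻¹, inv_pos.2 hA, fun x r y hy => ?_⟩
  rw [Metric.mem_ball, dist_eq_norm, ← div_eq_inv_mul, lt_div_iff₀ hA, mul_comm] at hy
  exact (h _).trans_lt hy

theorem mem_closure_wulffBall (hφ : IsNorm φ) {x y : Fin n → ℝ} {r : ℝ} (hr : 0 < r)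
    (h : φ (y - x) ≤ r) : y ∈ closure (wulffBall φ x r) := by
  have ht : Tendsto (fun k : ℕ => x + (1 - 1 / ((k : ℝ) + 1)) • (y - x)) atTop
      (nhds (x + (1 - 0 : ℝ) • (y - x))) := by
    refine tendsto_const_nhds.add ((tendsto_const_nhds.sub ?_).smul_const _)
    exact tendsto_one_div_add_atTop_nhds_zero_nat
  have : x + (1 - 0 : ℝ) • (y - x) = y := by simp
  rw [this] at ht
  refine mem_closure_of_tendsto ht (Eventually.of_forall fun k => ?_)
  rw [mem_wulffBall, add_sub_cancel_left, hφ.smul_eq]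
  have h1 : 0 < 1 / ((k : ℝ) + 1) := by positivity
  have h2 : 1 / ((k : ℝ) + 1) ≤ 1 := by
    rw [div_le_one (by positivity)]; linarith [(Nat.cast_nonneg k : (0:ℝ) ≤ k)]
  rw [abs_of_nonneg (by linarith)]
  nlinarith [hφ.nonneg (y - x)]

theorem wulffBall_eq_image (hφ : IsNorm φ) (x : Fin n → ℝ) {r : ℝ} (hr : 0 < r) :
    wulffBall φ x r = (fun z => x + z) '' (r • wulffBall φ 0 1) := by
  ext y
  simp only [mem_image, mem_wulffBall]
  constructor
  · intro h
    refine ⟨y - x, ⟨r⁻¹ • (y - x), ?_, by simp [smul_smul, hr.ne']⟩, by simp⟩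
    rw [mem_wulffBall, sub_zero, hφ.smul_eq, abs_of_pos (inv_pos.2 hr), ← div_eq_inv_mul,
      div_lt_one hr]
    exact h
  · rintro ⟨_, ⟨z, hz, rfl⟩, rfl⟩
    rw [mem_wulffBall, sub_zero] at hz
    simp only [add_sub_cancel_left]
    rw [hφ.smul_eq, abs_of_pos hr]
    nlinarith

theorem wulffBall_pos (hφ : IsNorm φ) : 0 < volume.real (wulffBall φ 0 1) := by
  rw [measureReal_def, ENNReal.toReal_pos_iff]
  exact ⟨(isOpen_wulffBall hφ 0 1).measure_pos _ ⟨0, mem_wulffBall_self hφ 0 one_pos⟩,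
    (isBounded_wulffBall hφ 0 1).measure_lt_top⟩

theorem volume_wulffBall {φ : Plane → ℝ} (hφ : IsNorm φ) (x : Plane) {r : ℝ} (hr : 0 ≤ r) :
    volume.real (wulffBall φ x r) = r ^ 2 * volume.real (wulffBall φ 0 1) := by
  rcases hr.eq_or_lt with rfl | hr'
  · simp [wulffBall_eq_empty hφ x le_rfl]
  rw [wulffBall_eq_image hφ x hr', measureReal_def, image_add_left, measure_preimage_add,
    Measure.addHaar_smul]
  simp only [measureReal_def, Module.finrank_fintype_fun_eq_card, Fintype.card_fin, toReal_mul]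
  rw [abs_of_nonneg (by positivity), ENNReal.toReal_ofReal (by positivity)]

end Balls

section ErosionDilation

variable {φ : Plane → ℝ}

/-- Erosion of `C` by the Wulff ball of radius `r`. -/
def er (φ : Plane → ℝ) (C : Set Plane) (r : ℝ) : Set Plane := {x | wulffBall φ x r ⊆ C}

/-- Dilation of `K` by the Wulff ball of radius `r`. -/
def dil (φ : Plane → ℝ) (K : Set Plane) (r : ℝ) : Set Plane := {y | ∃ k ∈ K, φ (y - k) < r}

theorem isOpen_dil (hφ : IsNorm φ) (K : Set Plane) (r : ℝ) : IsOpen (dil φ K r) := by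
  have : dil φ K r = ⋃ k ∈ K, wulffBall φ k r := by
    ext y; simp [dil, mem_wulffBall]
  rw [this]
  exact isOpen_biUnion fun k _ => isOpen_wulffBall hφ k r

theorem dil_mono_right (K : Set Plane) {r s : ℝ} (h : r ≤ s) : dil φ K r ⊆ dil φ K s :=
  fun _ ⟨k, hk, hy⟩ => ⟨k, hk, hy.trans_le h⟩

theorem dil_mono_left {K L : Set Plane} (h : K ⊆ L) (r : ℝ) : dil φ K r ⊆ dil φ L r :=
  fun _ ⟨k, hk, hy⟩ => ⟨k, h hk, hy⟩

theorem dil_er_subset (C : Set Plane) (r : ℝ) : dil φ (er φ C r) r ⊆ C :=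
  fun _ ⟨_, hk, hy⟩ => hk hy

theorem er_mono_left {C D : Set Plane} (h : C ⊆ D) (r : ℝ) : er φ C r ⊆ er φ D r :=
  fun _ hx => Subset.trans hx h

theorem er_anti_right (C : Set Plane) {r s : ℝ} (h : r ≤ s) : er φ C s ⊆ er φ C r :=
  fun x hx => Subset.trans (wulffBall_mono x h) hx

theorem isBounded_dil (hφ : IsNorm φ) {K : Set Plane} (hK : Bornology.IsBounded K) (r : ℝ) :
    Bornology.IsBounded (dil φ K r) := by
  obtain ⟨c, hc, h⟩ := hφ.exists_norm_le
  refine (hK.thickening (δ := r / c)).subset ?_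
  rintro y ⟨k, hk, hy⟩
  rw [Metric.mem_thickening_iff]
  refine ⟨k, hk, ?_⟩
  rw [dist_eq_norm, lt_div_iff₀ hc, mul_comm]
  exact (h _).trans_lt hy

theorem convex_dil (hφ : IsNorm φ) {K : Set Plane} (hK : Convex ℝ K) (r : ℝ) :
    Convex ℝ (dil φ K r) := by
  have : dil φ K r = K + wulffBall φ 0 r := by
    ext y
    rw [Set.mem_add]
    constructor
    · rintro ⟨k, hk, hy⟩
      exact ⟨k, hk, y - k, by simpa [mem_wulffBall] using hy, by simp⟩
    · rintro ⟨k, hk, z, hz, rfl⟩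
      exact ⟨k, hk, by simpa [mem_wulffBall] using hz⟩
  rw [this]
  exact hK.add (convex_wulffBall hφ 0 r)

theorem convex_er {C : Set Plane} (hC : Convex ℝ C) (r : ℝ) : Convex ℝ (er φ C r) := by
  intro x hx y hy a b ha hb hab z hz
  have e : z = a • (z - (a • x + b • y) + x) + b • (z - (a • x + b • y) + y) := by
    have : z - (a • x + b • y) = a • (z - (a • x + b • y)) + b • (z - (a • x + b • y)) := by
      rw [← add_smul, hab, one_smul]
    rw [smul_add, smul_add, add_add_add_comm, ← this]; abel
  rw [e]
  refine hC (hx ?_) (hy ?_) ha hb hab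
  · rw [mem_wulffBall, add_sub_cancel_right]; exact hz
  · rw [mem_wulffBall, add_sub_cancel_right]; exact hz

theorem isClosed_er (hφ : IsNorm φ) {C : Set Plane} {r : ℝ} : IsClosed (er φ C r) := by
  have : er φ C r = ⋂ z ∈ Cᶜ, {x | r ≤ φ (z - x)} := by
    ext x
    simp only [er, mem_ofPred_eq, mem_iInter, mem_compl_iff]
    constructor
    · intro h z hz
      by_contra hlt
      exact hz (h (not_le.1 hlt))
    · intro h z hz
      by_contra hlt
      exact absurd hz (not_lt.2 (h z hlt))
  rw [this]
  exact isClosed_biInter fun z _ =>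
    isClosed_le continuous_const (hφ.continuous.comp (continuous_const.sub continuous_id))

theorem er_subset (hφ : IsNorm φ) {C : Set Plane} {r : ℝ} (hr : 0 < r) : er φ C r ⊆ C :=
  fun x hx => hx (mem_wulffBall_self hφ x hr)

theorem plaquette_eq_dil {C : Set Plane} {r : ℝ} (hr : r ≠ 0) :
    plaquette φ C r = dil φ (er φ C r) r := by
  ext y
  simp [plaquette, hr, dil, er, mem_wulffBall]

theorem er_add_dil (hφ : IsNorm φ) {C : Set Plane} {x : Plane} {r s : ℝ} (hr : 0 < r) (hs : 0 < s)
    (h : wulffBall φ x s ⊆ er φ C r) : wulffBall φ x (r + s) ⊆ C := by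
  intro y hy
  rw [mem_wulffBall] at hy
  have hrs : 0 < r + s := by linarith
  have hz : x + (s / (r + s)) • (y - x) ∈ wulffBall φ x s := by
    rw [mem_wulffBall, add_sub_cancel_left, hφ.smul_eq, abs_of_pos (by positivity), div_mul_eq_mul_div,
      div_lt_iff₀ hrs]
    nlinarith
  refine h hz ?_
  rw [mem_wulffBall]
  have : y - (x + (s / (r + s)) • (y - x)) = (r / (r + s)) • (y - x) := by
    have e : r / (r + s) = 1 - s / (r + s) := by field_simp; ring
    rw [e, sub_smul, one_smul]; abel
  rw [this, hφ.smul_eq, abs_of_pos (by positivity), div_mul_eq_mul_div, div_lt_iff₀ hrs]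
  nlinarith

theorem er_er_subset (hφ : IsNorm φ) {C : Set Plane} {r s : ℝ} (hr : 0 < r) (hs : 0 < s) :
    er φ (er φ C r) s ⊆ er φ C (r + s) := fun _ hx => er_add_dil hφ hr hs hx

theorem er_add_subset_er_er (hφ : IsNorm φ) {C : Set Plane} {r s : ℝ} :
    er φ C (r + s) ⊆ er φ (er φ C r) s := by
  intro x hx y hy z hz
  refine hx ?_
  rw [mem_wulffBall] at *
  linarith [hφ.sub_le z y x]

end ErosionDilation

/-- The two-dimensional cross product. -/
def cr (x v : Plane) : ℝ := x 0 * v 1 - x 1 * v 0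

/-- The cross product with a fixed second factor, as a linear form. -/
def crL (v : Plane) : Plane →L[ℝ] ℝ :=
  v 1 • ContinuousLinearMap.proj (R := ℝ) (φ := fun _ : Fin 2 => ℝ) 0 -
    v 0 • ContinuousLinearMap.proj (R := ℝ) (φ := fun _ : Fin 2 => ℝ) 1

theorem crL_apply (v x : Plane) : crL v x = cr x v := by
  simp [crL, cr]; ring

theorem cr_self (v : Plane) : cr v v = 0 := by simp [cr]; ring

theorem cr_smul_left (a : ℝ) (x v : Plane) : cr (a • x) v = a * cr x v := by simp [cr]; ring

theorem cr_smul_right (a : ℝ) (x v : Plane) : cr x (a • v) = a * cr x v := by simp [cr]; ring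

/-- The vector `n` parallel to the rotation of `v` with `cr n v = 1`. -/
def nv (v : Plane) : Plane := (v 0 ^ 2 + v 1 ^ 2)⁻¹ • ![v 1, -v 0]

theorem sq_add_sq_pos {v : Plane} (hv : v ≠ 0) : 0 < v 0 ^ 2 + v 1 ^ 2 := by
  by_contra h
  refine hv (funext fun i => ?_)
  have h0 : v 0 = 0 := by nlinarith [sq_nonneg (v 0), sq_nonneg (v 1)]
  have h1 : v 1 = 0 := by nlinarith [sq_nonneg (v 0), sq_nonneg (v 1)]
  fin_cases i <;> simp [h0, h1]

theorem cr_nv {v : Plane} (hv : v ≠ 0) : cr (nv v) v = 1 := by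
  have := (sq_add_sq_pos hv).ne'
  simp [cr, nv]
  field_simp
  ring

/-- Measure preserving coordinates whose second axis is in direction `v`. -/
def coord (v : Plane) (p : ℝ × ℝ) : Plane := p.1 • nv v + p.2 • v

theorem continuous_coord (v : Plane) : Continuous (coord v) := by
  unfold coord; fun_prop

theorem crL_coord {v : Plane} (hv : v ≠ 0) (p : ℝ × ℝ) : crL v (coord v p) = p.1 := by
  have h1 := crL_apply v (nv v)
  have h2 := crL_apply v v
  rw [cr_nv hv] at h1
  rw [cr_self] at h2
  simp [coord, h1, h2]

theorem coord_add (v : Plane) (s y t : ℝ) : coord v (s, y + t) = coord v (s, y) + t • v := by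
  simp [coord, add_smul, add_assoc]

theorem coord_surj {v : Plane} (hv : v ≠ 0) (x : Plane) : ∃ y, coord v (crL v x, y) = x := by
  have h := (sq_add_sq_pos hv).ne'
  refine ⟨(x 0 * v 0 + x 1 * v 1) / (v 0 ^ 2 + v 1 ^ 2), funext fun i => ?_⟩
  rw [crL_apply]
  fin_cases i
  · simp [coord, nv, cr]; field_simp; ring
  · simp [coord, nv, cr]; field_simp; ring

theorem measurePreserving_coord {v : Plane} (hv : v ≠ 0) : MeasurePreserving (coord v) := by
  let M : Matrix (Fin 2) (Fin 2) ℝ := !![nv v 0, v 0; nv v 1, v 1]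
  have hdet : LinearMap.det (Matrix.toLin' M) = 1 := by
    rw [LinearMap.det_toLin', Matrix.det_fin_two_of]
    have := cr_nv hv
    rw [cr] at this
    linarith
  have h1 : MeasurePreserving (Matrix.toLin' M) (volume : Measure Plane) volume := by
    refine ⟨(LinearMap.continuous_of_finiteDimensional _).measurable, ?_⟩
    rw [Measure.map_linearMap_addHaar_eq_smul_addHaar _ (by rw [hdet]; exact one_ne_zero), hdet]
    simp
  have h2 := h1.comp (volume_preserving_finTwoArrow ℝ).symm
  have e : coord v = Matrix.toLin' M ∘ MeasurableEquiv.finTwoArrow.symm := by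
    refine funext fun p => funext fun i => ?_
    fin_cases i <;> simp [coord, M, MeasurableEquiv.finTwoArrow, Matrix.mulVec, dotProduct,
      Fin.sum_univ_two] <;> ring
  rw [e]
  exact h2

/-- The fiber of `S` along `v` over the value `s` of the linear form `crL v`. -/
def fib (v : Plane) (S : Set Plane) (s : ℝ) : Set ℝ := {y | coord v (s, y) ∈ S}

theorem measurableSet_fib {v : Plane} {S : Set Plane} (hS : MeasurableSet S) (s : ℝ) :
    MeasurableSet (fib v S s) := by
  have : Continuous fun y : ℝ => coord v (s, y) :=
    (continuous_coord v).comp (by fun_prop)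
  exact this.measurable hS

theorem volume_eq_lintegral_fib {v : Plane} (hv : v ≠ 0) {S : Set Plane} (hS : MeasurableSet S) :
    volume S = ∫⁻ s, volume (fib v S s) := by
  rw [← (measurePreserving_coord hv).measure_preimage hS.nullMeasurableSet, Measure.volume_eq_prod,
    Measure.prod_apply ((continuous_coord v).measurable hS)]
  rfl

theorem measurable_volume_fib {v : Plane} {S : Set Plane} (hS : MeasurableSet S) :
    Measurable fun s => volume (fib v S s) :=
  measurable_measure_prodMk_left ((continuous_coord v).measurable hS)

theorem isCompact_fib {v : Plane} (hv : v ≠ 0) {S : Set Plane} (hS : IsCompact S) (s : ℝ) :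
    IsCompact (fib v S s) := by
  have hc : Continuous fun y : ℝ => coord v (s, y) := (continuous_coord v).comp (by fun_prop)
  refine Metric.isCompact_of_isClosed_isBounded (hS.isClosed.preimage hc) ?_
  obtain ⟨B, hB⟩ := hS.isBounded.exists_norm_le
  have hvn : 0 < ‖v‖ := norm_pos_iff.2 hv
  refine (Metric.isBounded_closedBall (x := (0 : ℝ)) (r := (B + ‖s • nv v‖) / ‖v‖)).subset
    fun y hy => ?_
  rw [Metric.mem_closedBall, dist_zero_right, le_div_iff₀ hvn, ← norm_smul]
  have h1 := hB _ hy
  have h2 : y • v = coord v (s, y) - s • nv v := by simp [coord]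
  rw [h2]
  exact (norm_sub_le _ _).trans (by linarith)

theorem convex_fib {v : Plane} {S : Set Plane} (hS : Convex ℝ S) (s : ℝ) :
    Convex ℝ (fib v S s) := by
  intro y hy z hz a b ha hb hab
  have := hS hy hz ha hb hab
  have e : coord v (s, a • y + b • z) = a • coord v (s, y) + b • coord v (s, z) := by
    simp only [coord, smul_add, smul_smul, smul_eq_mul, add_smul]
    rw [add_add_add_comm, ← add_smul (a * s), ← add_mul, hab, one_mul]
  show coord v (s, a • y + b • z) ∈ S
  rwa [e]

theorem fib_nonempty_iff {v : Plane} (hv : v ≠ 0) {S : Set Plane} {s : ℝ} :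
    (fib v S s).Nonempty ↔ s ∈ crL v '' S := by
  constructor
  · rintro ⟨y, hy⟩
    exact ⟨_, hy, crL_coord hv _⟩
  · rintro ⟨x, hx, rfl⟩
    obtain ⟨y, hy⟩ := coord_surj hv x
    exact ⟨y, by rw [fib, mem_ofPred_eq, hy]; exact hx⟩

theorem exists_eq_Icc {S : Set ℝ} (hne : S.Nonempty) (hc : IsCompact S) (hS : Convex ℝ S) :
    ∃ a b, a ≤ b ∧ S = Icc a b := by
  have h := eq_Icc_of_connected_compact ⟨hne, hS.isPreconnected⟩ hc
  refine ⟨_, _, ?_, h⟩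
  rw [h] at hne
  exact nonempty_Icc.1 hne

/-- The segment `[-v, v]`. -/
def sg (v : Plane) : Set Plane := (fun t : ℝ => t • v) '' Icc (-1) 1

theorem isCompact_sg (v : Plane) : IsCompact (sg v) :=
  isCompact_Icc.image (by fun_prop)

theorem convex_sg (v : Plane) : Convex ℝ (sg v) := by
  have := (convex_Icc (-1 : ℝ) 1).linear_image (LinearMap.toSpanSingleton ℝ Plane v)
  exact this

theorem zero_mem_sg (v : Plane) : (0 : Plane) ∈ sg v := ⟨0, by simp, by simp⟩

/-- The width of `C` measured by the linear form `crL v`. -/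
def wd (v : Plane) (C : Set Plane) : ℝ := volume.real (crL v '' C)

theorem image_crL_eq_Icc {v : Plane} {C : Set Plane} (hc : IsCompact C) (hC : Convex ℝ C)
    (hne : C.Nonempty) : ∃ a b, a ≤ b ∧ crL v '' C = Icc a b :=
  exists_eq_Icc (hne.image _) (hc.image (crL v).continuous) (hC.linear_image (crL v).toLinearMap)

theorem volume_image_crL {v : Plane} {C : Set Plane} (hc : IsCompact C) :
    volume (crL v '' C) = ENNReal.ofReal (wd v C) :=
  (ofReal_measureReal (hc.image (crL v).continuous).measure_lt_top.ne).symm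

theorem wd_add_sg (u v : Plane) {C : Set Plane} (hc : IsCompact C) (hC : Convex ℝ C)
    (hne : C.Nonempty) : wd u (C + sg v) = wd u C + 2 * |cr v u| := by
  obtain ⟨a, b, hab, h⟩ := image_crL_eq_Icc (v := u) hc hC hne
  have h2 : crL u '' (C + sg v) = Icc (a - |cr v u|) (b + |cr v u|) := by
    rw [image_add, h, sg, image_image]
    have : (fun t : ℝ => crL u (t • v)) '' Icc (-1) 1 = Icc (-|cr v u|) (|cr v u|) := by
      have e : (fun t : ℝ => crL u (t • v)) = fun t => t * cr v u := by
        funext t; rw [map_smul, crL_apply, smul_eq_mul]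
      rw [e]
      rcases le_total 0 (cr v u) with h0 | h0
      · rw [abs_of_nonneg h0]
        rcases h0.eq_or_lt with h0 | h0
        · rw [← h0]; simp
        · rw [image_mul_right_Icc (by norm_num) h0.le]; simp
      · rw [abs_of_nonpos h0]
        rcases h0.eq_or_lt with h0 | h0
        · rw [h0]; simp
        · have : (fun t : ℝ => t * cr v u) '' Icc (-1) 1 =
            (fun t : ℝ => t * (-cr v u)) '' ((fun t => -t) '' Icc (-1) 1) := by
            rw [image_image]; simp
          rw [this, image_neg_eq_neg]
          simp only [neg_Icc, neg_neg]
          rw [image_mul_right_Icc (by norm_num) (by linarith)]; simp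
    rw [this, Icc_add_Icc hab (by linarith [abs_nonneg (cr v u)])]
    congr 1
  have h0 := abs_nonneg (cr v u)
  rw [wd, wd, h, h2, measureReal_def, measureReal_def, Real.volume_Icc, Real.volume_Icc,
    toReal_ofReal (by linarith), toReal_ofReal (by linarith)]
  ring

theorem sg_zero : sg (0 : Plane) = {0} := by
  ext x; simp only [sg, smul_zero, mem_image, mem_singleton_iff]
  constructor
  · rintro ⟨_, _, h⟩; exact h.symm
  · rintro rfl; exact ⟨0, by simp, rfl⟩

theorem wd_zero (C : Set Plane) : wd 0 C = 0 := by
  have : crL (0 : Plane) '' C ⊆ {0} := by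
    rintro _ ⟨x, _, rfl⟩; simp [crL]
  rw [wd, measureReal_def, measure_mono_null this (by simp)]; rfl

theorem volume_add_sg (v : Plane) {C : Set Plane} (hc : IsCompact C) (hC : Convex ℝ C) :
    volume.real (C + sg v) = volume.real C + 2 * wd v C := by
  by_cases hv : v = 0
  · subst hv; rw [sg_zero, wd_zero]; simp
  have hcs : IsCompact (C + sg v) := hc.add (isCompact_sg v)
  have key : volume (C + sg v) = volume C + 2 * volume (crL v '' C) := by
    rw [volume_eq_lintegral_fib hv hcs.measurableSet, volume_eq_lintegral_fib hv hc.measurableSet]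
    have hm : MeasurableSet (crL v '' C) := (hc.image (crL v).continuous).measurableSet
    rw [← lintegral_indicator_const hm, ← lintegral_add_left (measurable_volume_fib hc.measurableSet)]
    refine lintegral_congr fun s => ?_
    have hf : fib v (C + sg v) s = fib v C s + Icc (-1) 1 := by
      ext y
      simp only [fib, mem_ofPred_eq, Set.mem_add]
      constructor
      · rintro ⟨x, hx, _, ⟨t, ht, rfl⟩, h⟩
        refine ⟨y - t, ?_, t, ht, by ring⟩
        have : coord v (s, y - t) = x := by
          rw [sub_eq_add_neg, coord_add, ← h]; simp
        rwa [this]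
      · rintro ⟨z, hz, t, ht, rfl⟩
        exact ⟨_, hz, t • v, ⟨t, ht, rfl⟩, (coord_add v s z t).symm⟩
    rw [hf]
    by_cases hs : s ∈ crL v '' C
    · rw [indicator_of_mem hs]
      obtain ⟨a, b, hab, h⟩ := exists_eq_Icc ((fib_nonempty_iff hv).2 hs) (isCompact_fib hv hc s)
        (convex_fib hC s)
      rw [h, Icc_add_Icc hab (by norm_num), Real.volume_Icc, Real.volume_Icc,
        ← ENNReal.ofReal_ofNat, ← ENNReal.ofReal_add (by linarith) (by norm_num)]
      congr 1; ring
    · rw [indicator_of_notMem hs]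
      have : fib v C s = ∅ := by
        rw [← not_nonempty_iff_eq_empty, fib_nonempty_iff hv]; exact hs
      simp [this]
  rw [measureReal_def, key, ENNReal.toReal_add hc.measure_lt_top.ne
    (by rw [volume_image_crL hc]; exact ENNReal.mul_ne_top (by simp) (by simp)), ENNReal.toReal_mul]
  rfl

/-- Erosion of `C` by the segment `[-v, v]`. -/
def erSg (v : Plane) (C : Set Plane) : Set Plane := {x | ∀ t ∈ Icc (-1 : ℝ) 1, x + t • v ∈ C}

theorem erSg_subset (v : Plane) (C : Set Plane) : erSg v C ⊆ C := fun x hx => by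
  simpa using hx 0 (by simp)

theorem erSg_add_subset (v : Plane) (C : Set Plane) : erSg v C + sg v ⊆ C := by
  rintro _ ⟨x, hx, _, ⟨t, ht, rfl⟩, rfl⟩
  exact hx t ht

theorem isCompact_erSg (v : Plane) {C : Set Plane} (hc : IsCompact C) : IsCompact (erSg v C) := by
  refine hc.of_isClosed_subset ?_ (erSg_subset v C)
  have : erSg v C = ⋂ t ∈ Icc (-1 : ℝ) 1, (fun x => x + t • v) ⁻¹' C := by
    ext x; simp [erSg]
  rw [this]
  exact isClosed_biInter fun t _ => hc.isClosed.preimage (by fun_prop)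

theorem convex_erSg (v : Plane) {C : Set Plane} (hC : Convex ℝ C) : Convex ℝ (erSg v C) := by
  intro x hx y hy a b ha hb hab t ht
  have := hC (hx t ht) (hy t ht) ha hb hab
  rwa [smul_add, smul_add, add_add_add_comm, ← add_smul, hab, one_smul] at this

theorem wd_mono {u : Plane} {C D : Set Plane} (hD : IsCompact D) (h : C ⊆ D) :
    wd u C ≤ wd u D :=
  measureReal_mono (image_mono h) (hD.image (crL u).continuous).measure_lt_top.ne

theorem wd_erSg (u v : Plane) {C : Set Plane} (hc : IsCompact C) (hC : Convex ℝ C)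
    (hne : (erSg v C).Nonempty) : wd u (erSg v C) + 2 * |cr v u| ≤ wd u C := by
  rw [← wd_add_sg u v (isCompact_erSg v hc) (convex_erSg v hC) hne]
  exact wd_mono hc (erSg_add_subset v C)

theorem volume_le_erSg (v : Plane) {C : Set Plane} (hc : IsCompact C) (hC : Convex ℝ C) :
    volume.real C ≤ volume.real (erSg v C) + 2 * wd v C := by
  by_cases hv : v = 0
  · subst hv
    have : erSg 0 C = C := by
      refine (erSg_subset 0 C).antisymm fun x hx t _ => by simpa using hx
    rw [this, wd_zero]; simp
  have hcs := isCompact_erSg v hc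
  have key : volume C ≤ volume (erSg v C) + 2 * volume (crL v '' C) := by
    rw [volume_eq_lintegral_fib hv hcs.measurableSet, volume_eq_lintegral_fib hv hc.measurableSet]
    have hm : MeasurableSet (crL v '' C) := (hc.image (crL v).continuous).measurableSet
    rw [← lintegral_indicator_const hm, ← lintegral_add_left (measurable_volume_fib hcs.measurableSet)]
    refine lintegral_mono fun s => ?_
    by_cases hs : s ∈ crL v '' C
    · rw [indicator_of_mem hs]
      obtain ⟨a, b, hab, h⟩ := exists_eq_Icc ((fib_nonempty_iff hv).2 hs) (isCompact_fib hv hc s)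
        (convex_fib hC s)
      have hsub : Icc (a + 1) (b - 1) ⊆ fib v (erSg v C) s := by
        intro y hy t ht
        rw [← coord_add]
        have : y + t ∈ fib v C s := by
          rw [h]; exact ⟨by linarith [hy.1, ht.1], by linarith [hy.2, ht.2]⟩
        exact this
      refine le_trans ?_ (add_le_add_left (measure_mono hsub) _)
      rw [h, Real.volume_Icc, Real.volume_Icc, ← ENNReal.ofReal_ofNat]
      refine le_trans (ENNReal.ofReal_le_ofReal ?_) ENNReal.ofReal_add_le
      linarith
    · have : fib v C s = ∅ := by
        rw [← not_nonempty_iff_eq_empty, fib_nonempty_iff hv]; exact hs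
      simp [this]
  have hfin : volume (erSg v C) + 2 * volume (crL v '' C) ≠ ⊤ := by
    rw [volume_image_crL hc]
    exact ENNReal.add_ne_top.2 ⟨hcs.measure_lt_top.ne, ENNReal.mul_ne_top (by simp) (by simp)⟩
  have := ENNReal.toReal_mono hfin key
  rw [ENNReal.toReal_add hcs.measure_lt_top.ne
    (by rw [volume_image_crL hc]; exact ENNReal.mul_ne_top (by simp) (by simp)),
    ENNReal.toReal_mul] at this
  exact this

/-- The zonotope with generators `l`, i.e. the Minkowski sum of the segments `[-v, v]`. -/
def zono : List Plane → Set Plane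
  | [] => {0}
  | v :: l => sg v + zono l

/-- The linear coefficient of the Steiner polynomial of `C` relative to `zono l`. -/
def zP (l : List Plane) (C : Set Plane) : ℝ := (l.map fun v => 2 * wd v C).sum

/-- The area of `zono l`. -/
def zA : List Plane → ℝ
  | [] => 0
  | v :: l => zA l + (l.map fun u => 4 * |cr v u|).sum

theorem isCompact_zono (l : List Plane) : IsCompact (zono l) := by
  induction l with
  | nil => exact isCompact_singleton
  | cons v l ih => exact (isCompact_sg v).add ih

theorem convex_zono (l : List Plane) : Convex ℝ (zono l) := by
  induction l with
  | nil => exact convex_singleton 0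
  | cons v l ih => exact (convex_sg v).add ih

theorem zero_mem_zono (l : List Plane) : (0 : Plane) ∈ zono l := by
  induction l with
  | nil => rfl
  | cons v l ih => exact ⟨0, zero_mem_sg v, 0, ih, by simp⟩

theorem zP_add_sg (l : List Plane) (v : Plane) {C : Set Plane} (hc : IsCompact C)
    (hC : Convex ℝ C) (hne : C.Nonempty) :
    zP l (C + sg v) = zP l C + (l.map fun u => 4 * |cr v u|).sum := by
  induction l with
  | nil => simp [zP]
  | cons u l ih =>
    simp only [zP, List.map_cons, List.sum_cons] at *
    rw [ih, wd_add_sg u v hc hC hne]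
    ring

theorem zP_erSg (l : List Plane) (v : Plane) {C : Set Plane} (hc : IsCompact C)
    (hC : Convex ℝ C) (hne : (erSg v C).Nonempty) :
    zP l (erSg v C) + (l.map fun u => 4 * |cr v u|).sum ≤ zP l C := by
  induction l with
  | nil => simp [zP]
  | cons u l ih =>
    simp only [zP, List.map_cons, List.sum_cons] at *
    linarith [wd_erSg u v hc hC hne]

theorem volume_add_zono (l : List Plane) {C : Set Plane} (hc : IsCompact C) (hC : Convex ℝ C)
    (hne : C.Nonempty) : volume.real (C + zono l) = volume.real C + zP l C + zA l := by
  induction l generalizing C with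
  | nil => simp [zono, zP, zA]
  | cons v l ih =>
    have h := ih (hc.add (isCompact_sg v)) (hC.add (convex_sg v))
      (hne.add ⟨0, zero_mem_sg v⟩)
    rw [zono, ← add_assoc, h, volume_add_sg v hc hC, zP_add_sg l v hc hC hne]
    simp only [zP, zA, List.map_cons, List.sum_cons]
    ring

/-- Erosion of `C` by `zono l`. -/
def erZ (l : List Plane) (C : Set Plane) : Set Plane := {x | ∀ z ∈ zono l, x + z ∈ C}

theorem erZ_cons (v : Plane) (l : List Plane) (C : Set Plane) :
    erZ (v :: l) C = erZ l (erSg v C) := by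
  ext x
  simp only [erZ, erSg, mem_ofPred_eq, zono]
  constructor
  · intro h z hz t ht
    have := h (t • v + z) ⟨t • v, ⟨t, ht, rfl⟩, z, hz, rfl⟩
    rwa [add_assoc, add_comm z]
  · rintro h _ ⟨_, ⟨t, ht, rfl⟩, z, hz, rfl⟩
    have := h z hz t ht
    simp only
    rwa [add_assoc, add_comm z] at this

theorem erZ_subset (l : List Plane) (C : Set Plane) : erZ l C ⊆ C := fun x hx => by
  simpa using hx 0 (zero_mem_zono l)

theorem le_volume_erZ (l : List Plane) {C : Set Plane} (hc : IsCompact C) (hC : Convex ℝ C)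
    (hne : (erZ l C).Nonempty) :
    volume.real C - zP l C + zA l ≤ volume.real (erZ l C) := by
  induction l generalizing C with
  | nil => simp [erZ, zono, zP, zA]
  | cons v l ih =>
    rw [erZ_cons] at hne ⊢
    have h := ih (isCompact_erSg v hc) (convex_erSg v hC) hne
    have h1 := volume_le_erSg v hc hC
    have h2 := zP_erSg l v hc hC (hne.mono (erZ_subset _ _))
    simp only [zP, zA, List.map_cons, List.sum_cons] at *
    linarith

theorem sg_smul (s : ℝ) (v : Plane) : sg (s • v) = s • sg v := by
  ext x
  simp only [sg, mem_image, mem_smul_set]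
  constructor
  · rintro ⟨t, ht, rfl⟩; exact ⟨_, ⟨t, ht, rfl⟩, smul_comm s t v⟩
  · rintro ⟨_, ⟨t, ht, rfl⟩, rfl⟩; exact ⟨t, ht, smul_comm t s v⟩

theorem zono_smul (s : ℝ) (l : List Plane) : zono (l.map (s • ·)) = s • zono l := by
  induction l with
  | nil => simp [zono]
  | cons v l ih => simp only [List.map_cons, zono, ih, sg_smul, smul_add]

theorem wd_smul (s : ℝ) (v : Plane) (C : Set Plane) : wd (s • v) C = |s| * wd v C := by
  have : crL (s • v) '' C = s • (crL v '' C) := by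
    rw [← image_smul, image_image]
    refine image_congr fun x _ => ?_
    rw [crL_apply, cr_smul_right, crL_apply, smul_eq_mul]
  rw [wd, this, measureReal_def, Measure.addHaar_smul]
  simp [wd, measureReal_def]

theorem zP_smul {s : ℝ} (hs : 0 ≤ s) (l : List Plane) (C : Set Plane) :
    zP (l.map (s • ·)) C = s * zP l C := by
  induction l with
  | nil => simp [zP]
  | cons v l ih =>
    simp only [zP, List.map_cons, List.sum_cons] at *
    rw [ih, wd_smul, abs_of_nonneg hs]; ring

theorem zA_smul {s : ℝ} (hs : 0 ≤ s) (l : List Plane) :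
    zA (l.map (s • ·)) = s ^ 2 * zA l := by
  induction l with
  | nil => simp [zA]
  | cons v l ih =>
    simp only [List.map_cons, zA, ih, List.map_map, mul_add]
    congr 1
    rw [← List.sum_map_mul_left]
    congr 1
    refine List.map_congr_left fun u _ => ?_
    simp only [Function.comp, cr_smul_left, cr_smul_right, abs_mul, abs_of_nonneg hs]; ring

theorem volume_add_smul_zono (l : List Plane) {s : ℝ} (hs : 0 ≤ s) {C : Set Plane}
    (hc : IsCompact C) (hC : Convex ℝ C) (hne : C.Nonempty) :
    volume.real (C + s • zono l) = volume.real C + s * zP l C + s ^ 2 * zA l := by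
  rw [← zono_smul, volume_add_zono _ hc hC hne, zP_smul hs, zA_smul hs]

theorem mem_erZ_smul {s : ℝ} {l : List Plane} {C : Set Plane} {x : Plane} :
    x ∈ erZ (l.map (s • ·)) C ↔ ∀ z ∈ zono l, x + s • z ∈ C := by
  simp only [erZ, mem_ofPred_eq, zono_smul, mem_smul_set]
  constructor
  · intro h z hz; exact h _ ⟨z, hz, rfl⟩
  · rintro h _ ⟨z, hz, rfl⟩; exact h z hz

theorem le_volume_erZ_smul (l : List Plane) {s : ℝ} (hs : 0 ≤ s) {C : Set Plane}
    (hc : IsCompact C) (hC : Convex ℝ C) (hne : (erZ (l.map (s • ·)) C).Nonempty) :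
    volume.real C - s * zP l C + s ^ 2 * zA l ≤ volume.real (erZ (l.map (s • ·)) C) := by
  have := le_volume_erZ _ hc hC hne
  rwa [zP_smul hs, zA_smul hs] at this

theorem zP_nonneg (l : List Plane) (C : Set Plane) : 0 ≤ zP l C := by
  refine List.sum_nonneg ?_
  intro x hx
  obtain ⟨v, _, rfl⟩ := List.mem_map.1 hx
  have : 0 ≤ wd v C := measureReal_nonneg
  linarith

theorem le_of_mem_zono (ℓ : Plane →L[ℝ] ℝ) {l : List Plane} {x : Plane} (hx : x ∈ zono l) :
    ℓ x ≤ (l.map fun v => |ℓ v|).sum := by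
  induction l generalizing x with
  | nil => rw [zono, mem_singleton_iff] at hx; simp [hx]
  | cons v l ih =>
    obtain ⟨_, ⟨t, ht, rfl⟩, z, hz, rfl⟩ := hx
    have h1 : t * ℓ v ≤ |ℓ v| := by
      refine (le_abs_self _).trans ?_
      rw [abs_mul]
      have := abs_le.2 ht
      nlinarith [abs_nonneg (ℓ v)]
    simp only [List.map_cons, List.sum_cons, map_add, map_smul, smul_eq_mul]
    linarith [ih hz]

theorem exists_mem_zono (ℓ : Plane →L[ℝ] ℝ) (l : List Plane) :
    ∃ x ∈ zono l, ℓ x = (l.map fun v => |ℓ v|).sum := by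
  induction l with
  | nil => exact ⟨0, rfl, by simp⟩
  | cons v l ih =>
    obtain ⟨z, hz, h⟩ := ih
    rcases le_total 0 (ℓ v) with h0 | h0
    · refine ⟨(1 : ℝ) • v + z, ⟨_, ⟨1, by simp, rfl⟩, z, hz, rfl⟩, ?_⟩
      simp [h, abs_of_nonneg h0]
    · refine ⟨(-1 : ℝ) • v + z, ⟨_, ⟨-1, by simp, rfl⟩, z, hz, rfl⟩, ?_⟩
      simp [h, abs_of_nonpos h0]

/-- The total variation of a finite sequence which increases up to `k` and decreases after. -/
theorem sum_abs_sub_eq_of_unimodal {g : ℕ → ℝ} {n k : ℕ} (hk : k ≤ n)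
    (h1 : ∀ i < k, g i ≤ g (i + 1)) (h2 : ∀ i, k ≤ i → i < n → g (i + 1) ≤ g i) :
    ∑ i ∈ Finset.range n, |g (i + 1) - g i| = 2 * g k - g 0 - g n := by
  induction n with
  | zero => obtain rfl : k = 0 := by omega
            simp; ring
  | succ n ih =>
    rw [Finset.sum_range_succ]
    rcases hk.eq_or_lt with rfl | hlt
    · have hs : ∀ i ∈ Finset.range n, |g (i + 1) - g i| = g (i + 1) - g i := fun i hi =>
        abs_of_nonneg (sub_nonneg.2 (h1 i (by have := Finset.mem_range.1 hi; omega)))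
      rw [Finset.sum_congr rfl hs, Finset.sum_range_sub, abs_of_nonneg (sub_nonneg.2 (h1 n (by omega)))]
      ring
    · rw [ih (by omega) (fun i hi hin => h2 i hi (by omega)),
        abs_of_nonpos (sub_nonpos.2 (h2 n (by omega) (by omega)))]
      ring

theorem clm_apply_plane (ℓ : Plane →L[ℝ] ℝ) (x : Plane) :
    ℓ x = x 0 * ℓ ![1, 0] + x 1 * ℓ ![0, 1] := by
  have : x = x 0 • ![1, 0] + x 1 • ![0, 1] := by
    funext i; fin_cases i <;> simp
  conv_lhs => rw [this]
  simp only [map_add, map_smul, smul_eq_mul]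

theorem isCompact_closedWulff {φ : Plane → ℝ} (hφ : IsNorm φ) : IsCompact {x | φ x ≤ 1} := by
  refine Metric.isCompact_of_isClosed_isBounded (isClosed_le hφ.continuous continuous_const) ?_
  refine (isBounded_wulffBall hφ 0 2).subset fun x hx => ?_
  rw [mem_wulffBall, sub_zero]
  have : φ x ≤ 1 := hx
  linarith

theorem convex_closedWulff {φ : Plane → ℝ} (hφ : IsNorm φ) : Convex ℝ {x | φ x ≤ 1} := by
  intro x hx y hy a b ha hb hab
  have hx' : φ x ≤ 1 := hx
  have hy' : φ y ≤ 1 := hy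
  have := hφ.add_le (a • x) (b • y)
  rw [hφ.smul_eq, hφ.smul_eq, abs_of_nonneg ha, abs_of_nonneg hb] at this
  show φ (a • x + b • y) ≤ 1
  nlinarith

/-- A concave parametrization of the upper half of the unit sphere. -/
theorem exists_upper_graph {φ : Plane → ℝ} (hφ : IsNorm φ) :
    ∃ M > 0, ∃ f : ℝ → ℝ, (∀ x, φ x ≤ 1 → |x 0| ≤ M) ∧
      (∀ x, |x| ≤ M → φ ![x, f x] ≤ 1) ∧ (∀ x y, φ ![x, y] ≤ 1 → y ≤ f x) := by
  have hc := isCompact_closedWulff hφ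
  have h0 : (0 : Plane) ∈ {x | φ x ≤ 1} := by
    show φ 0 ≤ 1; rw [hφ.map_zero]; exact zero_le_one
  obtain ⟨p, hp, hmax⟩ := hc.exists_isMaxOn ⟨0, h0⟩
    (f := fun x : Plane => x 0) (by fun_prop)
  have hpn : φ (-p) ≤ 1 := by rw [hφ.map_neg]; exact hp
  have hM : ∀ x, φ x ≤ 1 → |x 0| ≤ p 0 := by
    intro x hx
    have h1 := hmax hx
    have h2 := hmax (show φ (-x) ≤ 1 by rw [hφ.map_neg]; exact hx)
    simp only [mem_ofPred_eq, Pi.neg_apply] at h1 h2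
    exact abs_le.2 ⟨by linarith, h1⟩
  have hMpos : 0 < p 0 := by
    have he : (![1, 0] : Plane) ≠ 0 := fun h => by simpa using congrFun h 0
    have hpos : 0 < φ ![1, 0] := lt_of_le_of_ne (hφ.nonneg _) fun h => he ((hφ.eq_zero_iff _).1 h.symm)
    have := hM ((φ ![1, 0])⁻¹ • ![1, 0]) (by
      rw [hφ.smul_eq, abs_of_pos (inv_pos.2 hpos), inv_mul_cancel₀ hpos.ne'])
    have h3 : |((φ ![1, 0])⁻¹ • ![1, 0] : Plane) 0| = (φ ![1, 0])⁻¹ := by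
      simp [abs_of_pos hpos]
    rw [h3] at this
    exact (inv_pos.2 hpos).trans_le this
  have hslice : ∀ x, |x| ≤ p 0 → ∃ y, φ ![x, y] ≤ 1 ∧ ∀ z, φ ![x, z] ≤ 1 → z ≤ y := by
    intro x hx
    have hne : ({q : Plane | φ q ≤ 1} ∩ {q : Plane | q 0 = x}).Nonempty := by
      refine ⟨(x / p 0) • p, ?_, ?_⟩
      · show φ _ ≤ 1
        rw [hφ.smul_eq, abs_div, abs_of_pos hMpos]
        have h1 : |x| / p 0 ≤ 1 := (div_le_one hMpos).2 hx
        have h2 : φ p ≤ 1 := hp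
        have h3 : 0 ≤ |x| / p 0 := by positivity
        nlinarith [hφ.nonneg p]
      · show (x / p 0) * p 0 = x
        field_simp
    have hcs : IsCompact ({q : Plane | φ q ≤ 1} ∩ {q : Plane | q 0 = x}) :=
      hc.inter_right (isClosed_eq (continuous_apply 0) continuous_const)
    obtain ⟨q, hq, hqm⟩ := hcs.exists_isMaxOn hne (f := fun x : Plane => x 1) (by fun_prop)
    have hq0 : q 0 = x := hq.2
    refine ⟨q 1, ?_, fun z hz => ?_⟩
    · have : (![x, q 1] : Plane) = q := by
        funext i; fin_cases i <;> simp [hq0]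
      rw [this]; exact hq.1
    · have := hqm (show (![x, z] : Plane) ∈ _ from ⟨hz, by simp⟩)
      simpa using this
  choose! f hf using hslice
  refine ⟨p 0, hMpos, f, hM, fun x hx => (hf x hx).1, fun x y hy => (hf x ?_).2 y hy⟩
  simpa using hM _ hy

theorem exists_list_near_support {φ : Plane → ℝ} (hφ : IsNorm φ) {ε : ℝ} (hε : 0 < ε)
    (hε1 : ε < 1) :
    ∃ l : List Plane, ∀ ℓ : Plane →L[ℝ] ℝ, ∃ q, φ q ≤ 1 ∧ (∀ y, φ y ≤ 1 → ℓ y ≤ ℓ q) ∧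
      (l.map fun v => |ℓ v|).sum ≤ ℓ q ∧ (1 - 2 * ε) * ℓ q ≤ (l.map fun v => |ℓ v|).sum := by
  obtain ⟨M, hM, f, hfM, hf1, hf2⟩ := exists_upper_graph hφ
  obtain ⟨A, hA, hAle⟩ := hφ.exists_le_norm
  obtain ⟨n, hn⟩ := exists_nat_gt (A * (2 * M) / ε)
  have hn0 : (0 : ℝ) < n := lt_of_le_of_lt (by positivity) hn
  let X : ℕ → ℝ := fun i => -M + 2 * M * i / n
  let p : ℕ → Plane := fun i => ![X i, f (X i)]
  have hX0 : X 0 = -M := by simp [X]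
  have hXn : X n = M := by simp only [X]; field_simp; ring
  have hXmono : Monotone X := by
    intro i j hij
    have : (i : ℝ) ≤ j := by exact_mod_cast hij
    simp only [X]; gcongr
  have hXle : ∀ i ≤ n, |X i| ≤ M := fun i hi => abs_le.2
    ⟨by rw [← hX0]; exact hXmono (Nat.zero_le i), by
      conv_rhs => rw [← hXn]
      exact hXmono hi⟩
  have hp : ∀ i ≤ n, φ (p i) ≤ 1 := fun i hi => hf1 _ (hXle i hi)
  let l : List Plane := (-(1 / 2 : ℝ) • (p 0 + p n)) ::
    (List.range n).map fun i => (1 / 2 : ℝ) • (p (i + 1) - p i)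
  -- The case of a functional with nonnegative second coefficient.
  have key : ∀ ℓ : Plane →L[ℝ] ℝ, 0 ≤ ℓ ![0, 1] → ∃ q, φ q ≤ 1 ∧ (∀ y, φ y ≤ 1 → ℓ y ≤ ℓ q) ∧
      (l.map fun v => |ℓ v|).sum ≤ ℓ q ∧ (1 - 2 * ε) * ℓ q ≤ (l.map fun v => |ℓ v|).sum := by
    intro ℓ hℓ
    obtain ⟨q, hq, hqm⟩ := (isCompact_closedWulff hφ).exists_isMaxOn ⟨p 0, hp 0 (Nat.zero_le n)⟩
      (f := ℓ) (by fun_prop)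
    have hqm' : ∀ y, φ y ≤ 1 → ℓ y ≤ ℓ q := fun y hy => hqm hy
    let g : ℕ → ℝ := fun i => ℓ (p i)
    obtain ⟨k, hkn, hkmax⟩ := Finset.exists_max_image (Finset.range (n + 1)) g ⟨0, by simp⟩
    have hkn' : k ≤ n := by simpa [Nat.lt_succ_iff] using hkn
    have hkmax' : ∀ i ≤ n, g i ≤ g k := fun i hi => hkmax i (by simp; omega)
    have hquasi : ∀ i j m : ℕ, i ≤ j → j ≤ m → m ≤ n → min (g i) (g m) ≤ g j := by
      intro i j m hij hjm hmn
      have hXj : X j ∈ segment ℝ (X i) (X m) := by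
        rw [segment_eq_Icc (hXmono (hij.trans hjm))]
        exact ⟨hXmono hij, hXmono hjm⟩
      obtain ⟨a, b, ha, hb, hab, he⟩ := hXj
      have hin := convex_closedWulff hφ (hp i (by omega)) (hp m hmn) ha hb hab
      have hy : a * f (X i) + b * f (X m) ≤ f (X j) := by
        refine hf2 _ _ ?_
        have : (![X j, a * f (X i) + b * f (X m)] : Plane) = a • p i + b • p m := by
          funext t; fin_cases t <;> simp [p, ← he]
        rw [this]; exact hin
      have e1 : ∀ i, g i = X i * ℓ ![1, 0] + f (X i) * ℓ ![0, 1] := by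
        intro i; simp only [g]; rw [clm_apply_plane]; simp [p]
      have h1 : a * g i + b * g m ≤ g j := by
        have h3 := mul_le_mul_of_nonneg_right hy hℓ
        have h4 : X j * ℓ ![1, 0] = (a * X i + b * X m) * ℓ ![1, 0] := by rw [← he]; rfl
        rw [e1, e1, e1, h4]
        linarith
      have h2 : min (g i) (g m) ≤ a * g i + b * g m := by
        have := min_le_left (g i) (g m)
        have := min_le_right (g i) (g m)
        calc min (g i) (g m) = a * min (g i) (g m) + b * min (g i) (g m) := by
              rw [← add_mul, hab, one_mul]
          _ ≤ _ := by gcongr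
      exact h2.trans h1
    have hsum : (l.map fun v => |ℓ v|).sum = g k := by
      have hS : 0 ≤ g 0 + g n := by
        have e : g 0 + g n = (f (X 0) + f (X n)) * ℓ ![0, 1] := by
          simp only [g]; rw [clm_apply_plane, clm_apply_plane ℓ (p n)]; simp [p, hX0, hXn]; ring
        have : -f (X 0) ≤ f (X n) := by
          refine hf2 _ _ ?_
          have : (![X n, -f (X 0)] : Plane) = -p 0 := by
            funext t; fin_cases t <;> simp [p, hX0, hXn]
          rw [this, hφ.map_neg]; exact hp 0 (Nat.zero_le n)
        rw [e]; exact mul_nonneg (by linarith) hℓ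
      have hu := sum_abs_sub_eq_of_unimodal (g := g) hkn'
        (fun i hi => by
          have := hquasi i (i + 1) k (by omega) (by omega) hkn'
          rwa [min_eq_left (hkmax' i (by omega))] at this)
        (fun i hi hin => by
          have := hquasi k i (i + 1) hi (by omega) (by omega)
          rwa [min_eq_right (hkmax' (i + 1) (by omega))] at this)
      have e2 : ((List.range n).map fun i => |ℓ ((1 / 2 : ℝ) • (p (i + 1) - p i))|).sum =
          ∑ i ∈ Finset.range n, (1 / 2) * |g (i + 1) - g i| := by
        have : ∀ i, |ℓ ((1 / 2 : ℝ) • (p (i + 1) - p i))| = (1 / 2) * |g (i + 1) - g i| := by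
          intro i
          rw [map_smul, map_sub, smul_eq_mul, abs_mul, abs_of_pos (by norm_num : (0:ℝ) < 1 / 2)]
        simp only [this]
        rfl
      simp only [l, List.map_cons, List.sum_cons, List.map_map, Function.comp_def]
      rw [e2, ← Finset.mul_sum, hu, map_smul, map_add, smul_eq_mul, abs_mul]
      have : |ℓ (p 0) + ℓ (p n)| = g 0 + g n := abs_of_nonneg hS
      rw [this, abs_neg, abs_of_pos (by norm_num : (0:ℝ) < 1 / 2)]
      ring
    refine ⟨q, hq, hqm', ?_, ?_⟩
    · rw [hsum]; exact hqm' _ (hp k hkn')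
    rw [hsum]
    have hq1 : φ q ≤ 1 := hq
    -- a grid point close to `(1 - ε) q`
    have hq0 := abs_le.1 (hfM q hq)
    obtain ⟨j, hjn, hj⟩ : ∃ j ≤ n, |X j - (1 - ε) * q 0| ≤ 2 * M / n := by
      have hy0 : 0 ≤ (1 - ε) * q 0 + M := by nlinarith
      have hy1 : (1 - ε) * q 0 ≤ M := by nlinarith
      refine ⟨⌊((1 - ε) * q 0 + M) * n / (2 * M)⌋₊, ?_, ?_⟩
      · refine Nat.floor_le_of_le ?_
        rw [div_le_iff₀ (by positivity)]
        nlinarith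
      · have h1 := Nat.floor_le (a := ((1 - ε) * q 0 + M) * n / (2 * M)) (by positivity)
        have h2 := (Nat.lt_floor_add_one (((1 - ε) * q 0 + M) * n / (2 * M))).le
        set N : ℝ := (⌊((1 - ε) * q 0 + M) * n / (2 * M)⌋₊ : ℝ)
        rw [le_div_iff₀ (by positivity)] at h1
        rw [div_le_iff₀ (by positivity)] at h2
        rw [abs_le]
        simp only [X]
        constructor
        · rw [← sub_nonneg]
          have : -M + 2 * M * N / n - (1 - ε) * q 0 - -(2 * M / n) =
            ((N + 1) * (2 * M) - ((1 - ε) * q 0 + M) * n) / n := by field_simp; ring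
          rw [this]; exact div_nonneg (by linarith) hn0.le
        · rw [← sub_nonneg]
          have : 2 * M / n - (-M + 2 * M * N / n - (1 - ε) * q 0) =
            (2 * M + (((1 - ε) * q 0 + M) * n - N * (2 * M))) / n := by field_simp; ring
          rw [this]; exact div_nonneg (by nlinarith) hn0.le
    set d := X j - (1 - ε) * q 0 with hd
    have hφd : φ ![d, 0] ≤ ε := by
      have h1 : ‖(![d, 0] : Plane)‖ ≤ 2 * M / n := by
        rw [pi_norm_le_iff_of_nonneg (by positivity)]
        intro i; fin_cases i
        · simpa using hj
        · simp; positivity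
      calc φ ![d, 0] ≤ A * (2 * M / n) := (hAle _).trans (by gcongr)
        _ ≤ ε := by
          rw [div_lt_iff₀ hε] at hn
          rw [mul_div_assoc', div_le_iff₀ hn0]; nlinarith
    have hfj : (1 - ε) * q 1 ≤ f (X j) := by
      refine hf2 _ _ ?_
      have : (![X j, (1 - ε) * q 1] : Plane) = (1 - ε) • q + ![d, 0] := by
        funext t; fin_cases t <;> simp [hd]
      rw [this]
      refine (hφ.add_le _ _).trans ?_
      rw [hφ.smul_eq, abs_of_pos (by linarith)]
      nlinarith
    have hℓd : -(ε * ℓ q) ≤ ℓ ![d, 0] := by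
      have h1 := hqm' (-(ε⁻¹ • ![d, 0])) (by
        rw [hφ.map_neg, hφ.smul_eq, abs_of_pos (inv_pos.2 hε), ← div_eq_inv_mul, div_le_one hε]
        exact hφd)
      rw [map_neg, map_smul, smul_eq_mul, ← div_eq_inv_mul, ← neg_div, div_le_iff₀ hε] at h1
      linarith
    have h5 : (1 - ε) * ℓ q + ℓ ![d, 0] ≤ g j := by
      have e3 : ℓ (p j) = X j * ℓ ![1, 0] + f (X j) * ℓ ![0, 1] := by
        rw [clm_apply_plane]; simp [p]
      have e4 : ℓ ![d, 0] = d * ℓ ![1, 0] := by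
        rw [clm_apply_plane]; simp
      simp only [g]
      rw [e3, e4, clm_apply_plane ℓ q, hd]
      nlinarith
    have h6 := hkmax' j hjn
    linarith
  refine ⟨l, fun ℓ => ?_⟩
  rcases le_total 0 (ℓ ![0, 1]) with h0 | h0
  · exact key ℓ h0
  · obtain ⟨q, h1, h2, h3, h4⟩ := key (-ℓ) (by simpa using h0)
    refine ⟨-q, by rwa [hφ.map_neg], fun y hy => ?_, ?_, ?_⟩
    · have := h2 (-y) (by rwa [hφ.map_neg])
      simpa using this
    · simpa using h3
    · simpa using h4

theorem exists_zono_approx {φ : Plane → ℝ} (hφ : IsNorm φ) {δ : ℝ} (hδ : 0 < δ) (hδ1 : δ < 1) :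
    ∃ l : List Plane, wulffBall φ 0 (1 - δ) ⊆ zono l ∧ zono l ⊆ wulffBall φ 0 1 := by
  set ε := δ / 3
  have hε : 0 < ε := by positivity
  have hε1 : ε < 1 / 3 := by simp only [ε]; linarith
  obtain ⟨l, hl⟩ := exists_list_near_support hφ hε (by linarith)
  have hsub : ∀ x ∈ zono l, φ x ≤ 1 := by
    intro x hx
    by_contra hcon
    obtain ⟨ℓ, u, h1, h2⟩ := geometric_hahn_banach_closed_point (convex_closedWulff hφ)
      (isCompact_closedWulff hφ).isClosed (x := x) hcon
    obtain ⟨q, hq, -, h3, -⟩ := hl ℓ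
    have := h1 q hq
    have := le_of_mem_zono ℓ hx
    linarith
  have hsup : ∀ x, φ x ≤ 1 - 2 * ε → x ∈ zono l := by
    intro x hx
    by_contra hcon
    obtain ⟨ℓ, u, h1, h2⟩ := geometric_hahn_banach_closed_point (convex_zono l)
      (isCompact_zono l).isClosed hcon
    obtain ⟨q, hq, hqm, -, h4⟩ := hl ℓ
    obtain ⟨z, hz, hzℓ⟩ := exists_mem_zono ℓ l
    have h5 := h1 z hz
    have hpos : 0 < 1 - 2 * ε := by linarith
    have h6 := hqm ((1 - 2 * ε)⁻¹ • x) (by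
      rw [hφ.smul_eq, abs_of_pos (inv_pos.2 hpos), ← div_eq_inv_mul, div_le_one hpos]
      exact hx)
    rw [map_smul, smul_eq_mul, ← div_eq_inv_mul, div_le_iff₀ hpos] at h6
    linarith
  refine ⟨l.map ((1 - ε) • ·), ?_, ?_⟩
  · intro x hx
    rw [mem_wulffBall, sub_zero] at hx
    have hpos : 0 < 1 - ε := by linarith
    rw [zono_smul]
    refine ⟨(1 - ε)⁻¹ • x, hsup _ ?_, by simp [smul_smul, hpos.ne']⟩
    rw [hφ.smul_eq, abs_of_pos (inv_pos.2 hpos), ← div_eq_inv_mul, div_le_iff₀ hpos]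
    have : δ = 3 * ε := by simp only [ε]; ring
    nlinarith
  · rw [zono_smul]
    rintro _ ⟨z, hz, rfl⟩
    rw [mem_wulffBall, sub_zero]
    show φ ((1 - ε) • z) < 1
    rw [hφ.smul_eq, abs_of_pos (by linarith)]
    nlinarith [hsub z hz]

section Mixed

variable {φ : Plane → ℝ}

/-- The area of the unit Wulff ball. -/
def ww (φ : Plane → ℝ) : ℝ := volume.real (wulffBall φ 0 1)

/-- The anisotropic Minkowski content of a convex set `K`: the linear coefficient of the Steiner
polynomial relative to the Wulff ball. -/
def MM (φ : Plane → ℝ) (K : Set Plane) : ℝ := volume.real (dil φ K 1) - volume.real K - ww φ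

theorem ww_pos (hφ : IsNorm φ) : 0 < ww φ := wulffBall_pos hφ

/-- Radii increasing to `1`. -/
def rad (N : ℕ) : ℝ := 1 - 1 / ((N : ℝ) + 2)

theorem rad_pos (N : ℕ) : 0 < rad N := by
  have : (0 : ℝ) ≤ N := Nat.cast_nonneg N
  rw [rad, sub_pos, div_lt_one (by positivity)]; linarith

theorem rad_lt_one (N : ℕ) : rad N < 1 := by
  have : 0 < 1 / ((N : ℝ) + 2) := by positivity
  rw [rad]; linarith

theorem rad_mono : Monotone rad := by
  intro i j h
  have : (i : ℝ) ≤ j := by exact_mod_cast h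
  unfold rad
  gcongr

theorem tendsto_rad : Tendsto rad atTop (nhds 1) := by
  have h : Tendsto (fun N : ℕ => 1 / ((N : ℝ) + 2)) atTop (nhds 0) := by
    refine squeeze_zero (fun N => by positivity) (fun N => ?_)
      (tendsto_one_div_add_atTop_nhds_zero_nat (𝕜 := ℝ))
    gcongr; norm_num
  have h2 := (tendsto_const_nhds (x := (1 : ℝ))).sub h
  rw [sub_zero] at h2
  exact h2

theorem exists_lt_rad_mul {x r : ℝ} (h : x < r) : ∃ N, x < rad N * r := by
  have : Tendsto (fun N => rad N * r) atTop (nhds (1 * r)) := tendsto_rad.mul_const r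
  rw [one_mul] at this
  exact (this.eventually (lt_mem_nhds h)).exists

theorem exists_zono_seq (hφ : IsNorm φ) : ∃ Z : ℕ → List Plane,
    ∀ N, wulffBall φ 0 (rad N) ⊆ zono (Z N) ∧ zono (Z N) ⊆ wulffBall φ 0 1 := by
  have h : ∀ N : ℕ, ∃ l : List Plane,
      wulffBall φ 0 (rad N) ⊆ zono l ∧ zono l ⊆ wulffBall φ 0 1 := fun N => by
    have h0 : (0 : ℝ) ≤ N := Nat.cast_nonneg N
    exact exists_zono_approx hφ (by positivity) (by rw [div_lt_one (by positivity)]; linarith)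
  choose Z hZ using h
  exact ⟨Z, hZ⟩

/-- A sequence of zonotopes approximating the Wulff ball from inside. -/
def zz (hφ : IsNorm φ) : ℕ → List Plane := (exists_zono_seq hφ).choose

theorem ball_subset_zz (hφ : IsNorm φ) (N : ℕ) : wulffBall φ 0 (rad N) ⊆ zono (zz hφ N) :=
  ((exists_zono_seq hφ).choose_spec N).1

theorem zz_subset (hφ : IsNorm φ) (N : ℕ) : zono (zz hφ N) ⊆ wulffBall φ 0 1 :=
  ((exists_zono_seq hφ).choose_spec N).2

theorem dil_subset_add_zz (hφ : IsNorm φ) (N : ℕ) (K : Set Plane) {s : ℝ} (hs : 0 < s) :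
    dil φ K (rad N * s) ⊆ K + s • zono (zz hφ N) := by
  rintro y ⟨k, hk, hy⟩
  refine ⟨k, hk, y - k, ⟨s⁻¹ • (y - k), ball_subset_zz hφ N ?_, by simp [smul_smul, hs.ne']⟩,
    by simp⟩
  rw [mem_wulffBall, sub_zero, hφ.smul_eq, abs_of_pos (inv_pos.2 hs), ← div_eq_inv_mul,
    div_lt_iff₀ hs]
  exact hy

theorem add_zz_subset_dil (hφ : IsNorm φ) (N : ℕ) (K : Set Plane) {s : ℝ} (hs : 0 < s) :
    K + s • zono (zz hφ N) ⊆ dil φ K s := by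
  rintro _ ⟨k, hk, _, ⟨z, hz, rfl⟩, rfl⟩
  refine ⟨k, hk, ?_⟩
  have := zz_subset hφ N hz
  rw [mem_wulffBall, sub_zero] at this
  simp only [add_sub_cancel_left]
  rw [hφ.smul_eq, abs_of_pos hs]
  nlinarith

theorem tendsto_volume_dil_rad (hφ : IsNorm φ) {K : Set Plane} (hK : Bornology.IsBounded K)
    {s : ℝ} (hs : 0 < s) :
    Tendsto (fun N => volume.real (dil φ K (rad N * s))) atTop (nhds (volume.real (dil φ K s))) := by
  have hu : ⋃ N, dil φ K (rad N * s) = dil φ K s := by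
    refine Subset.antisymm (iUnion_subset fun N => dil_mono_right K ?_) ?_
    · nlinarith [rad_lt_one N]
    · rintro y ⟨k, hk, hy⟩
      obtain ⟨N, hN⟩ := exists_lt_rad_mul hy
      exact mem_iUnion.2 ⟨N, k, hk, hN⟩
  have hm : Monotone fun N => dil φ K (rad N * s) := fun i j h =>
    dil_mono_right K (mul_le_mul_of_nonneg_right (rad_mono h) hs.le)
  have := tendsto_measure_iUnion_atTop (μ := volume) hm
  rw [hu] at this
  exact (ENNReal.tendsto_toReal (isBounded_dil hφ hK s).measure_lt_top.ne).comp this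

theorem tendsto_volume_add_zz (hφ : IsNorm φ) {K : Set Plane} (hK : IsCompact K)
    {s : ℝ} (hs : 0 < s) :
    Tendsto (fun N => volume.real (K + s • zono (zz hφ N))) atTop
      (nhds (volume.real (dil φ K s))) := by
  refine tendsto_of_tendsto_of_tendsto_of_le_of_le (tendsto_volume_dil_rad hφ hK.isBounded hs)
    tendsto_const_nhds (fun N => ?_) (fun N => ?_)
  · exact measureReal_mono (dil_subset_add_zz hφ N K hs)
      (hK.add ((isCompact_zono _).smul s)).measure_lt_top.ne
  · exact measureReal_mono (add_zz_subset_dil hφ N K hs)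
      (isBounded_dil hφ hK.isBounded s).measure_lt_top.ne

theorem wd_singleton (u x : Plane) : wd u {x} = 0 := by
  simp [wd, measureReal_def]

theorem tendsto_zA (hφ : IsNorm φ) : Tendsto (fun N => zA (zz hφ N)) atTop (nhds (ww φ)) := by
  have h := tendsto_volume_add_zz hφ (isCompact_singleton (x := (0 : Plane))) one_pos
  have e : dil φ {0} 1 = wulffBall φ 0 1 := by
    ext y; simp [dil, mem_wulffBall]
  rw [e] at h
  refine h.congr fun N => ?_
  rw [volume_add_smul_zono _ zero_le_one isCompact_singleton (convex_singleton 0)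
    (singleton_nonempty 0)]
  have : zP (zz hφ N) {0} = 0 := by simp [zP, wd_singleton]
  simp [this, measureReal_def]

theorem tendsto_zP (hφ : IsNorm φ) {K : Set Plane} (hc : IsCompact K) (hK : Convex ℝ K)
    (hne : K.Nonempty) : Tendsto (fun N => zP (zz hφ N) K) atTop (nhds (MM φ K)) := by
  have h := ((tendsto_volume_add_zz hφ hc one_pos).sub
    (tendsto_const_nhds (x := volume.real K))).sub (tendsto_zA hφ)
  refine h.congr fun N => ?_
  rw [volume_add_smul_zono _ zero_le_one hc hK hne]
  ring

/-- The Steiner formula. -/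
theorem volume_dil (hφ : IsNorm φ) {K : Set Plane} (hc : IsCompact K) (hK : Convex ℝ K)
    (hne : K.Nonempty) {s : ℝ} (hs : 0 < s) :
    volume.real (dil φ K s) = volume.real K + s * MM φ K + s ^ 2 * ww φ := by
  have h1 := tendsto_volume_add_zz hφ hc hs
  have h2 := ((tendsto_const_nhds (x := volume.real K)).add
    ((tendsto_zP hφ hc hK hne).const_mul s)).add ((tendsto_zA hφ).const_mul (s ^ 2))
  refine tendsto_nhds_unique h1 (h2.congr fun N => ?_)
  rw [volume_add_smul_zono _ hs.le hc hK hne]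

theorem MM_nonneg (hφ : IsNorm φ) {K : Set Plane} (hc : IsCompact K) (hK : Convex ℝ K)
    (hne : K.Nonempty) : 0 ≤ MM φ K :=
  ge_of_tendsto' (tendsto_zP hφ hc hK hne) fun _ => zP_nonneg _ _

theorem isCompact_er (hφ : IsNorm φ) {C : Set Plane} (hC : Bornology.IsBounded C) {r : ℝ}
    (hr : 0 < r) : IsCompact (er φ C r) :=
  Metric.isCompact_of_isClosed_isBounded (isClosed_er hφ) (hC.subset (er_subset hφ hr))

theorem iInter_er_rad (C : Set Plane) {r : ℝ} (hr : 0 < r) :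
    ⋂ N, er φ C (rad N * r) = er φ C r := by
  refine Subset.antisymm (fun x hx y hy => ?_) (subset_iInter fun N => er_anti_right C ?_)
  · obtain ⟨N, hN⟩ := exists_lt_rad_mul hy
    exact mem_iInter.1 hx N hN
  · nlinarith [rad_lt_one N]

theorem antitone_er_rad (C : Set Plane) {r : ℝ} (hr : 0 < r) :
    Antitone fun N => er φ C (rad N * r) := fun _ _ h =>
  er_anti_right C (mul_le_mul_of_nonneg_right (rad_mono h) hr.le)

theorem tendsto_volume_er_rad (hφ : IsNorm φ) {C : Set Plane} (hC : Bornology.IsBounded C) {r : ℝ}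
    (hr : 0 < r) :
    Tendsto (fun N => volume.real (er φ C (rad N * r))) atTop (nhds (volume.real (er φ C r))) := by
  have := tendsto_measure_iInter_atTop (μ := volume) (s := fun N => er φ C (rad N * r))
    (fun N => (isClosed_er hφ).measurableSet.nullMeasurableSet) (antitone_er_rad C hr)
    ⟨0, (isCompact_er hφ hC (mul_pos (rad_pos 0) hr)).measure_lt_top.ne⟩
  rw [iInter_er_rad C hr] at this
  exact (ENNReal.tendsto_toReal (isCompact_er hφ hC hr).measure_lt_top.ne).comp this

/-- The inner parallel body inequality. -/
theorem le_volume_er (hφ : IsNorm φ) {C : Set Plane} (hc : IsCompact C) (hC : Convex ℝ C) {r : ℝ}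
    (hr : 0 < r) (hne : (er φ C r).Nonempty) :
    volume.real C - r * MM φ C + r ^ 2 * ww φ ≤ volume.real (er φ C r) := by
  have h2 := ((tendsto_const_nhds (x := volume.real C)).sub
    ((tendsto_zP hφ hc hC (hne.mono (er_subset hφ hr))).const_mul r)).add
    ((tendsto_zA hφ).const_mul (r ^ 2))
  refine le_of_tendsto_of_tendsto' h2 (tendsto_volume_er_rad hφ hc.isBounded hr) fun N => ?_
  have hsub : er φ C r ⊆ erZ ((zz hφ N).map (r • ·)) C := by
    intro x hx
    rw [mem_erZ_smul]
    intro z hz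
    refine hx ?_
    have := zz_subset hφ N hz
    rw [mem_wulffBall, sub_zero] at this
    rw [mem_wulffBall, add_sub_cancel_left, hφ.smul_eq, abs_of_pos hr]
    nlinarith
  refine (le_volume_erZ_smul _ hr.le hc hC (hne.mono hsub)).trans ?_
  refine measureReal_mono ?_ (isCompact_er hφ hc.isBounded (mul_pos (rad_pos N) hr)).measure_lt_top.ne
  intro x hx y hy
  rw [mem_erZ_smul] at hx
  have := hx (r⁻¹ • (y - x)) (ball_subset_zz hφ N (by
    rw [mem_wulffBall, sub_zero, hφ.smul_eq, abs_of_pos (inv_pos.2 hr), ← div_eq_inv_mul,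
      div_lt_iff₀ hr]
    exact hy))
  rw [smul_smul, mul_inv_cancel₀ hr.ne', one_smul] at this
  simpa using this

theorem exists_inradius (hφ : IsNorm φ) {C : Set Plane} (hC : Bornology.IsBounded C)
    (hi : (interior C).Nonempty) :
    ∃ s > 0, (er φ C s).Nonempty ∧ ∀ t, s < t → er φ C t = ∅ := by
  let S : Set ℝ := {s | 0 < s ∧ (er φ C s).Nonempty}
  have hSne : S.Nonempty := by
    obtain ⟨x, hx⟩ := hi
    obtain ⟨ε, hε, hb⟩ := Metric.isOpen_iff.1 isOpen_interior x hx
    obtain ⟨c, hc, h⟩ := hφ.exists_norm_le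
    refine ⟨c * ε, by positivity, x, fun y hy => interior_subset (hb ?_)⟩
    rw [Metric.mem_ball, dist_eq_norm]
    exact lt_of_mul_lt_mul_left ((h _).trans_lt hy) hc.le
  have hSb : BddAbove S := by
    refine ⟨Real.sqrt (volume.real C / ww φ), fun s ⟨hs, x, hx⟩ => ?_⟩
    refine Real.le_sqrt_of_sq_le ?_
    rw [le_div_iff₀ (ww_pos hφ)]
    have := volume_wulffBall hφ x hs.le
    rw [ww, ← this]
    exact measureReal_mono hx hC.measure_lt_top.ne
  have hs0 : 0 < sSup S := by
    obtain ⟨s, hs⟩ := hSne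
    exact hs.1.trans_le (le_csSup hSb hs)
  refine ⟨sSup S, hs0, ?_, fun t ht => ?_⟩
  · rw [← iInter_er_rad C hs0]
    refine IsCompact.nonempty_iInter_of_directed_nonempty_isCompact_isClosed _
      (directed_of_isDirected_le (antitone_er_rad C hs0)) (fun N => ?_)
      (fun N => isCompact_er hφ hC (mul_pos (rad_pos N) hs0)) (fun N => isClosed_er hφ)
    have hlt : rad N * sSup S < sSup S := by nlinarith [rad_lt_one N]
    obtain ⟨s, hs, hls⟩ := exists_lt_of_lt_csSup hSne hlt
    exact hs.2.mono (er_anti_right C hls.le)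
  · rw [← not_nonempty_iff_eq_empty]
    intro hne
    exact absurd (le_csSup hSb ⟨hs0.trans ht, hne⟩) (not_le.2 ht)

theorem interior_nonempty_of_volume_pos {C : Set Plane} (hC : Convex ℝ C)
    (h : 0 < volume.real C) : (interior C).Nonempty := by
  by_contra hcon
  rw [not_nonempty_iff_eq_empty] at hcon
  have h1 : volume C ≤ volume (frontier C) := by
    refine measure_mono ?_
    rw [frontier, hcon, sdiff_empty]; exact subset_closure
  rw [hC.addHaar_frontier volume] at h1
  rw [measureReal_def, le_antisymm h1 zero_le] at h
  simp at h

theorem volume_er_eq_zero (hφ : IsNorm φ) {C : Set Plane} (hC : Convex ℝ C)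
    {s : ℝ} (hs : 0 < s) (h : ∀ t, s < t → er φ C t = ∅) : volume.real (er φ C s) = 0 := by
  by_contra hcon
  obtain ⟨x, hx⟩ := interior_nonempty_of_volume_pos (convex_er hC s)
    (lt_of_le_of_ne measureReal_nonneg (Ne.symm hcon))
  obtain ⟨ε, hε, hb⟩ := Metric.isOpen_iff.1 isOpen_interior x hx
  obtain ⟨c, hc, hle⟩ := hφ.exists_norm_le
  have h1 : wulffBall φ x (c * ε) ⊆ er φ C s := fun y hy => interior_subset (hb (by
    rw [Metric.mem_ball, dist_eq_norm]
    exact lt_of_mul_lt_mul_left ((hle _).trans_lt hy) hc.le))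
  have h2 := er_add_dil hφ hs (by positivity) h1
  have h3 := h (s + c * ε) (by nlinarith)
  exact (h3 ▸ (show x ∈ er φ C (s + c * ε) from h2) : x ∈ (∅ : Set Plane))

/-- Bonnesen type inequality at the inradius. -/
theorem exists_inradius_ineq (hφ : IsNorm φ) {C : Set Plane} (hc : IsCompact C) (hC : Convex ℝ C)
    (hpos : 0 < volume.real C) :
    ∃ s > 0, (er φ C s).Nonempty ∧ (∀ t, s < t → er φ C t = ∅) ∧
      volume.real (er φ C s) = 0 ∧ volume.real C + s ^ 2 * ww φ ≤ s * MM φ C := by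
  obtain ⟨s, hs, hne, hmax⟩ := exists_inradius hφ hc.isBounded (interior_nonempty_of_volume_pos hC hpos)
  have h0 := volume_er_eq_zero hφ hC hs hmax
  have := le_volume_er hφ hc hC hs hne
  exact ⟨s, hs, hne, hmax, h0, by linarith⟩

/-- Bonnesen's inequality. -/
theorem bonnesen (hφ : IsNorm φ) {C : Set Plane} (hc : IsCompact C) (hC : Convex ℝ C) {r : ℝ}
    (hr : 0 < r) (hle : r ^ 2 * ww φ ≤ volume.real C) :
    volume.real C + r ^ 2 * ww φ - volume.real (er φ C r) ≤ r * MM φ C := by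
  have hw := ww_pos hφ
  by_cases hne : (er φ C r).Nonempty
  · linarith [le_volume_er hφ hc hC hr hne]
  have hpos : 0 < volume.real C := lt_of_lt_of_le (by positivity) hle
  obtain ⟨s, hs, hsne, hmax, h0, h⟩ := exists_inradius_ineq hφ hc hC hpos
  have hsr : s < r := by
    by_contra hcon
    exact hne (hsne.mono (er_anti_right C (not_lt.1 hcon)))
  rw [not_nonempty_iff_eq_empty] at hne
  rw [hne]
  simp only [measureReal_empty, sub_zero]
  have h1 : s * (volume.real C + r ^ 2 * ww φ) ≤ s * (r * MM φ C) := by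
    have h2 : s * (volume.real C + r ^ 2 * ww φ) ≤ r * (volume.real C + s ^ 2 * ww φ) := by
      have : s * r * ww φ ≤ volume.real C := by
        refine le_trans ?_ hle
        rw [sq]; gcongr
      nlinarith
    nlinarith
  exact le_of_mul_le_mul_left h1 hs

/-- The Wulff inequality, in linearized form. -/
theorem wulff_ineq (hφ : IsNorm φ) {C : Set Plane} (hc : IsCompact C) (hC : Convex ℝ C)
    (hpos : 0 < volume.real C) : 4 * (volume.real C * ww φ) ≤ MM φ C ^ 2 := by
  obtain ⟨s, hs, hsne, hmax, h0, h⟩ := exists_inradius_ineq hφ hc hC hpos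
  have hw := ww_pos hφ
  have h1 : 4 * (volume.real C * ww φ) * s ^ 2 ≤ (volume.real C + s ^ 2 * ww φ) ^ 2 := by
    nlinarith [sq_nonneg (volume.real C - s ^ 2 * ww φ)]
  have h2 : (volume.real C + s ^ 2 * ww φ) ^ 2 ≤ (s * MM φ C) ^ 2 := by
    gcongr
  have h3 : 4 * (volume.real C * ww φ) * s ^ 2 ≤ MM φ C ^ 2 * s ^ 2 := by nlinarith
  exact le_of_mul_le_mul_right h3 (by positivity)

end Mixed

section Perimeter

variable {φ : Plane → ℝ}

/-- The anisotropic perimeter of `E` is at most `p`. -/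
def PerLe (φ : Plane → ℝ) (E : Set Plane) (p : ℝ) : Prop :=
  ∀ η : Plane → Plane, ContDiff ℝ 1 η → HasCompactSupport η → (∀ x, φ (η x) ≤ 1) →
    ∫ x in E, diverg η x ≤ p

theorem PerLe.nonneg (hφ : IsNorm φ) {E : Set Plane} {p : ℝ} (h : PerLe φ E p) : 0 ≤ p := by
  have := h 0 contDiff_const HasCompactSupport.zero
    (fun x => by simp [hφ.map_zero])
  have e : diverg (0 : Plane → Plane) = 0 := by
    funext x
    simp [diverg]
  simpa [e] using this

theorem integral_indicator_one_mul {E : Set Plane} (hE : MeasurableSet E) (f : Plane → ℝ) :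
    ∫ x, E.indicator (1 : Plane → ℝ) x * f x = ∫ x in E, f x := by
  rw [← integral_indicator hE]
  refine integral_congr_ae (Eventually.of_forall fun x => ?_)
  by_cases hx : x ∈ E <;> simp [hx]

theorem perLe_iff {E : Set Plane} (hE : MeasurableSet E) {p : ℝ} (hp : 0 ≤ p) :
    PerLe φ E p ↔ anisoPerimeter φ E ≤ ENNReal.ofReal p := by
  simp only [anisoPerimeter, anisoTV, iSup_le_iff, integral_indicator_one_mul hE, mem_ofPred_eq,
    ENNReal.ofReal_le_ofReal_iff hp, PerLe]
  exact ⟨fun h η ⟨h1, h2, h3⟩ => h η h1 h2 h3, fun h η h1 h2 h3 => h η ⟨h1, h2, h3⟩⟩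

theorem continuous_diverg {η : Plane → Plane} (hη : ContDiff ℝ 1 η) : Continuous (diverg η) := by
  have h := hη.continuous_fderiv one_ne_zero
  unfold diverg
  fun_prop

theorem hasCompactSupport_diverg {η : Plane → Plane} (hη : HasCompactSupport η) :
    HasCompactSupport (diverg η) := by
  refine (hη.fderiv (𝕜 := ℝ)).mono' ?_
  intro x hx
  refine subset_tsupport _ ?_
  rw [Function.mem_support] at hx ⊢
  intro h
  exact hx (by simp [diverg, h])

theorem integrable_diverg {η : Plane → Plane} (hη : ContDiff ℝ 1 η) (hc : HasCompactSupport η) :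
    Integrable (diverg η) :=
  (continuous_diverg hη).integrable_of_hasCompactSupport (hasCompactSupport_diverg hc)

theorem det_id_add_smul (D : Plane →L[ℝ] Plane) (ε : ℝ) :
    (ContinuousLinearMap.id ℝ Plane + ε • D).det = 1 + ε * ∑ i, D (Pi.single i 1) i +
      ε ^ 2 * (D (Pi.single 0 1) 0 * D (Pi.single 1 1) 1 -
        D (Pi.single 1 1) 0 * D (Pi.single 0 1) 1) := by
  rw [ContinuousLinearMap.det, ← LinearMap.det_toMatrix', Matrix.det_fin_two]
  simp [LinearMap.toMatrix'_apply, Fin.sum_univ_two]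
  ring

theorem perLe_dil (hφ : IsNorm φ) {K : Set Plane} (hc : IsCompact K) (hK : Convex ℝ K)
    (hne : K.Nonempty) {r : ℝ} (hr : 0 < r) :
    PerLe φ (dil φ K r) (MM φ K + 2 * r * ww φ) := by
  intro η h1 h2 h3
  set F := dil φ K r
  have hFo : IsOpen F := isOpen_dil hφ K r
  have hFb : Bornology.IsBounded F := isBounded_dil hφ hc.isBounded r
  obtain ⟨L, hL⟩ := h1.lipschitzWith_of_hasCompactSupport h2 one_ne_zero
  let q : Plane → ℝ := fun x => fderiv ℝ η x (Pi.single 0 1) 0 * fderiv ℝ η x (Pi.single 1 1) 1 -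
    fderiv ℝ η x (Pi.single 1 1) 0 * fderiv ℝ η x (Pi.single 0 1) 1
  have hqc : Continuous q := by
    have h := h1.continuous_fderiv one_ne_zero
    simp only [q]
    fun_prop
  have hqi : IntegrableOn q F := (hqc.continuousOn.integrableOn_compact
    hFb.isCompact_closure).mono_set subset_closure
  have hdi : IntegrableOn (diverg η) F := (integrable_diverg h1 h2).integrableOn
  have key : ∀ ε : ℝ, 0 < ε → ε * (L : ℝ) < 1 →
      ∫ x in F, diverg η x ≤ MM φ K + 2 * r * ww φ + ε * (ww φ - ∫ x in F, q x) := by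
    intro ε hε hεL
    let g : Plane → Plane := fun x => x + ε • η x
    have hg : ∀ x ∈ F, HasFDerivWithinAt g (ContinuousLinearMap.id ℝ Plane + ε • fderiv ℝ η x) F x := by
      intro x _
      exact ((hasFDerivAt_id x).add
        (((h1.differentiable one_ne_zero) x).hasFDerivAt.const_smul ε)).hasFDerivWithinAt
    have hinj : InjOn g F := by
      intro x _ y _ hxy
      have e : x - y = ε • (η y - η x) := by
        have : x + ε • η x = y + ε • η y := hxy
        rw [smul_sub, sub_eq_sub_iff_add_eq_add, this]; abel
      have h4 : ‖x - y‖ ≤ ε * (L * ‖x - y‖) := by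
        conv_lhs => rw [e]
        rw [norm_smul, Real.norm_of_nonneg hε.le]
        have := hL.norm_sub_le y x
        rw [norm_sub_rev y x] at this
        gcongr
      by_contra hne
      have : 0 < ‖x - y‖ := norm_pos_iff.2 (sub_ne_zero.2 hne)
      nlinarith
    have himg : g '' F ⊆ dil φ K (r + ε) := by
      rintro _ ⟨x, ⟨k, hk, hx⟩, rfl⟩
      refine ⟨k, hk, ?_⟩
      have e : g x - k = (x - k) + ε • η x := by simp only [g]; abel
      rw [e]
      refine (hφ.add_le _ _).trans_lt ?_
      rw [hφ.smul_eq, abs_of_pos hε]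
      nlinarith [h3 x]
    have hch := integral_image_eq_integral_abs_det_fderiv_smul volume hFo.measurableSet hg hinj
      (fun _ => (1 : ℝ))
    have hvol : volume.real (g '' F) ≤ volume.real (dil φ K (r + ε)) :=
      measureReal_mono himg (isBounded_dil hφ hc.isBounded _).measure_lt_top.ne
    have hdet : ∀ x, (ContinuousLinearMap.id ℝ Plane + ε • fderiv ℝ η x).det =
        1 + ε * diverg η x + ε ^ 2 * q x := fun x => det_id_add_smul _ _
    simp only [hdet, smul_eq_mul, mul_one, setIntegral_const] at hch
    have h1i : IntegrableOn (fun _ : Plane => (1 : ℝ)) F :=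
      integrableOn_const hFb.measure_lt_top.ne
    have hfi : IntegrableOn (fun x => 1 + ε * diverg η x + ε ^ 2 * q x) F :=
      (h1i.add (hdi.const_mul ε)).add (hqi.const_mul _)
    have h5 : ∫ x in F, (1 + ε * diverg η x + ε ^ 2 * q x) ≤
        ∫ x in F, |1 + ε * diverg η x + ε ^ 2 * q x| :=
      integral_mono hfi hfi.abs fun x => le_abs_self _
    have hadd : IntegrableOn (fun x => 1 + ε * diverg η x) F := h1i.add (hdi.const_mul ε)
    have h6 : ∫ x in F, (1 + ε * diverg η x + ε ^ 2 * q x) =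
        volume.real F + ε * (∫ x in F, diverg η x) + ε ^ 2 * (∫ x in F, q x) := by
      rw [integral_add hadd (hqi.const_mul _),
        integral_add h1i (hdi.const_mul ε), integral_const_mul, integral_const_mul]
      simp
    rw [h6, ← hch] at h5
    have h7 := volume_dil hφ hc hK hne hr
    have h8 := volume_dil hφ hc hK hne (show 0 < r + ε by linarith)
    have h9 : ε * (∫ x in F, diverg η x) ≤
        ε * (MM φ K + 2 * r * ww φ + ε * (ww φ - ∫ x in F, q x)) := by
      nlinarith
    exact le_of_mul_le_mul_left h9 hε
  set Q := ww φ - ∫ x in F, q x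
  refine le_of_forall_pos_le_add fun δ hδ => ?_
  have hL0 : (0 : ℝ) ≤ L := L.2
  set ε := min (1 / (2 * ((L : ℝ) + 1))) (δ / (|Q| + 1))
  have hε : 0 < ε := lt_min (by positivity) (by positivity)
  have e1 : ε * L < 1 := by
    have : ε ≤ 1 / (2 * ((L : ℝ) + 1)) := min_le_left _ _
    rw [le_div_iff₀ (by positivity)] at this
    nlinarith
  have e2 : ε * Q ≤ δ := by
    have : ε ≤ δ / (|Q| + 1) := min_le_right _ _
    rw [le_div_iff₀ (by positivity)] at this
    nlinarith [le_abs_self Q, abs_nonneg Q]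
  linarith [key ε hε e1]

end Perimeter

section LineIntegral

variable {h : Plane → ℝ}

theorem hasFDerivAt_lineInt (hd : ContDiff ℝ 1 h) (hc : HasCompactSupport h) (v : Plane)
    (a b : ℝ) (x : Plane) :
    HasFDerivAt (fun x => ∫ t in a..b, h (x - t • v))
      (∫ t in a..b, fderiv ℝ h (x - t • v)) x := by
  have hdc : Continuous (fderiv ℝ h) := hd.continuous_fderiv one_ne_zero
  obtain ⟨M, hM⟩ := (hc.fderiv (𝕜 := ℝ)).exists_bound_of_continuous hdc
  have hcc : ∀ x : Plane, Continuous fun t : ℝ => h (x - t • v) := fun x =>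
    hd.continuous.comp (by fun_prop)
  have hdd : ∀ x : Plane, Continuous fun t : ℝ => fderiv ℝ h (x - t • v) := fun x =>
    hdc.comp (by fun_prop)
  refine intervalIntegral.hasFDerivAt_integral_of_dominated_of_fderiv_le (s := univ)
    (F := fun x t => h (x - t • v)) (F' := fun x t => fderiv ℝ h (x - t • v))
    (bound := fun _ => M) univ_mem
    (Eventually.of_forall fun x => (hcc x).aestronglyMeasurable)
    ((hcc x).intervalIntegrable _ _) (hdd x).aestronglyMeasurable
    (Eventually.of_forall fun t _ x _ => hM _) (by simp)
    (Eventually.of_forall fun t _ x _ => ?_)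
  have h1 : HasFDerivAt h (fderiv ℝ h (x - t • v)) (x - t • v) :=
    (hd.differentiable one_ne_zero _).hasFDerivAt
  have h2 : HasFDerivAt (fun x : Plane => x - t • v) (ContinuousLinearMap.id ℝ Plane) x :=
    (hasFDerivAt_id x).sub_const _
  have h3 := h1.comp x h2
  rw [ContinuousLinearMap.comp_id] at h3
  exact h3

theorem contDiff_lineInt (hd : ContDiff ℝ 1 h) (hc : HasCompactSupport h) (v : Plane)
    (a b : ℝ) : ContDiff ℝ 1 (fun x => ∫ t in a..b, h (x - t • v)) := by
  have hdc : Continuous (fderiv ℝ h) := hd.continuous_fderiv one_ne_zero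
  rw [contDiff_one_iff_fderiv]
  refine ⟨fun x => (hasFDerivAt_lineInt hd hc v a b x).differentiableAt, ?_⟩
  have : fderiv ℝ (fun x => ∫ t in a..b, h (x - t • v)) =
      fun x => ∫ t in a..b, fderiv ℝ h (x - t • v) :=
    funext fun x => (hasFDerivAt_lineInt hd hc v a b x).fderiv
  rw [this]
  refine intervalIntegral.continuous_parametric_intervalIntegral_of_continuous' ?_ a b
  exact hdc.comp (by fun_prop)

theorem fderiv_lineInt (hd : ContDiff ℝ 1 h) (hc : HasCompactSupport h) (v : Plane)
    (a b : ℝ) (x : Plane) :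
    fderiv ℝ (fun x => ∫ t in a..b, h (x - t • v)) x v = h (x - a • v) - h (x - b • v) := by
  have hdc : Continuous (fderiv ℝ h) := hd.continuous_fderiv one_ne_zero
  have hdd : Continuous fun t : ℝ => fderiv ℝ h (x - t • v) := hdc.comp (by fun_prop)
  rw [(hasFDerivAt_lineInt hd hc v a b x).fderiv,
    ContinuousLinearMap.intervalIntegral_apply (hdd.intervalIntegrable _ _)]
  have key : ∀ t ∈ uIcc a b, HasDerivAt (fun t : ℝ => -h (x - t • v))
      (fderiv ℝ h (x - t • v) v) t := by
    intro t _
    have h1 : HasFDerivAt h (fderiv ℝ h (x - t • v)) (x - t • v) :=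
      (hd.differentiable one_ne_zero _).hasFDerivAt
    have h2 : HasDerivAt (fun t : ℝ => x - t • v) (-v) t := by
      simpa using ((hasDerivAt_id t).smul_const v).const_sub x
    have h3 := (h1.comp_hasDerivAt t h2).neg
    rw [map_neg, neg_neg] at h3
    exact h3
  rw [intervalIntegral.integral_eq_sub_of_hasDerivAt key
    ((hdd.clm_apply continuous_const).intervalIntegrable _ _)]
  ring

theorem lineInt_le_volume_fib {U : Set Plane} (hU : IsOpen U) {v : Plane} (hv : v ≠ 0)
    (hd : Continuous h) (h0 : ∀ x, 0 ≤ h x) (h1 : ∀ x, h x ≤ U.indicator 1 x) {L : ℝ}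
    (hL : 0 ≤ L) (x : Plane) :
    ENNReal.ofReal (∫ t in (-L)..L, h (x - t • v)) ≤ volume (fib v U (crL v x)) := by
  obtain ⟨y, hy⟩ := coord_surj hv x
  have hcc : Continuous fun t : ℝ => h (x - t • v) := hd.comp (by fun_prop)
  rw [intervalIntegral.integral_of_le (by linarith),
    ofReal_integral_eq_lintegral_ofReal (hcc.integrableOn_Ioc)
      (Eventually.of_forall fun t => h0 _)]
  calc ∫⁻ t in Ioc (-L) L, ENNReal.ofReal (h (x - t • v))
      ≤ ∫⁻ t, ENNReal.ofReal (h (x - t • v)) := setLIntegral_le_lintegral _ _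
    _ ≤ ∫⁻ t, (fib v U (crL v x)).indicator 1 (y - t) := by
        refine lintegral_mono fun t => ?_
        have e : coord v (crL v x, y - t) = x - t • v := by
          rw [sub_eq_add_neg, coord_add, hy]; simp [sub_eq_add_neg]
        have h2 := h1 (x - t • v)
        by_cases hm : x - t • v ∈ U
        · have : y - t ∈ fib v U (crL v x) := by show coord v _ ∈ U; rwa [e]
          rw [indicator_of_mem this]
          rw [indicator_of_mem hm] at h2
          simpa using h2
        · rw [indicator_of_notMem hm] at h2
          simp [ENNReal.ofReal_of_nonpos h2]
    _ = ∫⁻ t, (fib v U (crL v x)).indicator 1 t :=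
        lintegral_sub_left_eq_self _ y
    _ = volume (fib v U (crL v x)) := by
        rw [lintegral_indicator_one (measurableSet_fib hU.measurableSet _)]

theorem exists_cutoff {K U : Set Plane} (hK : IsCompact K) (hU : IsOpen U) (hKU : K ⊆ U)
    (hb : Bornology.IsBounded U) :
    ∃ h : Plane → ℝ, ContDiff ℝ 1 h ∧ HasCompactSupport h ∧ (∀ x, 0 ≤ h x) ∧ (∀ x, h x ≤ 1) ∧
      (∀ x ∉ U, h x = 0) ∧ ∀ x ∈ K, h x = 1 := by
  obtain ⟨f, hf0, hf1, hf⟩ := exists_contMDiffMap_zero_one_of_isClosed (n := 1)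
    (modelWithCornersSelf ℝ Plane) hU.isClosed_compl hK.isClosed
    (disjoint_compl_left_iff_subset.2 hKU)
  refine ⟨f, f.contMDiff.contDiff, ?_, fun x => (hf x).1, fun x => (hf x).2,
    fun x hx => hf0 hx, fun x hx => hf1 hx⟩
  refine HasCompactSupport.intro hb.isCompact_closure fun x hx => hf0 ?_
  exact fun h => hx (subset_closure h)

end LineIntegral

section Projection

/-- The essential projection of `E` along the direction `v`. -/
def ep (v : Plane) (E : Set Plane) : Set ℝ := {s | 0 < volume (fib v E s)}

theorem measurableSet_ep {v : Plane} {E : Set Plane} (hE : MeasurableSet E) :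
    MeasurableSet (ep v E) :=
  measurableSet_lt measurable_const (measurable_volume_fib hE)

theorem ep_subset {v : Plane} (hv : v ≠ 0) (E : Set Plane) : ep v E ⊆ crL v '' E := fun _ hs =>
  (fib_nonempty_iff hv).1 (nonempty_of_measure_ne_zero (ne_of_gt hs))

theorem isBounded_ep {v : Plane} (hv : v ≠ 0) {E : Set Plane} (hb : Bornology.IsBounded E) :
    Bornology.IsBounded (ep v E) :=
  ((hb.isCompact_closure.image (crL v).continuous).isBounded).subset
    ((ep_subset hv E).trans (image_mono subset_closure))

theorem setLIntegral_crL {v : Plane} (hv : v ≠ 0) {K : Set Plane} (hK : MeasurableSet K)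
    {g : ℝ → ℝ≥0∞} (hg : Measurable g) :
    ∫⁻ x in K, g (crL v x) = ∫⁻ s, g s * volume (fib v K s) := by
  have hm : Measurable (K.indicator fun x => g (crL v x)) :=
    (hg.comp (crL v).continuous.measurable).indicator hK
  rw [← lintegral_indicator hK, ← (measurePreserving_coord hv).lintegral_comp hm,
    Measure.volume_eq_prod, lintegral_prod (fun p => K.indicator (fun x => g (crL v x)) (coord v p))
      (hm.comp (continuous_coord v).measurable).aemeasurable]
  refine lintegral_congr fun s => ?_
  have : ∀ y, K.indicator (fun x => g (crL v x)) (coord v (s, y)) =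
      (fib v K s).indicator (fun _ => g s) y := by
    intro y
    by_cases h : coord v (s, y) ∈ K
    · rw [indicator_of_mem h, indicator_of_mem (show y ∈ fib v K s from h), crL_coord hv]
    · rw [indicator_of_notMem h, indicator_of_notMem (show y ∉ fib v K s from h)]
  simp only [this]
  rw [lintegral_indicator (measurableSet_fib hK s), setLIntegral_const]

theorem ennreal_ratio {τ δ k u d e : ℝ≥0∞} (hτ' : τ ≠ ⊤) (hδ : δ ≠ 0)
    (hδ' : δ ≠ ⊤) (hu : u ≤ k + d) (he : τ ≤ e) (heu : e ≤ u) (hk : k ≠ ⊤) :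
    1 ≤ (δ + u)⁻¹ * k + (δ + d) * τ⁻¹ := by
  by_cases hd : d = ⊤
  · rw [hd]
    simp [hτ']
  have hut : u ≠ ⊤ := ne_top_of_le_ne_top (ENNReal.add_ne_top.2 ⟨hk, hd⟩) hu
  have h1 : (δ + u)⁻¹ ≤ τ⁻¹ := ENNReal.inv_le_inv.2 ((he.trans heu).trans le_add_self)
  calc (1 : ℝ≥0∞) = (δ + u)⁻¹ * (δ + u) :=
        (ENNReal.inv_mul_cancel (by simp [hδ]) (ENNReal.add_ne_top.2 ⟨hδ', hut⟩)).symm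
    _ ≤ (δ + u)⁻¹ * (δ + (k + d)) := by gcongr
    _ = (δ + u)⁻¹ * k + (δ + u)⁻¹ * (δ + d) := by ring
    _ ≤ (δ + u)⁻¹ * k + τ⁻¹ * (δ + d) := by gcongr
    _ = _ := by ring

theorem exists_level {v : Plane} (hv : v ≠ 0) {E : Set Plane}
    (hb : Bornology.IsBounded E) {ε : ℝ} (hε : 0 < ε) :
    ∃ τ : ℝ, 0 < τ ∧ volume.real (ep v E) ≤
      volume.real {s | ENNReal.ofReal τ ≤ volume (fib v E s)} + ε ∧
      {s | ENNReal.ofReal τ ≤ volume (fib v E s)} ⊆ ep v E := by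
  let B : ℕ → Set ℝ := fun n => {s | ENNReal.ofReal (1 / ((n : ℝ) + 1)) ≤ volume (fib v E s)}
  have hpos : ∀ n : ℕ, (0 : ℝ) < 1 / ((n : ℝ) + 1) := fun n => by positivity
  have hsub : ∀ n, B n ⊆ ep v E := fun n s hs =>
    (ENNReal.ofReal_pos.2 (hpos n)).trans_le hs
  have hmono : Monotone B := by
    intro i j hij s hs
    refine le_trans (ENNReal.ofReal_le_ofReal ?_) hs
    exact one_div_le_one_div_of_le (by positivity) (by exact_mod_cast Nat.succ_le_succ hij)
  have hU : ⋃ n, B n = ep v E := by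
    refine subset_antisymm (iUnion_subset hsub) fun s hs => ?_
    have hs' : 0 < volume (fib v E s) := hs
    rw [mem_iUnion]
    by_cases ht : volume (fib v E s) = ⊤
    · exact ⟨0, by simp [B, ht]⟩
    obtain ⟨n, hn⟩ := exists_nat_one_div_lt (ENNReal.toReal_pos hs'.ne' ht)
    exact ⟨n, (ENNReal.ofReal_le_iff_le_toReal ht).2 hn.le⟩
  have hfin : volume (ep v E) ≠ ⊤ := (isBounded_ep hv hb).measure_lt_top.ne
  have hlim := tendsto_measure_iUnion_atTop (μ := volume) hmono
  rw [hU] at hlim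
  have hlim' : Tendsto (fun n => volume.real (B n)) atTop (nhds (volume.real (ep v E))) :=
    (ENNReal.tendsto_toReal hfin).comp hlim
  obtain ⟨n, hn⟩ := (hlim'.eventually (lt_mem_nhds (sub_lt_self _ hε))).exists
  exact ⟨_, hpos n, by linarith, hsub n⟩

/-- The function giving the one-dimensional field which is almost optimal for `E`. -/
theorem exists_slice_field {v : Plane} (hv : v ≠ 0) {E : Set Plane} (hE : MeasurableSet E)
    (hb : Bornology.IsBounded E) {ε : ℝ} (hε : 0 < ε) :
    ∃ σ : Plane → ℝ, ContDiff ℝ 1 σ ∧ HasCompactSupport σ ∧ (∀ x, |σ x| ≤ 1) ∧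
      2 * volume.real (ep v E) ≤ (∫ x in E, fderiv ℝ σ x v) + ε := by
  obtain ⟨τ, hτ, hlev, -⟩ := exists_level hv hb (show 0 < ε / 8 by linarith)
  set B := {s | ENNReal.ofReal τ ≤ volume (fib v E s)} with hB
  have hBm : MeasurableSet B := measurableSet_le measurable_const (measurable_volume_fib hE)
  have hBsub : B ⊆ ep v E := fun s hs => (ENNReal.ofReal_pos.2 hτ).trans_le hs
  have hBfin : volume B ≠ ⊤ := measure_ne_top_of_subset hBsub (isBounded_ep hv hb).measure_lt_top.ne
  have hEfin : volume E ≠ ⊤ := hb.measure_lt_top.ne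
  set b := volume.real B
  have hb0 : 0 ≤ b := measureReal_nonneg
  set ρ := τ * ε / 8 with hρ
  have hρ0 : 0 < ρ := by positivity
  set δ := ρ / (b + 1) with hδ
  have hδ0 : 0 < δ := by positivity
  have hδb : δ * b ≤ ρ := by
    rw [hδ, div_mul_eq_mul_div, div_le_iff₀ (by positivity)]
    nlinarith
  have hρ2 : ENNReal.ofReal (ρ / 2) ≠ 0 := by simp [hρ0]
  obtain ⟨K, hKE, hK, hKd⟩ := hE.exists_isCompact_sdiff_lt hEfin hρ2
  obtain ⟨U', hEU', hU', -, hUd'⟩ := hE.exists_isOpen_sdiff_lt hEfin hρ2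
  obtain ⟨β, hβ0, hβ⟩ : ∃ β : ℝ, 0 < β ∧ E ⊆ Metric.ball 0 β := by
    obtain ⟨β, hβ⟩ := hb.subset_ball 0
    exact ⟨max β 1, by positivity, hβ.trans (Metric.ball_subset_ball (le_max_left _ _))⟩
  set U := U' ∩ Metric.ball 0 β
  have hU : IsOpen U := hU'.inter Metric.isOpen_ball
  have hEU : E ⊆ U := subset_inter hEU' hβ
  have hUb : Bornology.IsBounded U := Metric.isBounded_ball.subset inter_subset_right
  have hUK : volume (U \ K) ≤ ENNReal.ofReal ρ := by
    have hs : U \ K ⊆ (U' \ E) ∪ (E \ K) := by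
      rintro x ⟨⟨h1, -⟩, h2⟩
      by_cases h : x ∈ E
      · exact Or.inr ⟨h, h2⟩
      · exact Or.inl ⟨h1, h⟩
    calc volume (U \ K) ≤ volume (U' \ E) + volume (E \ K) :=
          (measure_mono hs).trans (measure_union_le _ _)
      _ ≤ ENNReal.ofReal (ρ / 2) + ENNReal.ofReal (ρ / 2) := add_le_add hUd'.le hKd.le
      _ = ENNReal.ofReal ρ := by
        rw [← ENNReal.ofReal_add (by positivity) (by positivity)]; congr 1; ring
  obtain ⟨h, hh, hhc, hh0, hh1, hhU, hhK⟩ := exists_cutoff hK hU (hKE.trans hEU) hUb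
  have hvn : 0 < ‖v‖ := norm_pos_iff.2 hv
  set L := 2 * β / ‖v‖ with hL
  have hL0 : 0 < L := by positivity
  have hLv : L * ‖v‖ = 2 * β := by rw [hL]; field_simp
  have hfar : ∀ x ∈ E, ∀ t : ℝ, |t| = L → h (x - t • v) = 0 := by
    intro x hx t ht
    refine hhU _ fun hm => ?_
    have h1 : ‖x‖ < β := by simpa using hβ hx
    have h2 : ‖x - t • v‖ < β := by simpa using hm.2
    have h3 : ‖t • v‖ = 2 * β := by rw [norm_smul, Real.norm_eq_abs, ht, hLv]
    have h4 : ‖t • v‖ ≤ ‖x‖ + ‖x - t • v‖ := by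
      have := norm_sub_le x (x - t • v)
      simpa using this
    linarith
  let m : Plane → ℝ := fun x => ∫ t in (-L)..L, h (x - t • v)
  let H : Plane → ℝ := fun x => ∫ t in (0)..L, h (x - t • v)
  have hcc : ∀ x : Plane, Continuous fun t : ℝ => h (x - t • v) := fun x =>
    hh.continuous.comp (by fun_prop)
  have hmd : ContDiff ℝ 1 m := contDiff_lineInt hh hhc v _ _
  have hHd : ContDiff ℝ 1 H := contDiff_lineInt hh hhc v _ _
  have hH0 : ∀ x, 0 ≤ H x := fun x => intervalIntegral.integral_nonneg hL0.le fun t _ => hh0 _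
  have hHm : ∀ x, H x ≤ m x := by
    intro x
    have h1 := intervalIntegral.integral_add_adjacent_intervals (a := -L) (b := 0) (c := L)
      ((hcc x).intervalIntegrable (μ := volume) _ _) ((hcc x).intervalIntegrable _ _)
    have h2 : 0 ≤ ∫ t in (-L)..0, h (x - t • v) :=
      intervalIntegral.integral_nonneg (by linarith) fun t _ => hh0 _
    simp only [m, H]
    linarith
  have hm0 : ∀ x, 0 ≤ m x := fun x => (hH0 x).trans (hHm x)
  let χ : ContDiffBump (0 : Plane) := ⟨β, β + 1, hβ0, by linarith⟩
  let q : Plane → ℝ := fun x => -1 + 2 * (H x * (δ + m x)⁻¹)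
  have hqd : ContDiff ℝ 1 q := by
    have : ContDiff ℝ 1 fun x => H x * (δ + m x)⁻¹ :=
      hHd.mul ((contDiff_const.add hmd).inv fun x => by linarith [hm0 x])
    exact contDiff_const.add (contDiff_const.mul this)
  have hq : ∀ x, |q x| ≤ 1 := by
    intro x
    have h0 : H x * (δ + m x)⁻¹ = H x / (δ + m x) := rfl
    have h1 : 0 ≤ H x / (δ + m x) := div_nonneg (hH0 x) (by linarith [hm0 x])
    have h2 : H x / (δ + m x) ≤ 1 := by
      rw [div_le_one (by linarith [hm0 x])]; linarith [hHm x]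
    rw [abs_le]
    constructor <;> simp only [q, h0] <;> linarith
  have hχd : ContDiff ℝ 1 (χ : Plane → ℝ) := χ.contDiff
  have hder : ∀ x ∈ E, fderiv ℝ (fun x => χ x * q x) x v = 2 * h x / (δ + m x) := by
    intro x hx
    have he : (fun x => χ x * q x) =ᶠ[nhds x] q := by
      filter_upwards [χ.eventuallyEq_one_of_mem_ball (hβ hx)] with y hy
      rw [hy]; simp
    have hDH : HasFDerivAt H (fderiv ℝ H x) x := (hHd.differentiable one_ne_zero x).hasFDerivAt
    have hDm : HasFDerivAt m (fderiv ℝ m x) x := (hmd.differentiable one_ne_zero x).hasFDerivAt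
    have e1 : fderiv ℝ H x v = h x := by
      rw [fderiv_lineInt hh hhc, hfar x hx L (abs_of_pos hL0)]; simp
    have e2 : fderiv ℝ m x v = 0 := by
      rw [fderiv_lineInt hh hhc, hfar x hx L (abs_of_pos hL0),
        hfar x hx (-L) (by rw [abs_neg, abs_of_pos hL0])]; simp
    have hne : δ + m x ≠ 0 := by linarith [hm0 x]
    have hDi := (hasDerivAt_inv hne).comp_hasFDerivAt x (hDm.const_add δ)
    have hD := ((hDH.mul hDi).const_mul 2).const_add (-1)
    rw [he.fderiv_eq]
    have : fderiv ℝ q x = _ := hD.fderiv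
    rw [this]
    simp [e1, e2]
    field_simp
  refine ⟨fun x => χ x * q x, hχd.mul hqd, χ.hasCompactSupport.mul_right, fun x => ?_, ?_⟩
  · rw [abs_mul, abs_of_nonneg χ.nonneg]
    exact mul_le_one₀ χ.le_one (abs_nonneg _) (hq x)
  rw [setIntegral_congr_fun hE hder]
  have hfc : Continuous fun x => 2 * h x / (δ + m x) :=
    (continuous_const.mul hh.continuous).div (continuous_const.add hmd.continuous)
      fun x => by linarith [hm0 x]
  have hf0 : ∀ x, 0 ≤ 2 * h x / (δ + m x) := fun x =>
    div_nonneg (by linarith [hh0 x]) (by linarith [hm0 x])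
  have hfi : IntegrableOn (fun x => 2 * h x / (δ + m x)) E :=
    (hfc.continuousOn.integrableOn_compact hb.isCompact_closure).mono_set subset_closure
  set u : ℝ → ℝ≥0∞ := fun s => volume (fib v U s)
  have hum : Measurable u := measurable_volume_fib hU.measurableSet
  set δ' := ENNReal.ofReal δ
  set τ' := ENNReal.ofReal τ
  set I := ∫⁻ s, (δ' + u s)⁻¹ * volume (fib v K s)
  have hI : 2 * I ≤ ENNReal.ofReal (∫ x in E, 2 * h x / (δ + m x)) := by
    rw [ofReal_integral_eq_lintegral_ofReal hfi (Eventually.of_forall hf0)]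
    have e : I = ∫⁻ x in K, (δ' + u (crL v x))⁻¹ :=
      (setLIntegral_crL hv hK.measurableSet (g := fun s => (δ' + u s)⁻¹)
        (measurable_const.add hum).inv).symm
    rw [e, ← lintegral_const_mul' _ _ (by simp)]
    refine le_trans ?_ (lintegral_mono_set hKE)
    refine setLIntegral_mono' hK.measurableSet fun x hx => ?_
    rw [hhK x hx, mul_one, div_eq_mul_inv, ENNReal.ofReal_mul (by norm_num),
      ENNReal.ofReal_inv_of_pos (by linarith [hm0 x]), ENNReal.ofReal_add hδ0.le (hm0 x)]
    have := lineInt_le_volume_fib hU hv hh.continuous hh0 (fun y => ?_) hL0.le x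
    · simp only [ENNReal.ofReal_ofNat]
      gcongr
    · by_cases hy : y ∈ U
      · rw [indicator_of_mem hy]; exact hh1 y
      · rw [indicator_of_notMem hy, hhU y hy]
  have hmain : volume B ≤ I + (δ' * volume B + volume (U \ K)) * τ'⁻¹ := by
    have hd : Measurable fun s => volume (fib v (U \ K) s) :=
      measurable_volume_fib (hU.measurableSet.diff hK.measurableSet)
    have hd' : Measurable fun s => δ' + volume (fib v (U \ K) s) := measurable_const.add hd
    calc volume B = ∫⁻ s in B, 1 := by simp
      _ ≤ ∫⁻ s in B, ((δ' + u s)⁻¹ * volume (fib v K s) +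
            (δ' + volume (fib v (U \ K) s)) * τ'⁻¹) := by
          refine setLIntegral_mono' hBm fun s hs => ?_
          refine ennreal_ratio (e := volume (fib v E s)) (by simp [τ'])
            (by simp [δ', hδ0]) (by simp [δ']) ?_ hs (measure_mono fun y hy => hEU hy)
            (isCompact_fib hv hK s).measure_lt_top.ne
          refine (measure_mono ?_).trans (measure_union_le _ _)
          intro y hy
          by_cases hyK : coord v (s, y) ∈ K
          · exact Or.inl hyK
          · exact Or.inr ⟨hy, hyK⟩
      _ = (∫⁻ s in B, (δ' + u s)⁻¹ * volume (fib v K s)) +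
            ∫⁻ s in B, (δ' + volume (fib v (U \ K) s)) * τ'⁻¹ :=
          lintegral_add_right _ (hd'.mul_const _)
      _ ≤ I + (δ' * volume B + volume (U \ K)) * τ'⁻¹ := by
          refine add_le_add (setLIntegral_le_lintegral _ _) ?_
          rw [lintegral_mul_const _ hd', lintegral_add_left measurable_const,
            setLIntegral_const, volume_eq_lintegral_fib hv (hU.measurableSet.diff hK.measurableSet)]
          gcongr
          exact Measure.restrict_le_self
  have hJ0 : 0 ≤ ∫ x in E, 2 * h x / (δ + m x) := setIntegral_nonneg hE fun x _ => hf0 x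
  have hIfin : I ≠ ⊤ := by
    intro h
    rw [h] at hI
    simp at hI
  have hIr : 2 * I.toReal ≤ ∫ x in E, 2 * h x / (δ + m x) := by
    have := ENNReal.toReal_mono ENNReal.ofReal_ne_top hI
    rwa [ENNReal.toReal_mul, ENNReal.toReal_ofReal hJ0, ENNReal.toReal_ofNat] at this
  have hbr : b ≤ I.toReal + (δ * b + ρ) * τ⁻¹ := by
    have h1 : volume B ≤ I + (δ' * volume B + ENNReal.ofReal ρ) * τ'⁻¹ :=
      hmain.trans (by gcongr)
    have hτi : τ'⁻¹ ≠ ⊤ := ENNReal.inv_ne_top.2 (by simp [τ', hτ])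
    have h3 : δ' * volume B + ENNReal.ofReal ρ ≠ ⊤ :=
      ENNReal.add_ne_top.2 ⟨ENNReal.mul_ne_top (by simp [δ']) hBfin, by simp⟩
    have h2 := ENNReal.toReal_mono (ENNReal.add_ne_top.2 ⟨hIfin, ENNReal.mul_ne_top h3 hτi⟩) h1
    rw [ENNReal.toReal_add hIfin (ENNReal.mul_ne_top h3 hτi), ENNReal.toReal_mul,
      ENNReal.toReal_add (ENNReal.mul_ne_top (by simp [δ']) hBfin) (by simp), ENNReal.toReal_mul,
      ENNReal.toReal_ofReal hδ0.le, ENNReal.toReal_ofReal hρ0.le, ENNReal.toReal_inv,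
      ENNReal.toReal_ofReal hτ.le] at h2
    exact h2
  have h5 : (δ * b + ρ) * τ⁻¹ ≤ ε / 4 := by
    rw [mul_inv_le_iff₀ hτ]
    rw [hρ] at hδb ⊢
    linarith
  linarith

theorem diverg_smul_const {σ : Plane → ℝ} (hσ : ContDiff ℝ 1 σ) (v x : Plane) :
    diverg (fun x => σ x • v) x = fderiv ℝ σ x v := by
  have h : fderiv ℝ (fun x => σ x • v) x = (fderiv ℝ σ x).smulRight v :=
    ((hσ.differentiable one_ne_zero x).hasFDerivAt.smul_const v).fderiv
  have e := clm_apply_plane (fderiv ℝ σ x) v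
  simp only [diverg, h, Fin.sum_univ_two, ContinuousLinearMap.smulRight_apply, Pi.smul_apply,
    smul_eq_mul]
  rw [e, show (![1, 0] : Plane) = Pi.single 0 1 by ext i; fin_cases i <;> simp,
    show (![0, 1] : Plane) = Pi.single 1 1 by ext i; fin_cases i <;> simp]
  ring

theorem diverg_add {η ζ : Plane → Plane} (hη : ContDiff ℝ 1 η) (hζ : ContDiff ℝ 1 ζ) (x : Plane) :
    diverg (fun x => η x + ζ x) x = diverg η x + diverg ζ x := by
  have h : fderiv ℝ (fun x => η x + ζ x) x = fderiv ℝ η x + fderiv ℝ ζ x :=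
    ((hη.differentiable one_ne_zero x).hasFDerivAt.add
      (hζ.differentiable one_ne_zero x).hasFDerivAt).fderiv
  simp only [diverg, h, add_apply, Pi.add_apply, Finset.sum_add_distrib]

theorem exists_zono_field {E : Set Plane} (hE : MeasurableSet E) (hb : Bornology.IsBounded E)
    (l : List Plane) (hl : ∀ v ∈ l, v ≠ 0) {ε : ℝ} (hε : 0 < ε) :
    ∃ η : Plane → Plane, ContDiff ℝ 1 η ∧ HasCompactSupport η ∧ (∀ x, η x ∈ zono l) ∧
      (l.map fun v => 2 * volume.real (ep v E)).sum ≤ (∫ x in E, diverg η x) + ε := by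
  induction l generalizing ε with
  | nil =>
    refine ⟨fun _ => 0, contDiff_const, HasCompactSupport.zero, fun x => rfl, ?_⟩
    simp [diverg, hε.le]
  | cons v l ih =>
    obtain ⟨η, h1, h2, h3, h4⟩ := ih (fun w hw => hl w (List.mem_cons_of_mem _ hw)) (half_pos hε)
    obtain ⟨σ, s1, s2, s3, s4⟩ := exists_slice_field (hl v List.mem_cons_self) hE hb (half_pos hε)
    have s1' : ContDiff ℝ 1 fun x => σ x • v := s1.smul contDiff_const
    have s2' : HasCompactSupport fun x => σ x • v := s2.smul_right
    refine ⟨fun x => σ x • v + η x, s1'.add h1, s2'.add h2,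
      fun x => ⟨_, ⟨σ x, abs_le.1 (s3 x), rfl⟩, _, h3 x, rfl⟩, ?_⟩
    have e : ∀ x, diverg (fun x => σ x • v + η x) x =
        diverg (fun x => σ x • v) x + diverg η x := fun x => diverg_add s1' h1 x
    simp only [e, List.map_cons, List.sum_cons]
    rw [integral_add (integrable_diverg s1' s2').integrableOn (integrable_diverg h1 h2).integrableOn]
    simp only [diverg_smul_const s1]
    linarith

theorem PerLe.sum_ep_le {φ : Plane → ℝ} {E : Set Plane} (hE : MeasurableSet E)
    (hb : Bornology.IsBounded E) {p : ℝ} (hp : PerLe φ E p) {l : List Plane}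
    (hl : ∀ v ∈ l, v ≠ 0) (hz : ∀ x ∈ zono l, φ x ≤ 1) :
    (l.map fun v => 2 * volume.real (ep v E)).sum ≤ p := by
  refine le_of_forall_pos_le_add fun ε hε => ?_
  obtain ⟨η, h1, h2, h3, h4⟩ := exists_zono_field hE hb l hl hε
  linarith [hp η h1 h2 fun x => hz _ (h3 x)]

end Projection

section Hull

/-- The closed convex hull of the essential support of `E`. -/
def hull (E : Set Plane) : Set Plane := closure (convexHull ℝ (volume.restrict E).support)

theorem convex_hull (E : Set Plane) : Convex ℝ (hull E) := (convex_convexHull ℝ _).closure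

theorem hull_subset {E D : Set Plane} (hD : IsClosed D) (hc : Convex ℝ D) (hE : MeasurableSet E)
    (h : volume (E \ D) = 0) : hull E ⊆ D := by
  refine closure_minimal (convexHull_min ?_ hc) hD
  refine Measure.support_subset_of_isClosed hD ?_
  rw [mem_ae_iff, Measure.restrict_apply' hE, inter_comm]
  exact h

theorem volume_diff_hull {E : Set Plane} (hE : MeasurableSet E) : volume (E \ hull E) = 0 := by
  have h : volume.restrict E (hull E)ᶜ = 0 :=
    measure_mono_null (compl_subset_compl.2
      ((subset_convexHull ℝ (volume.restrict E).support).trans subset_closure))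
      Measure.measure_compl_support
  rw [Measure.restrict_apply' hE, inter_comm] at h
  exact h

theorem isCompact_hull {E : Set Plane} (hE : MeasurableSet E) (hb : Bornology.IsBounded E) :
    IsCompact (hull E) := by
  refine Metric.isCompact_of_isClosed_isBounded isClosed_closure ?_
  obtain ⟨β, hβ⟩ := hb.subset_closedBall 0
  refine Metric.isBounded_closedBall.subset (hull_subset Metric.isClosed_closedBall
    (convex_closedBall (0 : Plane) β) hE ?_)
  rw [sdiff_eq_empty.2 hβ, measure_empty]

theorem hull_nonempty {E : Set Plane} (hE : MeasurableSet E) (h : volume E ≠ 0) :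
    (hull E).Nonempty := by
  by_contra hcon
  rw [not_nonempty_iff_eq_empty] at hcon
  have := volume_diff_hull hE
  rw [hcon, sdiff_empty] at this
  exact h this

theorem volume_inter_strip {v : Plane} (hv : v ≠ 0) {E : Set Plane} (hE : MeasurableSet E)
    {T : Set ℝ} (hT : MeasurableSet T) :
    volume (E ∩ crL v ⁻¹' T) = ∫⁻ s in T, volume (fib v E s) := by
  have h := setLIntegral_crL hv hE (g := T.indicator 1) (measurable_one.indicator hT)
  have e1 : ∀ x, T.indicator (1 : ℝ → ℝ≥0∞) (crL v x) = (crL v ⁻¹' T).indicator 1 x := fun x => rfl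
  have hm : MeasurableSet (crL v ⁻¹' T) := (crL v).continuous.measurable hT
  simp only [e1] at h
  rw [lintegral_indicator_one hm, Measure.restrict_apply hm, inter_comm] at h
  rw [h, ← lintegral_indicator hT]
  refine lintegral_congr fun s => ?_
  by_cases hs : s ∈ T <;> simp [hs]

theorem exists_gap {v : Plane} (hv : v ≠ 0) {E : Set Plane} (hE : MeasurableSet E)
    (hb : Bornology.IsBounded E) (hlt : volume.real (ep v E) < wd v (hull E)) :
    ∃ s₀, (∀ ε > 0, ∀ δ₀ > 0, ∃ δ > 0, δ < δ₀ ∧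
      volume.real (E ∩ {x | |crL v x - s₀| ≤ δ}) ≤ ε * δ) ∧
      0 < volume (E ∩ {x | crL v x < s₀}) ∧ 0 < volume (E ∩ {x | s₀ < crL v x}) := by
  have hE0 : volume E ≠ 0 := by
    intro h0
    have : hull E ⊆ ∅ := hull_subset isClosed_empty convex_empty hE (by simpa using h0)
    rw [subset_empty_iff.1 this] at hlt
    simp only [wd, image_empty, measureReal_empty] at hlt
    linarith [measureReal_nonneg (μ := volume) (s := ep v E)]
  obtain ⟨a, b, hab, hI⟩ := image_crL_eq_Icc (v := v) (isCompact_hull hE hb) (convex_hull E)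
    (hull_nonempty hE hE0)
  have hwd : wd v (hull E) = b - a := by
    rw [wd, hI, measureReal_def, Real.volume_Icc, ENNReal.toReal_ofReal (by linarith)]
  -- the fibre measure is an integrable function
  let g : ℝ → ℝ := fun s => (volume (fib v E s)).toReal
  have hgm : Measurable g := (measurable_volume_fib hE).ennreal_toReal
  have hEfin : volume E ≠ ⊤ := hb.measure_lt_top.ne
  have hgi : Integrable g := by
    refine integrable_toReal_of_lintegral_ne_top (measurable_volume_fib hE).aemeasurable ?_
    rw [← volume_eq_lintegral_fib hv hE]
    exact hEfin
  have hffin : ∀ᵐ s, volume (fib v E s) < ⊤ :=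
    ae_lt_top (measurable_volume_fib hE) (by rw [← volume_eq_lintegral_fib hv hE]; exact hEfin)
  have hstrip : ∀ s₀ δ : ℝ, volume.real (E ∩ {x | |crL v x - s₀| ≤ δ}) =
      ∫ s in Metric.closedBall s₀ δ, g s := by
    intro s₀ δ
    have h1 := volume_inter_strip hv hE (T := Metric.closedBall s₀ δ) measurableSet_closedBall
    rw [integral_toReal (measurable_volume_fib hE).aemeasurable (ae_restrict_of_ae hffin), ← h1]
    rfl
  have hleb := IsUnifLocDoublingMeasure.ae_tendsto_average (volume : Measure ℝ)
    hgi.locallyIntegrable 1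
  have hG : volume (Ioo a b \ ep v E) ≠ 0 := by
    intro h0
    have h1 : volume.real (Ioo a b) ≤ volume.real (ep v E) := by
      have hle : volume (Ioo a b) ≤ volume (ep v E) := by
        have := measure_mono (μ := volume) (show Ioo a b ⊆ (Ioo a b \ ep v E) ∪ ep v E from
          fun s hs => by by_cases h : s ∈ ep v E; exacts [Or.inr h, Or.inl ⟨hs, h⟩])
        refine this.trans ((measure_union_le _ _).trans ?_)
        rw [h0, zero_add]
      exact ENNReal.toReal_mono (isBounded_ep hv hb).measure_lt_top.ne hle
    rw [measureReal_def, Real.volume_Ioo, ENNReal.toReal_ofReal (by linarith)] at h1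
    linarith
  obtain ⟨s₀, ⟨hs₀, hs₀E⟩, hs₀l⟩ : ∃ s₀ ∈ Ioo a b \ ep v E, ∀ {ι : Type} {l : Filter ι} (w : ι → ℝ)
      (δ : ι → ℝ), Tendsto δ l (nhdsWithin 0 (Ioi 0)) →
        (∀ᶠ j in l, s₀ ∈ Metric.closedBall (w j) (1 * δ j)) →
          Tendsto (fun j => ⨍ y in Metric.closedBall (w j) (δ j), g y) l (nhds (g s₀)) := by
    by_contra! hcon
    refine hG (measure_mono_null (fun s hs => ?_) hleb)
    intro h
    obtain ⟨ι, l, w, δ, h1, h2, h3⟩ := hcon s hs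
    exact h3 (h w δ h1 h2)
  have hg0 : g s₀ = 0 := by
    have : volume (fib v E s₀) = 0 := by
      have := hs₀E
      simpa [ep] using this
    simp [g, this]
  refine ⟨s₀, fun ε hε δ₀ hδ₀ => ?_, ?_, ?_⟩
  · have ht := hs₀l (ι := ℝ) (l := nhdsWithin 0 (Ioi 0)) (fun _ => s₀) id tendsto_id
      (by filter_upwards [self_mem_nhdsWithin] with δ hδ
          exact Metric.mem_closedBall_self (by simpa using (le_of_lt (show (0 : ℝ) < δ from hδ))))
    rw [hg0] at ht
    have h1 := ht.eventually (gt_mem_nhds (show 0 < ε / 2 by linarith))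
    have h2 : ∀ᶠ δ : ℝ in nhdsWithin 0 (Ioi 0), δ < δ₀ :=
      nhdsWithin_le_nhds (gt_mem_nhds hδ₀)
    obtain ⟨δ, ⟨h3, h4⟩, h5⟩ := ((h1.and h2).and self_mem_nhdsWithin).exists
    have h5' : (0 : ℝ) < δ := h5
    refine ⟨δ, h5', h4, ?_⟩
    rw [hstrip]
    simp only [id] at h3
    rw [setAverage_eq, smul_eq_mul, measureReal_def, Real.volume_closedBall,
      ENNReal.toReal_ofReal (by linarith), inv_mul_lt_iff₀ (by linarith)] at h3
    linarith
  · refine pos_iff_ne_zero.2 fun h0 => ?_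
    have hsub : hull E ⊆ {x | s₀ ≤ crL v x} := by
      refine hull_subset (isClosed_le continuous_const (crL v).continuous)
        (convex_halfSpace_ge (crL v).isLinear s₀) hE (measure_mono_null ?_ h0)
      rintro x ⟨h1, h2⟩
      exact ⟨h1, by simpa using h2⟩
    obtain ⟨x, hx, hxa⟩ : a ∈ crL v '' hull E := by rw [hI]; exact left_mem_Icc.2 hab
    have : s₀ ≤ crL v x := hsub hx
    linarith [hs₀.1]
  · refine pos_iff_ne_zero.2 fun h0 => ?_
    have hsub : hull E ⊆ {x | crL v x ≤ s₀} := by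
      refine hull_subset (isClosed_le (crL v).continuous continuous_const)
        (convex_halfSpace_le (crL v).isLinear s₀) hE (measure_mono_null ?_ h0)
      rintro x ⟨h1, h2⟩
      exact ⟨h1, by simpa using h2⟩
    obtain ⟨x, hx, hxb⟩ : b ∈ crL v '' hull E := by rw [hI]; exact right_mem_Icc.2 hab
    have : crL v x ≤ s₀ := hsub hx
    linarith [hs₀.2]

end Hull

section Cut

theorem diverg_smul {g : Plane → ℝ} {ζ : Plane → Plane} {x : Plane}
    (hg : DifferentiableAt ℝ g x) (hζ : DifferentiableAt ℝ ζ x) :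
    diverg (fun y => g y • ζ y) x = g x * diverg ζ x + fderiv ℝ g x (ζ x) := by
  have h := fderiv_fun_smul hg hζ
  unfold diverg
  rw [h, clm_apply_plane (fderiv ℝ g x) (ζ x),
    show (![1, 0] : Plane) = Pi.single 0 1 by ext i; fin_cases i <;> simp,
    show (![0, 1] : Plane) = Pi.single 1 1 by ext i; fin_cases i <;> simp]
  simp [Fin.sum_univ_two]
  ring

theorem exists_deriv_smoothTransition_bound :
    ∃ B : ℝ, 0 ≤ B ∧ ∀ t, |deriv Real.smoothTransition t| ≤ B ∧
      (t < 0 ∨ 1 < t → deriv Real.smoothTransition t = 0) := by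
  have hz : ∀ t, (t < 0 ∨ 1 < t → deriv Real.smoothTransition t = 0) := by
    rintro t (ht | ht)
    · have : Real.smoothTransition =ᶠ[nhds t] fun _ => 0 := by
        filter_upwards [gt_mem_nhds ht] with u hu
        exact Real.smoothTransition.zero_of_nonpos hu.le
      rw [this.deriv_eq, deriv_const]
    · have : Real.smoothTransition =ᶠ[nhds t] fun _ => 1 := by
        filter_upwards [lt_mem_nhds ht] with u hu
        exact Real.smoothTransition.one_of_one_le hu.le
      rw [this.deriv_eq, deriv_const]
  have hc : Continuous (deriv Real.smoothTransition) :=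
    (Real.smoothTransition.contDiff (n := 1)).continuous_deriv le_rfl
  obtain ⟨B, hB⟩ := (isCompact_Icc (a := (0 : ℝ)) (b := 1)).exists_bound_of_continuousOn
    hc.continuousOn
  refine ⟨max B 0, le_max_right _ _, fun t => ⟨?_, hz t⟩⟩
  by_cases ht : t ∈ Icc (0 : ℝ) 1
  · exact (hB t ht).trans (le_max_left _ _)
  · rw [hz t]
    · simp
    · by_contra! h
      exact ht ⟨h.1, h.2⟩

variable {φ : Plane → ℝ}

theorem PerLe.cut_sum (hφ : IsNorm φ) {E : Set Plane} {p : ℝ} (hp : PerLe φ E p)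
    (hfin : volume E ≠ ∞) (L : Plane →L[ℝ] ℝ) (s : ℝ)
    (hs : ∀ ε > 0, ∀ δ₀ > 0, ∃ δ > 0, δ < δ₀ ∧
      volume.real (E ∩ {x | |L x - s| ≤ δ}) ≤ ε * δ)
    {η₁ η₂ : Plane → Plane} (h1 : ContDiff ℝ 1 η₁) (c1 : HasCompactSupport η₁)
    (b1 : ∀ x, φ (η₁ x) ≤ 1) (h2 : ContDiff ℝ 1 η₂) (c2 : HasCompactSupport η₂)
    (b2 : ∀ x, φ (η₂ x) ≤ 1) :
    (∫ x in E ∩ {x | L x < s}, diverg η₁ x) + (∫ x in E ∩ {x | s < L x}, diverg η₂ x) ≤ p := by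
  obtain ⟨B, hB0, hB⟩ := exists_deriv_smoothTransition_bound
  obtain ⟨M₁, hM1⟩ := (hasCompactSupport_diverg c1).exists_bound_of_continuous
    (continuous_diverg h1)
  obtain ⟨M₂, hM2⟩ := (hasCompactSupport_diverg c2).exists_bound_of_continuous
    (continuous_diverg h2)
  obtain ⟨M, hM1', hM2'⟩ : ∃ M, (∀ x, |diverg η₁ x| ≤ M) ∧ ∀ x, |diverg η₂ x| ≤ M :=
    ⟨max M₁ M₂, fun x => (hM1 x).trans (le_max_left _ _),
      fun x => (hM2 x).trans (le_max_right _ _)⟩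
  have hM0 : 0 ≤ M := (abs_nonneg _).trans (hM1' 0)
  have hcs : HasCompactSupport fun x => L (η₂ x - η₁ x) := by
    have h3 : HasCompactSupport fun x => η₂ x - η₁ x := by
      have := c2.add c1.neg
      rwa [← sub_eq_add_neg] at this
    exact h3.comp_left (g := L) (map_zero L)
  obtain ⟨N, hN⟩ := hcs.exists_bound_of_continuous
    (L.continuous.comp (h2.continuous.sub h1.continuous))
  have hN0 : 0 ≤ N := (norm_nonneg _).trans (hN 0)
  set K := 2 * M + B * N with hK
  have hK0 : 0 ≤ K := by positivity
  refine le_of_forall_pos_le_add fun ε hε => ?_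
  obtain ⟨δ, hδ, hδ1, hv⟩ := hs (ε / (K + 1)) (by positivity) 1 one_pos
  set a : Plane → ℝ := fun x => (L x - s) / (2 * δ) + 1 / 2 with ha
  set g : Plane → ℝ := fun x => Real.smoothTransition (a x) with hg
  have hag : ∀ x, HasFDerivAt a ((2 * δ)⁻¹ • L) x := by
    intro x
    have := ((L.hasFDerivAt (x := x)).sub_const s).const_smul (2 * δ)⁻¹
    refine (this.add_const (1 / 2)).congr_of_eventuallyEq (Eventually.of_forall fun y => ?_)
    simp [ha]
    ring
  have hgd : ∀ x, HasFDerivAt g (deriv Real.smoothTransition (a x) • (2 * δ)⁻¹ • L) x := by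
    intro x
    have h3 : HasDerivAt Real.smoothTransition (deriv Real.smoothTransition (a x)) (a x) :=
      ((Real.smoothTransition.contDiff (n := 1)).differentiable one_ne_zero _).hasDerivAt
    exact h3.comp_hasFDerivAt x (hag x)
  have hgc : ContDiff ℝ 1 g := by
    refine (Real.smoothTransition.contDiff (n := 1)).comp ?_
    simp only [ha]
    fun_prop
  have hg0 : ∀ x, 0 ≤ g x := fun x => Real.smoothTransition.nonneg _
  have hg1 : ∀ x, g x ≤ 1 := fun x => Real.smoothTransition.le_one _
  set η : Plane → Plane := fun x => η₁ x + g x • (η₂ x - η₁ x) with hη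
  have hηc : ContDiff ℝ 1 η := h1.add (hgc.smul (h2.sub h1))
  have hηs : HasCompactSupport η := by
    have h3 : HasCompactSupport fun x => η₂ x - η₁ x := by
      have := c2.add c1.neg
      rwa [← sub_eq_add_neg] at this
    exact c1.add (h3.smul_left (f := g))
  have hηb : ∀ x, φ (η x) ≤ 1 := by
    intro x
    have e : η x = (1 - g x) • η₁ x + g x • η₂ x := by
      simp only [hη, sub_smul, smul_sub, one_smul]
      abel
    rw [e]
    refine (hφ.add_le _ _).trans ?_
    rw [hφ.smul_eq, hφ.smul_eq, abs_of_nonneg (hg0 x), abs_of_nonneg (sub_nonneg.2 (hg1 x))]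
    nlinarith [b1 x, b2 x, hg0 x, hg1 x]
  have hdiv : ∀ x, diverg η x = diverg η₁ x + (g x * (diverg η₂ x - diverg η₁ x) +
      deriv Real.smoothTransition (a x) * ((2 * δ)⁻¹ * L (η₂ x - η₁ x))) := by
    intro x
    have d1 := h1.differentiable one_ne_zero x
    have d2 := h2.differentiable one_ne_zero x
    have e3 : diverg (fun y => η₂ y - η₁ y) x = diverg η₂ x - diverg η₁ x := by
      unfold diverg
      rw [fderiv_fun_sub d2 d1]
      simp
    have e1 : diverg η x = diverg η₁ x + diverg (fun y => g y • (η₂ y - η₁ y)) x := by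
      have := fderiv_fun_add d1 ((hgd x).differentiableAt.smul (d2.sub d1))
      unfold diverg
      rw [← Finset.sum_add_distrib]
      refine Finset.sum_congr rfl fun i _ => ?_
      have h5 := DFunLike.congr_fun this (Pi.single i 1)
      exact congrFun h5 i
    rw [e1, diverg_smul (ζ := fun y => η₂ y - η₁ y) (hgd x).differentiableAt (d2.sub d1), e3, (hgd x).fderiv]
    simp
  have hL : Measurable L := L.continuous.measurable
  have m1 : MeasurableSet {x | L x < s} := measurableSet_lt hL measurable_const
  have m2 : MeasurableSet {x | s < L x} := measurableSet_lt measurable_const hL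
  have mT : MeasurableSet {x | |L x - s| ≤ δ} :=
    measurableSet_le (by fun_prop) measurable_const
  have i1 := integrable_diverg h1 c1
  have i2 := integrable_diverg h2 c2
  have iη := integrable_diverg hηc hηs
  have e1 : ∫ x in E ∩ {x | L x < s}, diverg η₁ x =
      ∫ x in E, indicator {x | L x < s} (diverg η₁) x := by
    rw [setIntegral_indicator m1]
  have e2 : ∫ x in E ∩ {x | s < L x}, diverg η₂ x =
      ∫ x in E, indicator {x | s < L x} (diverg η₂) x := by
    rw [setIntegral_indicator m2]
  have j1 : IntegrableOn (indicator {x | L x < s} (diverg η₁)) E :=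
    (i1.indicator m1).integrableOn
  have j2 : IntegrableOn (indicator {x | s < L x} (diverg η₂)) E :=
    (i2.indicator m2).integrableOn
  have jT : IntegrableOn (indicator {x | |L x - s| ≤ δ} fun _ => K / δ) E :=
    IntegrableOn.indicator (integrableOn_const hfin) mT
  have hpt : ∀ x, indicator {x | L x < s} (diverg η₁) x + indicator {x | s < L x} (diverg η₂) x
      ≤ diverg η x + indicator {x | |L x - s| ≤ δ} (fun _ => K / δ) x := by
    intro x
    rw [hdiv]
    by_cases hx : |L x - s| ≤ δ
    · rw [indicator_of_mem (show x ∈ {x | |L x - s| ≤ δ} from hx)]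
      have q1 : indicator {x | L x < s} (diverg η₁) x + indicator {x | s < L x} (diverg η₂) x
          ≤ M := by
        by_cases h3 : L x < s
        · have h4 : ¬ s < L x := by linarith
          simp only [indicator, mem_ofPred_eq, h3, h4, if_true, if_false, add_zero]
          exact (le_abs_self _).trans (hM1' x)
        · by_cases h4 : s < L x
          · simp only [indicator, mem_ofPred_eq, h3, h4, if_true, if_false, zero_add]
            exact (le_abs_self _).trans (hM2' x)
          · simp only [indicator, mem_ofPred_eq, h3, h4, if_false, add_zero]
            exact hM0
      have q2 : -M ≤ diverg η₁ x + g x * (diverg η₂ x - diverg η₁ x) := by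
        have := (abs_le.1 (hM1' x)).1
        have := (abs_le.1 (hM2' x)).1
        nlinarith [hg0 x, hg1 x]
      have q3 : -(B * N / δ) ≤ deriv Real.smoothTransition (a x) * ((2 * δ)⁻¹ * L (η₂ x - η₁ x)) := by
        refine neg_le_of_abs_le ?_
        rw [abs_mul, abs_mul, abs_of_pos (by positivity : (0 : ℝ) < (2 * δ)⁻¹)]
        have := hN x
        rw [Real.norm_eq_abs] at this
        calc _ ≤ B * ((2 * δ)⁻¹ * N) := by
              gcongr
              · exact (hB _).1
          _ ≤ B * (δ⁻¹ * N) := by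
              gcongr
              linarith
          _ = B * N / δ := by ring
      have q4 : 2 * M ≤ 2 * M / δ := by
        rw [le_div_iff₀ hδ]
        nlinarith
      have q5 : K / δ = 2 * M / δ + B * N / δ := by rw [hK]; ring
      linarith
    · rw [indicator_of_notMem (show x ∉ {x | |L x - s| ≤ δ} from hx)]
      rw [not_le, lt_abs] at hx
      rcases hx with hx | hx
      · have h3 : 1 < a x := by
          have : 1 / 2 < (L x - s) / (2 * δ) := by
            rw [lt_div_iff₀ (by positivity)]
            linarith
          simp only [ha]
          linarith
        have h4 : s < L x := by linarith
        have h5 : ¬ L x < s := by linarith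
        have h6 : g x = 1 := Real.smoothTransition.one_of_one_le h3.le
        simp only [indicator, mem_ofPred_eq, h4, h5, if_true, if_false, (hB (a x)).2 (Or.inr h3), h6]
        linarith
      · have h3 : a x < 0 := by
          have : (L x - s) / (2 * δ) < - (1 / 2) := by
            rw [div_lt_iff₀ (by positivity)]
            linarith
          simp only [ha]
          linarith
        have h4 : ¬ s < L x := by linarith
        have h5 : L x < s := by linarith
        have h6 : g x = 0 := Real.smoothTransition.zero_of_nonpos h3.le
        simp only [indicator, mem_ofPred_eq, h4, h5, if_true, if_false, (hB (a x)).2 (Or.inl h3), h6]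
        linarith
  rw [e1, e2, ← integral_add j1 j2]
  calc _ ≤ ∫ x in E, (diverg η x + indicator {x | |L x - s| ≤ δ} (fun _ => K / δ) x) :=
        integral_mono (j1.add j2) (iη.integrableOn.add jT) hpt
    _ = (∫ x in E, diverg η x) + volume.real (E ∩ {x | |L x - s| ≤ δ}) * (K / δ) := by
        rw [integral_add iη.integrableOn jT, setIntegral_indicator mT, setIntegral_const, smul_eq_mul]
    _ ≤ p + ε := by
        gcongr
        · exact hp η hηc hηs hηb
        · calc _ ≤ ε / (K + 1) * δ * (K / δ) := by gcongr
            _ = ε * (K / (K + 1)) := by field_simp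
            _ ≤ ε * 1 := by
                gcongr
                rw [div_le_one (by positivity)]
                linarith
            _ = ε := mul_one _

theorem PerLe.cut (hφ : IsNorm φ) {E : Set Plane} {p : ℝ} (hp : PerLe φ E p)
    (hfin : volume E ≠ ∞) (L : Plane →L[ℝ] ℝ) (s : ℝ)
    (hs : ∀ ε > 0, ∀ δ₀ > 0, ∃ δ > 0, δ < δ₀ ∧
      volume.real (E ∩ {x | |L x - s| ≤ δ}) ≤ ε * δ) :
    ∃ p₁ p₂, p₁ + p₂ = p ∧ PerLe φ (E ∩ {x | L x < s}) p₁ ∧ PerLe φ (E ∩ {x | s < L x}) p₂ := by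
  set S : Set ℝ := {q | ∃ η : Plane → Plane, ContDiff ℝ 1 η ∧ HasCompactSupport η ∧
    (∀ x, φ (η x) ≤ 1) ∧ q = ∫ x in E ∩ {x | L x < s}, diverg η x} with hS
  have z1 : ContDiff ℝ 1 (0 : Plane → Plane) := contDiff_const
  have z2 : HasCompactSupport (0 : Plane → Plane) := HasCompactSupport.zero
  have z3 : ∀ x, φ ((0 : Plane → Plane) x) ≤ 1 := fun x => by simp [hφ.map_zero]
  have z4 : diverg (0 : Plane → Plane) = 0 := by funext x; simp [diverg]
  have hbdd : BddAbove S := by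
    refine ⟨p, ?_⟩
    rintro q ⟨η, h1, h2, h3, rfl⟩
    have := hp.cut_sum hφ hfin L s hs h1 h2 h3 z1 z2 z3
    simpa [z4] using this
  refine ⟨sSup S, p - sSup S, by ring, fun η h1 h2 h3 => le_csSup hbdd ⟨η, h1, h2, h3, rfl⟩,
    fun η h1 h2 h3 => ?_⟩
  rw [le_sub_comm]
  refine csSup_le ⟨0, 0, z1, z2, z3, by simp [z4]⟩ ?_
  rintro q ⟨ζ, g1, g2, g3, rfl⟩
  have := hp.cut_sum hφ hfin L s hs g1 g2 g3 h1 h2 h3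
  linarith

end Cut

section Isoperimetric

variable {φ : Plane → ℝ}

theorem zono_filter_subset (l : List Plane) : zono (l.filter (· ≠ 0)) ⊆ zono l := by
  induction l with
  | nil => simp
  | cons v l ih =>
    by_cases hv : v = 0
    · rw [List.filter_cons_of_neg (by simpa using hv)]
      refine ih.trans fun x hx => ?_
      exact ⟨0, zero_mem_sg v, x, hx, zero_add x⟩
    · rw [List.filter_cons_of_pos (by simpa using hv)]
      exact Set.add_subset_add_left ih

theorem zP_filter (l : List Plane) (C : Set Plane) : zP (l.filter (· ≠ 0)) C = zP l C := by
  induction l with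
  | nil => simp
  | cons v l ih =>
    by_cases hv : v = 0
    · rw [List.filter_cons_of_neg (by simpa using hv), ih]
      simp [zP, hv, wd_zero]
    · rw [List.filter_cons_of_pos (by simpa using hv)]
      simp only [zP, List.map_cons, List.sum_cons] at ih ⊢
      rw [ih]

theorem PerLe.MM_hull_le (hφ : IsNorm φ) {E : Set Plane} (hE : MeasurableSet E)
    (hb : Bornology.IsBounded E) (h0 : volume E ≠ 0) {p : ℝ} (hp : PerLe φ E p)
    (hgap : ∀ v ≠ 0, wd v (hull E) ≤ volume.real (ep v E)) : MM φ (hull E) ≤ p := by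
  refine le_of_tendsto' (tendsto_zP hφ (isCompact_hull hE hb) (convex_hull E)
    (hull_nonempty hE h0)) fun N => ?_
  rw [← zP_filter]
  refine le_trans ?_ (hp.sum_ep_le hE hb (l := (zz hφ N).filter (· ≠ 0)) (fun v hv => ?_)
    fun x hx => ?_)
  · refine List.sum_le_sum fun v hv => ?_
    have : v ≠ 0 := by simpa using (List.mem_filter.1 hv).2
    linarith [hgap v this]
  · simpa using (List.mem_filter.1 hv).2
  · have := zz_subset hφ N (zono_filter_subset _ hx)
    rw [mem_wulffBall, sub_zero] at this
    exact this.le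

theorem volume_inter_compl_ep {v : Plane} (hv : v ≠ 0) {E : Set Plane} (hE : MeasurableSet E) :
    volume (E ∩ crL v ⁻¹' (ep v E)ᶜ) = 0 := by
  rw [volume_inter_strip hv hE (measurableSet_ep hE).compl,
    setLIntegral_congr_fun (measurableSet_ep hE).compl (g := fun _ => 0), lintegral_zero]
  intro s hs
  simpa [ep] using hs

theorem exists_rough_isoperimetric (hφ : IsNorm φ) :
    ∃ κ > 0, ∀ E : Set Plane, MeasurableSet E → Bornology.IsBounded E → ∀ p, PerLe φ E p →
      κ * volume.real E ≤ p ^ 2 := by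
  obtain ⟨a, ha, hφa⟩ : ∃ a : ℝ, 0 < a ∧ a * (φ ![1, 0] + φ ![0, 1]) ≤ 1 := by
    have h0 := hφ.nonneg ![1, 0]
    have h1 := hφ.nonneg ![0, 1]
    refine ⟨(φ ![1, 0] + φ ![0, 1] + 1)⁻¹, by positivity, ?_⟩
    rw [inv_mul_le_iff₀ (by positivity)]
    linarith
  refine ⟨a ^ 2, by positivity, fun E hE hb p hp => ?_⟩
  set v₀ : Plane := a • ![1, 0] with hv₀
  set v₁ : Plane := a • ![0, 1] with hv₁
  have n0 : v₀ ≠ 0 := fun h => by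
    have := congrFun h 0
    simp [hv₀, ha.ne'] at this
  have n1 : v₁ ≠ 0 := fun h => by
    have := congrFun h 1
    simp [hv₁, ha.ne'] at this
  have hsum := hp.sum_ep_le hE hb (l := [v₀, v₁]) (by simp [n0, n1]) (by
    rintro x ⟨_, ⟨s, hs, rfl⟩, _, ⟨_, ⟨t, ht, rfl⟩, _, rfl, rfl⟩, rfl⟩
    have e : s • v₀ + (t • v₁ + 0) = (s * a) • ![1, 0] + (t * a) • ![0, 1] := by
      rw [hv₀, hv₁, add_zero, smul_smul, smul_smul]
    show φ (s • v₀ + (t • v₁ + 0)) ≤ 1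
    rw [e]
    refine (hφ.add_le _ _).trans ?_
    rw [hφ.smul_eq, hφ.smul_eq, abs_mul, abs_mul, abs_of_pos ha]
    have h0 := mul_nonneg ha.le (hφ.nonneg ![1, 0])
    have h1 := mul_nonneg ha.le (hφ.nonneg ![0, 1])
    have := abs_le.2 hs
    have := abs_le.2 ht
    nlinarith)
  simp only [List.map_cons, List.map_nil, List.sum_cons, List.sum_nil] at hsum
  have c0 : ∀ x : Plane, crL v₀ x = (-a) * x 1 := fun x => by simp [crL_apply, cr, hv₀]; ring
  have c1 : ∀ x : Plane, crL v₁ x = a * x 0 := fun x => by simp [crL_apply, cr, hv₁]; ring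
  set P : Set Plane := univ.pi ![(a * ·) ⁻¹' ep v₁ E, ((-a) * ·) ⁻¹' ep v₀ E] with hP
  have hvP : volume P = ENNReal.ofReal |a⁻¹| * volume (ep v₁ E) *
      (ENNReal.ofReal |(-a)⁻¹| * volume (ep v₀ E)) := by
    rw [hP, volume_pi_pi, Fin.prod_univ_two]
    simp only [Matrix.cons_val_zero, Matrix.cons_val_one]
    rw [Real.volume_preimage_mul_left ha.ne', Real.volume_preimage_mul_left (neg_ne_zero.2 ha.ne')]
  have hsub : E ⊆ P ∪ (E ∩ crL v₀ ⁻¹' (ep v₀ E)ᶜ) ∪ (E ∩ crL v₁ ⁻¹' (ep v₁ E)ᶜ) := by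
    intro x hx
    by_cases h0 : crL v₀ x ∈ ep v₀ E
    · by_cases h1 : crL v₁ x ∈ ep v₁ E
      · refine Or.inl (Or.inl fun i _ => ?_)
        rw [c0] at h0
        rw [c1] at h1
        fin_cases i
        · exact h1
        · exact h0
      · exact Or.inr ⟨hx, h1⟩
    · exact Or.inl (Or.inr ⟨hx, h0⟩)
  have hle : volume E ≤ volume P := by
    refine (measure_mono hsub).trans ((measure_union_le _ _).trans ?_)
    rw [volume_inter_compl_ep n1 hE, add_zero]
    refine (measure_union_le _ _).trans ?_
    rw [volume_inter_compl_ep n0 hE, add_zero]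
  have f0 : volume (ep v₀ E) ≠ ⊤ := (isBounded_ep n0 hb).measure_lt_top.ne
  have f1 : volume (ep v₁ E) ≠ ⊤ := (isBounded_ep n1 hb).measure_lt_top.ne
  have hle' : volume.real E ≤ a⁻¹ * volume.real (ep v₁ E) * (a⁻¹ * volume.real (ep v₀ E)) := by
    rw [hvP] at hle
    have := ENNReal.toReal_mono (by finiteness) hle
    simpa [measureReal_def, ENNReal.toReal_mul, abs_of_pos ha, ENNReal.toReal_ofReal,
      inv_nonneg.2 ha.le] using this
  have g0 := measureReal_nonneg (μ := volume) (s := ep v₀ E)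
  have g1 := measureReal_nonneg (μ := volume) (s := ep v₁ E)
  calc a ^ 2 * volume.real E
      ≤ a ^ 2 * (a⁻¹ * volume.real (ep v₁ E) * (a⁻¹ * volume.real (ep v₀ E))) := by gcongr
    _ = volume.real (ep v₁ E) * volume.real (ep v₀ E) := by field_simp
    _ ≤ p ^ 2 := by nlinarith

end Isoperimetric

section Minimal

variable {φ : Plane → ℝ}

theorem exists_minimal_piece (hφ : IsNorm φ) {r : ℝ} (hr : 0 < r) {E : Set Plane}
    (hE : MeasurableSet E) (hfin : volume E ≠ ∞) {p : ℝ} (hp : PerLe φ E p) :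
    ∃ A q, MeasurableSet A ∧ A ⊆ E ∧ PerLe φ A q ∧
      r * q - 2 * volume.real A ≤ r * p - 2 * volume.real E ∧
      ∀ B s, MeasurableSet B → B ⊆ A → PerLe φ B s →
        r * s - 2 * volume.real B ≤ r * q - 2 * volume.real A →
        volume.real A ≤ volume.real B := by
  let X := {x : Set Plane × ℝ // MeasurableSet x.1 ∧ x.1 ⊆ E ∧ PerLe φ x.1 x.2}
  let rel : X → X → Prop := fun y x => y.1.1 ⊆ x.1.1 ∧
    r * y.1.2 - 2 * volume.real y.1.1 ≤ r * x.1.2 - 2 * volume.real x.1.1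
  have hrefl : ∀ x, rel x x := fun x => ⟨subset_rfl, le_rfl⟩
  have htrans : ∀ x y z, rel x y → rel y z → rel x z := fun x y z h1 h2 =>
    ⟨h1.1.trans h2.1, h1.2.trans h2.2⟩
  have hXfin : ∀ x : X, volume x.1.1 ≠ ∞ := fun x => measure_ne_top_of_subset x.2.2.1 hfin
  have hstep : ∀ (n : ℕ) (x : X), ∃ y, rel y x ∧
      ∀ z, rel z x → volume.real y.1.1 ≤ volume.real z.1.1 + 1 / ((n : ℝ) + 1) := by
    intro n x
    set T : Set ℝ := (fun y : X => volume.real y.1.1) '' {y | rel y x}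
    obtain ⟨_, ⟨y, hy, rfl⟩, hlt⟩ := Real.lt_sInf_add_pos (s := T) ⟨_, x, hrefl x, rfl⟩
      (show (0 : ℝ) < 1 / ((n : ℝ) + 1) by positivity)
    refine ⟨y, hy, fun z hz => hlt.le.trans ?_⟩
    gcongr
    exact csInf_le ⟨0, by rintro _ ⟨u, -, rfl⟩; exact measureReal_nonneg⟩ ⟨z, hz, rfl⟩
  choose g hg1 hg2 using hstep
  let u : ℕ → X := fun n => Nat.rec ⟨(E, p), hE, subset_rfl, hp⟩ (fun n x => g n x) n
  have hu : ∀ n, u (n + 1) = g n (u n) := fun n => rfl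
  have hrel : ∀ n, rel (u (n + 1)) (u n) := fun n => hg1 n (u n)
  have hsub : Antitone fun n => (u n).1.1 := antitone_nat_of_succ_le fun n => (hrel n).1
  have hval : Antitone fun n => r * (u n).1.2 - 2 * volume.real (u n).1.1 :=
    antitone_nat_of_succ_le fun n => (hrel n).2
  have hvol : Antitone fun n => volume.real (u n).1.1 := fun i j hij =>
    measureReal_mono (hsub hij) (hXfin _)
  have hq : Antitone fun n => (u n).1.2 := fun i j hij => by
    have h1 := hval hij
    have h2 := hvol hij
    simp only at h1 h2
    exact le_of_mul_le_mul_left (by linarith) hr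
  set A : Set Plane := ⋂ n, (u n).1.1 with hA
  have hqb : BddBelow (range fun n => (u n).1.2) := by
    refine ⟨0, ?_⟩
    rintro _ ⟨n, rfl⟩
    exact PerLe.nonneg hφ (u n).2.2.2
  set q : ℝ := ⨅ n, (u n).1.2
  have hqt : Tendsto (fun n => (u n).1.2) atTop (nhds q) := tendsto_atTop_ciInf hq hqb
  have hAm : MeasurableSet A := MeasurableSet.iInter fun n => (u n).2.1
  have hAE : A ⊆ E := iInter_subset _ 0
  have hAt : Tendsto (fun n => volume.real (u n).1.1) atTop (nhds (volume.real A)) := by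
    refine (ENNReal.tendsto_toReal (measure_ne_top_of_subset hAE hfin)).comp ?_
    exact tendsto_measure_iInter_atTop (fun n => (u n).2.1.nullMeasurableSet) hsub ⟨0, hXfin _⟩
  have hAp : PerLe φ A q := by
    intro η h1 h2 h3
    have h4 := tendsto_setIntegral_of_antitone (μ := volume) (f := diverg η) (fun n => (u n).2.1)
      hsub ⟨0, (integrable_diverg h1 h2).integrableOn⟩
    exact le_of_tendsto_of_tendsto' h4 hqt fun n => (u n).2.2.2 η h1 h2 h3
  have hvalt : Tendsto (fun n => r * (u n).1.2 - 2 * volume.real (u n).1.1) atTop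
      (nhds (r * q - 2 * volume.real A)) := (hqt.const_mul r).sub (hAt.const_mul 2)
  have hle : ∀ n, r * q - 2 * volume.real A ≤ r * (u n).1.2 - 2 * volume.real (u n).1.1 :=
    fun n => hval.le_of_tendsto hvalt n
  refine ⟨A, q, hAm, hAE, hAp, hle 0, fun B s hB hBA hBs hBv => ?_⟩
  let z : X := ⟨(B, s), hB, hBA.trans hAE, hBs⟩
  have hz : ∀ n, rel z (u n) := fun n =>
    ⟨hBA.trans (iInter_subset _ n), hBv.trans (hle n)⟩
  have h1 : ∀ n : ℕ, volume.real A ≤ volume.real B + 1 / ((n : ℝ) + 1) := fun n =>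
    (measureReal_mono (iInter_subset _ (n + 1)) (hXfin _)).trans (hg2 n (u n) z (hz n))
  have h2 : Tendsto (fun n : ℕ => volume.real B + 1 / ((n : ℝ) + 1)) atTop
      (nhds (volume.real B + 0)) := tendsto_one_div_add_atTop_nhds_zero_nat.const_add _
  rw [add_zero] at h2
  exact ge_of_tendsto' h2 h1

end Minimal

section Alternative

variable {φ : Plane → ℝ}

/-- The alternative for a set `E` of perimeter at most `p` in a convex body `D`, at scale `r`. -/
def PerimeterAlt (φ : Plane → ℝ) (r : ℝ) (D E : Set Plane) (p : ℝ) : Prop :=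
  2 * volume.real E ≤ r * p ∨
  (2 * (r ^ 2 * ww φ) ≤ volume.real E ∧
    volume.real E + 2 * (r ^ 2 * ww φ) - volume.real (er φ D r) ≤ r * p) ∨
  ∃ C, IsCompact C ∧ Convex ℝ C ∧ C ⊆ D ∧ r ^ 2 * ww φ ≤ volume.real E ∧
    r ^ 2 * ww φ ≤ volume.real C ∧ r * MM φ C + 2 * volume.real (E \ C) ≤ r * p

theorem PerimeterAlt.weak (hφ : IsNorm φ) {r : ℝ} (hr : 0 < r) {D E : Set Plane}
    (hD : IsCompact D) (hfin : volume E ≠ ∞) {p : ℝ}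
    (h : PerimeterAlt φ r D E p) (hlt : r * p < 2 * volume.real E) :
    r ^ 2 * ww φ ≤ volume.real E ∧
      volume.real E + r ^ 2 * ww φ - volume.real (er φ D r) ≤ r * p := by
  have hw := ww_pos hφ
  have h0 : 0 < r ^ 2 * ww φ := by positivity
  rcases h with h | ⟨h1, h2⟩ | ⟨C, h1, h2, h3, h4, h5, h6⟩
  · linarith
  · constructor <;> linarith
  · refine ⟨h4, ?_⟩
    have h7 := bonnesen hφ h1 h2 hr h5
    have h8 : volume.real (er φ C r) ≤ volume.real (er φ D r) :=
      measureReal_mono (er_mono_left h3 r) (isCompact_er hφ hD.isBounded hr).measure_lt_top.ne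
    have h9 : volume.real E ≤ volume.real C + volume.real (E \ C) := by
      have : volume.real E ≤ volume.real (C ∪ (E \ C)) :=
        measureReal_mono (by rw [union_sdiff_self]; exact subset_union_right)
          (measure_union_lt_top (h1.measure_lt_top (μ := volume))
            ((measure_mono sdiff_subset).trans_lt hfin.lt_top)).ne
      exact this.trans (measureReal_union_le _ _)
    linarith [measureReal_nonneg (μ := volume) (s := E \ C)]

theorem PerimeterAlt.of_piece {r : ℝ} {D E A : Set Plane} (hA : MeasurableSet A) (hAE : A ⊆ E)
    (hfin : volume E ≠ ∞) {p q : ℝ}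
    (hv : r * q - 2 * volume.real A ≤ r * p - 2 * volume.real E) (h : PerimeterAlt φ r D A q) :
    PerimeterAlt φ r D E p := by
  have h0 : volume.real A ≤ volume.real E := measureReal_mono hAE hfin
  rcases h with h | ⟨h1, h2⟩ | ⟨C, h1, h2, h3, h4, h5, h6⟩
  · exact Or.inl (by linarith)
  · exact Or.inr (Or.inl ⟨by linarith, by linarith⟩)
  · refine Or.inr (Or.inr ⟨C, h1, h2, h3, h4.trans h0, h5, ?_⟩)
    have h7 : volume.real (E \ A) = volume.real E - volume.real A := measureReal_sdiff hAE hA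
    have h8 : volume.real (E \ C) ≤ volume.real (A \ C) + volume.real (E \ A) := by
      refine (measureReal_mono (s₂ := (A \ C) ∪ (E \ A)) ?_ ?_).trans (measureReal_union_le _ _)
      · rintro x ⟨hx, hc⟩
        by_cases hxA : x ∈ A
        · exact Or.inl ⟨hxA, hc⟩
        · exact Or.inr ⟨hx, hxA⟩
      · refine measure_ne_top_of_subset ?_ hfin
        exact union_subset (sdiff_subset.trans hAE) sdiff_subset
    linarith

theorem disjoint_er_halfSpaces (hφ : IsNorm φ) {r : ℝ} (hr : 0 < r) {v : Plane} (hv : v ≠ 0)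
    (s : ℝ) (D : Set Plane) :
    Disjoint (er φ (D ∩ {x | crL v x ≤ s}) r) (er φ (D ∩ {x | s ≤ crL v x}) r) := by
  rw [Set.disjoint_left]
  intro x h1 h2
  obtain ⟨c, hc, hb⟩ := exists_ball_subset_wulffBall hφ
  have h3 : ∀ y ∈ Metric.ball x (c * r), crL v y = s := fun y hy =>
    le_antisymm (h1 (hb x r hy)).2 (h2 (hb x r hy)).2
  have h4 : Tendsto (fun t : ℝ => x + t • coord v (1, 0)) (nhdsWithin 0 (Ioi 0)) (nhds x) := by
    have : Continuous fun t : ℝ => x + t • coord v (1, 0) := by fun_prop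
    have h5 := this.tendsto 0
    simp only [zero_smul, add_zero] at h5
    exact h5.mono_left nhdsWithin_le_nhds
  obtain ⟨t, h6, h7⟩ := ((h4.eventually (Metric.ball_mem_nhds x (mul_pos hc hr))).and
    self_mem_nhdsWithin).exists
  have h8 := h3 _ h6
  have h9 := h3 x (Metric.mem_ball_self (mul_pos hc hr))
  rw [map_add, map_smul, crL_coord hv, h9] at h8
  simp at h8
  exact (ne_of_gt h7) h8

theorem perimeterAlt (hφ : IsNorm φ) {r : ℝ} (hr : 0 < r) {D E : Set Plane} (hD : IsCompact D)
    (hDc : Convex ℝ D) (hE : MeasurableSet E) (hb : Bornology.IsBounded E)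
    (hED : volume (E \ D) = 0) {p : ℝ} (hp : PerLe φ E p) : PerimeterAlt φ r D E p := by
  obtain ⟨κ, hκ, hiso⟩ := exists_rough_isoperimetric hφ
  have hw := ww_pos hφ
  have hrw : 0 < r ^ 2 * ww φ := by positivity
  set a := κ * r ^ 2 / 4 with ha
  have ha0 : 0 < a := by positivity
  obtain ⟨n, hn⟩ : ∃ n : ℕ, volume.real E ≤ n * a := by
    obtain ⟨n, hn⟩ := exists_nat_ge (volume.real E / a)
    exact ⟨n, by rwa [div_le_iff₀ ha0] at hn⟩
  induction n generalizing D E p with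
  | zero =>
    left
    have := hp.nonneg hφ
    simp only [CharP.cast_eq_zero, zero_mul] at hn
    nlinarith
  | succ n ih =>
    have hfin : volume E ≠ ∞ := hb.measure_lt_top.ne
    obtain ⟨A, q, hA, hAE, hAq, hval, hmin⟩ := exists_minimal_piece hφ hr hE hfin hp
    refine PerimeterAlt.of_piece hA hAE hfin hval ?_
    have hAb := hb.subset hAE
    have hAfin : volume A ≠ ∞ := hAb.measure_lt_top.ne
    have hAn : volume.real A ≤ (n + 1 : ℕ) * a := (measureReal_mono hAE hfin).trans hn
    have hAD : volume (A \ D) = 0 := measure_mono_null (sdiff_subset_sdiff_left hAE) hED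
    have hq0 := hAq.nonneg hφ
    by_cases hA0 : volume A = 0
    · left
      rw [measureReal_def, hA0]
      simp only [ENNReal.toReal_zero, mul_zero]
      positivity
    have hApos : 0 < volume.real A := ENNReal.toReal_pos hA0 hAfin
    by_cases hgap : ∀ v ≠ 0, wd v (hull A) ≤ volume.real (ep v A)
    · have hM := hAq.MM_hull_le hφ hA hAb hA0 hgap
      have hC := isCompact_hull hA hAb
      have hAC : volume (A \ hull A) = 0 := volume_diff_hull hA
      have hle : volume.real A ≤ volume.real (hull A) := by
        refine ENNReal.toReal_mono hC.measure_lt_top.ne ?_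
        have h1 : A ⊆ hull A ∪ (A \ hull A) := by
          rw [union_sdiff_self]; exact subset_union_right
        refine (measure_mono h1).trans ((measure_union_le _ _).trans ?_)
        rw [hAC, add_zero]
      by_cases hbig : r ^ 2 * ww φ ≤ volume.real A
      · refine Or.inr (Or.inr ⟨hull A, hC, convex_hull A,
          hull_subset hD.isClosed hDc hA hAD, hbig, hbig.trans hle, ?_⟩)
        rw [measureReal_def, hAC]
        simp only [ENNReal.toReal_zero, mul_zero, add_zero]
        gcongr
      · left
        have h1 := wulff_ineq hφ hC (convex_hull A) (hApos.trans_le hle)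
        have h2 : MM φ (hull A) ^ 2 ≤ q ^ 2 :=
          pow_le_pow_left₀ (MM_nonneg hφ hC (convex_hull A) (hull_nonempty hA hA0)) hM 2
        have h3 : volume.real A * ww φ ≤ volume.real (hull A) * ww φ := by gcongr
        refine le_of_sq_le_sq ?_ (by positivity)
        have h4 : volume.real A * volume.real A ≤ volume.real A * (r ^ 2 * ww φ) := by
          gcongr
          exact (not_le.1 hbig).le
        nlinarith [sq_nonneg r]
    · push Not at hgap
      obtain ⟨v, hv, hlt⟩ := hgap
      obtain ⟨s, hs, hpos1, hpos2⟩ := exists_gap hv hA hAb hlt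
      obtain ⟨q₁, q₂, hq, hq1, hq2⟩ := hAq.cut hφ hAfin (crL v) s hs
      have hL : Measurable (crL v) := (crL v).continuous.measurable
      have m1 : MeasurableSet (A ∩ {x | crL v x < s}) :=
        hA.inter (measurableSet_lt hL measurable_const)
      have m2 : MeasurableSet (A ∩ {x | s < crL v x}) :=
        hA.inter (measurableSet_lt measurable_const hL)
      set A₁ := A ∩ {x | crL v x < s} with hA1
      set A₂ := A ∩ {x | s < crL v x} with hA2
      have f1 : volume A₁ ≠ ∞ := measure_ne_top_of_subset inter_subset_left hAfin
      have f2 : volume A₂ ≠ ∞ := measure_ne_top_of_subset inter_subset_left hAfin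
      have hline : volume (A ∩ crL v ⁻¹' {s}) = 0 := by
        rw [volume_inter_strip hv hA (measurableSet_singleton s)]
        simp
      have hsum : volume.real A = volume.real A₁ + volume.real A₂ := by
        have e : volume A = volume (A₁ ∪ A₂) := by
          refine le_antisymm ?_ (measure_mono (union_subset inter_subset_left inter_subset_left))
          have : A ⊆ (A₁ ∪ A₂) ∪ (A ∩ crL v ⁻¹' {s}) := by
            intro x hx
            rcases lt_trichotomy (crL v x) s with h | h | h
            · exact Or.inl (Or.inl ⟨hx, h⟩)
            · exact Or.inr ⟨hx, h⟩
            · exact Or.inl (Or.inr ⟨hx, h⟩)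
          refine (measure_mono this).trans ((measure_union_le _ _).trans ?_)
          rw [hline, add_zero]
        have hd : Disjoint A₁ A₂ := by
          rw [Set.disjoint_left]
          rintro x ⟨-, h1⟩ ⟨-, h2⟩
          exact lt_asymm (show crL v x < s from h1) h2
        rw [measureReal_def, e, measure_union hd m2, ENNReal.toReal_add f1 f2]
        rfl
      have p1 : 0 < volume.real A₁ := ENNReal.toReal_pos hpos1.ne' f1
      have p2 : 0 < volume.real A₂ := ENNReal.toReal_pos hpos2.ne' f2
      have n1 : r * q₁ < 2 * volume.real A₁ := by
        by_contra! h
        have := hmin A₂ q₂ m2 inter_subset_left hq2 (by rw [hsum, ← hq]; linarith)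
        linarith
      have n2 : r * q₂ < 2 * volume.real A₂ := by
        by_contra! h
        have := hmin A₁ q₁ m1 inter_subset_left hq1 (by rw [hsum, ← hq]; linarith)
        linarith
      have hbig : ∀ B : Set Plane, MeasurableSet B → B ⊆ A → ∀ q', PerLe φ B q' →
          0 < volume.real B → r * q' < 2 * volume.real B → a ≤ volume.real B := by
        intro B hB hBA q' hq' hBpos hlt'
        have h1 := hiso B hB (hAb.subset hBA) q' hq'
        have h2 := hq'.nonneg hφ
        have h3 : (r * q') ^ 2 ≤ (2 * volume.real B) ^ 2 :=
          pow_le_pow_left₀ (by positivity) hlt'.le 2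
        have h4 : r ^ 2 * (κ * volume.real B) ≤ r ^ 2 * q' ^ 2 := by gcongr
        have h5 : (κ * r ^ 2) * volume.real B ≤ (4 * volume.real B) * volume.real B := by
          nlinarith
        have h6 := le_of_mul_le_mul_right h5 hBpos
        rw [ha]
        linarith
      have b1 := hbig A₁ m1 inter_subset_left q₁ hq1 p1 n1
      have b2 := hbig A₂ m2 inter_subset_left q₂ hq2 p2 n2
      push_cast at hAn
      have cl1 : IsClosed {x | crL v x ≤ s} := isClosed_le (crL v).continuous continuous_const
      have cl2 : IsClosed {x | s ≤ crL v x} := isClosed_le continuous_const (crL v).continuous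
      have hD1 := hD.inter_right cl1
      have hD2 := hD.inter_right cl2
      have t1 := (ih hD1 (hDc.inter (convex_halfSpace_le (crL v).isLinear s)) m1
        (hAb.subset inter_subset_left) (by
          refine measure_mono_null ?_ hAD
          rintro x ⟨⟨hx1, hx2⟩, hx3⟩
          exact ⟨hx1, fun hx4 => hx3 ⟨hx4, le_of_lt (show crL v x < s from hx2)⟩⟩) hq1 (by linarith)).weak hφ hr hD1 f1 n1
      have t2 := (ih hD2 (hDc.inter (convex_halfSpace_ge (crL v).isLinear s)) m2
        (hAb.subset inter_subset_left) (by
          refine measure_mono_null ?_ hAD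
          rintro x ⟨⟨hx1, hx2⟩, hx3⟩
          exact ⟨hx1, fun hx4 => hx3 ⟨hx4, le_of_lt (show s < crL v x from hx2)⟩⟩) hq2 (by linarith)).weak hφ hr hD2 f2 n2
      have her : volume.real (er φ (D ∩ {x | crL v x ≤ s}) r) +
          volume.real (er φ (D ∩ {x | s ≤ crL v x}) r) ≤ volume.real (er φ D r) := by
        have k1 := isCompact_er hφ hD1.isBounded hr
        have k2 := isCompact_er hφ hD2.isBounded hr
        rw [← measureReal_union (disjoint_er_halfSpaces hφ hr hv s D) k2.measurableSet
          k1.measure_lt_top.ne k2.measure_lt_top.ne]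
        exact measureReal_mono (union_subset (er_mono_left inter_subset_left r)
          (er_mono_left inter_subset_left r)) (isCompact_er hφ hD.isBounded hr).measure_lt_top.ne
      refine Or.inr (Or.inl ⟨by rw [hsum]; linarith [t1.1, t2.1], ?_⟩)
      rw [hsum, ← hq]
      linarith [t1.2, t2.2]

end Alternative

section Plaquette

variable {φ : Plane → ℝ}

theorem Convex.subset_of_volume_diff_eq_zero {K L : Set Plane} (hK : Convex ℝ K)
    (hne : (interior K).Nonempty) (hL : IsClosed L) (h : volume (K \ L) = 0) : K ⊆ L := by
  have h1 : interior K \ L = ∅ := by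
    refine (isOpen_interior.sdiff hL).measure_eq_zero_iff volume |>.1 ?_
    exact measure_mono_null (sdiff_subset_sdiff_left interior_subset) h
  have h2 : closure (interior K) ⊆ L := closure_minimal (sdiff_eq_empty.1 h1) hL
  rw [hK.closure_interior_eq_closure_of_nonempty_interior hne] at h2
  exact subset_closure.trans h2

theorem Convex.ae_eq_closure {K : Set Plane} (hK : Convex ℝ K) : K =ᵐ[volume] closure K := by
  have h : volume (closure K \ K) = 0 :=
    measure_mono_null (by
      rintro x ⟨h1, h2⟩
      exact ⟨h1, fun h3 => h2 (interior_subset h3)⟩) (hK.addHaar_frontier volume)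
  exact subset_closure.eventuallyLE.antisymm (ae_le_set.2 h)

theorem IsOpen.eq_interior_closure {Ω : Set Plane} (ho : IsOpen Ω) (hc : Convex ℝ Ω)
    (hne : Ω.Nonempty) : interior (closure Ω) = Ω := by
  rw [hc.interior_closure_eq_interior_of_nonempty_interior (by rwa [ho.interior_eq]),
    ho.interior_eq]

theorem IsOpen.subset_of_subset_closure {Ω U : Set Plane} (ho : IsOpen Ω) (hc : Convex ℝ Ω)
    (hne : Ω.Nonempty) (hU : IsOpen U) (h : U ⊆ closure Ω) : U ⊆ Ω := by
  have := interior_maximal h hU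
  rwa [ho.eq_interior_closure hc hne] at this

theorem er_closure (hφ : IsNorm φ) {Ω : Set Plane} (ho : IsOpen Ω) (hc : Convex ℝ Ω)
    (hne : Ω.Nonempty) (r : ℝ) : er φ (closure Ω) r = er φ Ω r :=
  subset_antisymm
    (fun x hx => ho.subset_of_subset_closure hc hne (isOpen_wulffBall hφ x r) hx)
    (er_mono_left subset_closure r)

theorem maxInradius_spec (hφ : IsNorm φ) {Ω : Set Plane} (ho : IsOpen Ω)
    (hb : Bornology.IsBounded Ω) (hne : Ω.Nonempty) :
    0 < maxInradius φ Ω ∧ (er φ Ω (maxInradius φ Ω)).Nonempty ∧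
      ∀ t, maxInradius φ Ω < t → er φ Ω t = ∅ := by
  obtain ⟨s, hs, h1, h2⟩ := exists_inradius hφ hb (by rwa [ho.interior_eq])
  have : maxInradius φ Ω = s := by
    refine IsGreatest.csSup_eq ⟨⟨hs, h1⟩, ?_⟩
    rintro t ⟨-, x, hx⟩
    by_contra! h
    exact (h2 t h).subset hx
  rw [this]
  exact ⟨hs, h1, h2⟩

theorem plaquette_zero (Ω : Set Plane) : plaquette φ Ω 0 = Ω := if_pos rfl

theorem plaquette_subset (Ω : Set Plane) (r : ℝ) : plaquette φ Ω r ⊆ Ω := by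
  by_cases hr : r = 0
  · rw [hr, plaquette_zero]
  · rw [plaquette_eq_dil hr]
    exact dil_er_subset Ω r

theorem isOpen_plaquette (hφ : IsNorm φ) {Ω : Set Plane} (ho : IsOpen Ω) (r : ℝ) :
    IsOpen (plaquette φ Ω r) := by
  by_cases hr : r = 0
  · rwa [hr, plaquette_zero]
  · rw [plaquette_eq_dil hr]
    exact isOpen_dil hφ _ _

theorem convex_plaquette (hφ : IsNorm φ) {Ω : Set Plane} (hc : Convex ℝ Ω) (r : ℝ) :
    Convex ℝ (plaquette φ Ω r) := by
  by_cases hr : r = 0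
  · rwa [hr, plaquette_zero]
  · rw [plaquette_eq_dil hr]
    exact convex_dil hφ (convex_er hc r) r

theorem plaquette_anti (hφ : IsNorm φ) (Ω : Set Plane) {r ρ : ℝ} (hr : 0 ≤ r) (h : r ≤ ρ) :
    plaquette φ Ω ρ ⊆ plaquette φ Ω r := by
  rcases hr.eq_or_lt with rfl | hr
  · rw [plaquette_zero]
    exact plaquette_subset Ω ρ
  have hρ : 0 < ρ := hr.trans_le h
  rw [plaquette_eq_dil hr.ne', plaquette_eq_dil hρ.ne']
  rintro y ⟨x, hx, hyx⟩
  refine ⟨x + (1 - r / ρ) • (y - x), fun u hu => hx ?_, ?_⟩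
  · rw [mem_wulffBall] at hu ⊢
    have e : u - x = (u - (x + (1 - r / ρ) • (y - x))) + (1 - r / ρ) • (y - x) := by abel
    rw [e]
    refine (hφ.add_le _ _).trans_lt ?_
    have h0 : 0 ≤ 1 - r / ρ := by
      rw [sub_nonneg, div_le_one hρ]
      exact h
    rw [hφ.smul_eq, abs_of_nonneg h0]
    have h1 : (1 - r / ρ) * φ (y - x) ≤ (1 - r / ρ) * ρ := by gcongr
    have h2 : (1 - r / ρ) * ρ = ρ - r := by field_simp
    linarith
  · have e : y - (x + (1 - r / ρ) • (y - x)) = (r / ρ) • (y - x) := by module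
    rw [e, hφ.smul_eq, abs_of_nonneg (by positivity)]
    calc r / ρ * φ (y - x) < r / ρ * ρ := by gcongr
      _ = r := by field_simp

theorem mem_closure_dil_er (hφ : IsNorm φ) {C : Set Plane} (hb : Bornology.IsBounded C) {r : ℝ}
    (hr : 0 < r) {x : Plane} (h : ∀ N, ∃ y ∈ er φ C (rad N * r), φ (x - y) ≤ r) :
    x ∈ closure (dil φ (er φ C r) r) := by
  have hcl : IsClosed {y | φ (x - y) ≤ r} :=
    isClosed_le (hφ.continuous.comp (by fun_prop)) continuous_const
  have hk : ∀ N, IsCompact (er φ C (rad N * r)) := fun N =>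
    isCompact_er hφ hb (mul_pos (rad_pos N) hr)
  obtain ⟨y, hy⟩ := IsCompact.nonempty_iInter_of_sequence_nonempty_isCompact_isClosed
    (fun N => er φ C (rad N * r) ∩ {y | φ (x - y) ≤ r})
    (fun N => inter_subset_inter_left _ (antitone_er_rad C hr N.le_succ))
    (fun N => by
      obtain ⟨y, h1, h2⟩ := h N
      exact ⟨y, h1, h2⟩)
    ((hk 0).inter_right hcl) fun N => (hk N).isClosed.inter hcl
  rw [mem_iInter] at hy
  have h1 : y ∈ er φ C r := by
    rw [← iInter_er_rad C hr, mem_iInter]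
    exact fun N => (hy N).1
  refine closure_mono ?_ (mem_closure_wulffBall hφ hr (hy 0).2)
  exact fun z hz => ⟨y, h1, hz⟩

theorem exists_of_mem_closure_dil (hφ : IsNorm φ) {K : Set Plane} (hK : IsCompact K) {s : ℝ}
    {x : Plane} (hx : x ∈ closure (dil φ K s)) : ∃ y ∈ K, φ (x - y) ≤ s := by
  have hB : IsClosed {z | φ z ≤ s} := isClosed_le hφ.continuous continuous_const
  have hcl : IsClosed (K + {z | φ z ≤ s}) := hB.add_left_of_isCompact hK
  have h1 : closure (dil φ K s) ⊆ K + {z | φ z ≤ s} := by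
    refine closure_minimal ?_ hcl
    rintro y ⟨k, hk, hy⟩
    exact ⟨k, hk, y - k, hy.le, add_sub_cancel k y⟩
  obtain ⟨k, hk, z, hz, rfl⟩ := h1 hx
  exact ⟨k, hk, by simpa using hz⟩

theorem exists_gt_mem_plaquette (hφ : IsNorm φ) {Ω : Set Plane} (ho : IsOpen Ω)
    (hc : Convex ℝ Ω) {r R : ℝ} (hr : 0 ≤ r) (hrR : r < R) (hne : (er φ Ω R).Nonempty)
    {x : Plane} (hx : x ∈ plaquette φ Ω r) : ∃ ρ, r < ρ ∧ ρ ≤ R ∧ x ∈ plaquette φ Ω ρ := by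
  obtain ⟨z, hz⟩ := hne
  rcases hr.eq_or_lt with rfl | hr
  · rw [plaquette_zero] at hx
    obtain ⟨ε, hε, hb⟩ := Metric.isOpen_iff.1 ho x hx
    obtain ⟨c, hc0, hcn⟩ := hφ.exists_norm_le
    have hρ : 0 < min R (c * ε) := lt_min hrR (by positivity)
    refine ⟨min R (c * ε), hρ, min_le_left _ _, ?_⟩
    rw [plaquette_eq_dil hρ.ne']
    refine ⟨x, fun y hy => hb ?_, by simpa [hφ.map_zero] using hρ⟩
    rw [mem_wulffBall] at hy
    rw [Metric.mem_ball, dist_eq_norm]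
    have h1 := hcn (y - x)
    have h2 : φ (y - x) < c * ε := hy.trans_le (min_le_right _ _)
    exact lt_of_mul_lt_mul_left (h1.trans_lt h2) hc0.le
  · rw [plaquette_eq_dil hr.ne'] at hx
    obtain ⟨y, hy, hxy⟩ := hx
    have ht : Tendsto (fun t : ℝ => φ (x - y) + t * φ (z - y) - t * (R - r)) (nhdsWithin 0 (Ioi 0))
        (nhds (φ (x - y))) := by
      have : Continuous fun t : ℝ => φ (x - y) + t * φ (z - y) - t * (R - r) := by fun_prop
      have h5 := this.tendsto 0
      simp only [zero_mul, add_zero, sub_zero] at h5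
      exact h5.mono_left nhdsWithin_le_nhds
    have hlt : ∀ᶠ t : ℝ in nhdsWithin 0 (Ioi 0), t < 1 :=
      nhdsWithin_le_nhds (gt_mem_nhds one_pos)
    obtain ⟨t, ⟨h1, h2⟩, h3⟩ := ((ht.eventually (gt_mem_nhds hxy)).and hlt).and
      self_mem_nhdsWithin |>.exists
    have h3' : (0 : ℝ) < t := h3
    have hρ : 0 < r + t * (R - r) := by nlinarith
    refine ⟨r + t * (R - r), by nlinarith, by nlinarith, ?_⟩
    rw [plaquette_eq_dil hρ.ne']
    refine ⟨y + t • (z - y), fun u hu => ?_, ?_⟩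
    · rw [mem_wulffBall] at hu
      set w := u - (y + t • (z - y)) with hw
      have e : u = (1 - t) • (y + (r / (r + t * (R - r))) • w) +
          t • (z + (R / (r + t * (R - r))) • w) := by
        have e1 : (1 - t) * (r / (r + t * (R - r))) + t * (R / (r + t * (R - r))) = 1 := by
          field_simp
          ring
        have e2 : (1 - t) • (y + (r / (r + t * (R - r))) • w) +
          t • (z + (R / (r + t * (R - r))) • w) = (y + t • (z - y)) +
          ((1 - t) * (r / (r + t * (R - r))) + t * (R / (r + t * (R - r)))) • w := by module
        rw [e2, e1, one_smul, hw]
        abel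
      have hball : ∀ a : ℝ, 0 < a → ∀ q : Plane,
          q + (a / (r + t * (R - r))) • w ∈ wulffBall φ q a := by
        intro a ha q
        rw [mem_wulffBall, add_sub_cancel_left, hφ.smul_eq, abs_of_pos (by positivity)]
        calc a / (r + t * (R - r)) * φ w < a / (r + t * (R - r)) * (r + t * (R - r)) := by gcongr
          _ = a := by field_simp
      rw [e]
      exact hc (hy (hball r hr y)) (hz (hball R (hr.trans hrR) z)) (by linarith) h3'.le (by ring)
    · have e : x - (y + t • (z - y)) = (x - y) + (-t) • (z - y) := by module
      rw [e]
      refine (hφ.add_le _ _).trans_lt ?_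
      rw [hφ.smul_eq, abs_neg, abs_of_pos h3']
      linarith

theorem plaquette_eq_self_of_rWCond (hφ : IsNorm φ) {Ω : Set Plane} (ho : IsOpen Ω)
    (hb : Bornology.IsBounded Ω) (hc : Convex ℝ Ω) (hne : Ω.Nonempty) {ρ : ℝ} (hρ : 0 < ρ)
    (h : rWCond φ Ω ρ) : (er φ Ω ρ).Nonempty ∧ plaquette φ Ω ρ = Ω := by
  have hcp : IsCompact (closure Ω) := hb.isCompact_closure
  have hfr : frontier Ω ⊆ closure (plaquette φ Ω ρ) := by
    intro x hx
    obtain ⟨y, hy, hxy⟩ := h x hx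
    refine closure_mono ?_ (frontier_subset_closure hxy)
    rw [plaquette_eq_dil hρ.ne']
    exact fun z hz => ⟨y, hy, hz⟩
  have hext : extremePoints ℝ (closure Ω) ⊆ closure (plaquette φ Ω ρ) := by
    intro x hx
    refine hfr ⟨hx.1, fun hx2 => ?_⟩
    exact Set.disjoint_left.1 (disjoint_interior_extremePoints (closure Ω))
      (interior_mono subset_closure hx2) hx
  have hcl : closure Ω ⊆ closure (plaquette φ Ω ρ) := by
    rw [← closure_convexHull_extremePoints hcp hc.closure]
    exact closure_minimal (convexHull_min hext (convex_plaquette hφ hc ρ).closure) isClosed_closure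
  have hpne : (plaquette φ Ω ρ).Nonempty := closure_nonempty_iff.1 ((hne.mono subset_closure).mono hcl)
  refine ⟨?_, (plaquette_subset Ω ρ).antisymm ?_⟩
  · rw [plaquette_eq_dil hρ.ne'] at hpne
    obtain ⟨_, k, hk, -⟩ := hpne
    exact ⟨k, hk⟩
  · exact (isOpen_plaquette hφ ho ρ).subset_of_subset_closure (convex_plaquette hφ hc ρ) hpne ho
      (subset_closure.trans hcl)

theorem exists_plaquette_volume_eq (hφ : IsNorm φ) {Ω : Set Plane} (ho : IsOpen Ω)
    (hb : Bornology.IsBounded Ω) (hc : Convex ℝ Ω) {R : ℝ} (hR : 0 < R)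
    (hne : (er φ Ω R).Nonempty) {m : ℝ} (hm : volume.real (plaquette φ Ω R) < m)
    (hm1 : m ≤ volume.real Ω) :
    ∃ r, 0 ≤ r ∧ r < R ∧ volume.real (plaquette φ Ω r) = m ∧
      ∀ ρ, 0 ≤ ρ → ρ ≤ R → m ≤ volume.real (plaquette φ Ω ρ) → ρ ≤ r := by
  have hfin : ∀ r, volume (plaquette φ Ω r) ≠ ∞ := fun r =>
    (hb.subset (plaquette_subset Ω r)).measure_lt_top.ne
  set S : Set ℝ := {r | 0 ≤ r ∧ r ≤ R ∧ m ≤ volume.real (plaquette φ Ω r)} with hS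
  have h0S : (0 : ℝ) ∈ S := ⟨le_rfl, hR.le, by rwa [plaquette_zero]⟩
  have hbdd : BddAbove S := ⟨R, fun r hr => hr.2.1⟩
  set r := sSup S with hr
  have hr0 : 0 ≤ r := le_csSup hbdd h0S
  have hrR : r ≤ R := csSup_le ⟨0, h0S⟩ fun r hr => hr.2.1
  have hanti : ∀ a b, 0 ≤ a → a ≤ b →
      volume.real (plaquette φ Ω b) ≤ volume.real (plaquette φ Ω a) := fun a b ha hab =>
    measureReal_mono (plaquette_anti hφ Ω ha hab) (hfin a)
  have hge : m ≤ volume.real (plaquette φ Ω r) := by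
    rcases hr0.eq_or_lt with h | hpos
    · rw [← h, plaquette_zero]
      exact hm1
    have hlt : ∀ N, rad N * r < r := fun N => by nlinarith [rad_lt_one N]
    have hN : ∀ N, m ≤ volume.real (plaquette φ Ω (rad N * r)) := by
      intro N
      obtain ⟨s, hs, hlt'⟩ := exists_lt_of_lt_csSup ⟨0, h0S⟩ (hlt N)
      exact hs.2.2.trans (hanti _ _ (mul_pos (rad_pos N) hpos).le hlt'.le)
    have hsub : ⋂ N, plaquette φ Ω (rad N * r) ⊆ closure (plaquette φ Ω r) := by
      intro x hx
      rw [plaquette_eq_dil hpos.ne']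
      refine mem_closure_dil_er hφ hb hpos fun N => ?_
      have h1 := mem_iInter.1 hx N
      rw [plaquette_eq_dil (mul_pos (rad_pos N) hpos).ne'] at h1
      obtain ⟨y, hy, hxy⟩ := h1
      exact ⟨y, hy, (hxy.trans (hlt N)).le⟩
    have ht : Tendsto (fun N => volume.real (plaquette φ Ω (rad N * r))) atTop
        (nhds (volume.real (⋂ N, plaquette φ Ω (rad N * r)))) := by
      refine (ENNReal.tendsto_toReal ?_).comp (tendsto_measure_iInter_atTop
        (fun N => (isOpen_plaquette hφ ho _).nullMeasurableSet) ?_ ⟨0, hfin _⟩)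
      · exact measure_ne_top_of_subset (iInter_subset _ 0) (hfin _)
      · intro M N hMN
        refine plaquette_anti hφ Ω (mul_pos (rad_pos M) hpos).le ?_
        gcongr
        exact rad_mono hMN
    have h1 := ge_of_tendsto' ht hN
    refine h1.trans ?_
    rw [measureReal_congr (convex_plaquette hφ hc r).ae_eq_closure]
    refine measureReal_mono hsub ?_
    rw [← measure_congr (convex_plaquette hφ hc r).ae_eq_closure]
    exact hfin r
  have hrlt : r < R := by
    refine hrR.lt_of_ne fun h => ?_
    rw [h] at hge
    linarith
  refine ⟨r, hr0, hrlt, le_antisymm ?_ hge, fun ρ h1 h2 h3 => le_csSup hbdd ⟨h1, h2, h3⟩⟩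
  set u : ℕ → ℝ := fun n => r + (R - r) * (1 / ((n : ℝ) + 1)) with hu
  have hur : ∀ n, r < u n := fun n => by
    have : 0 < (R - r) * (1 / ((n : ℝ) + 1)) := mul_pos (by linarith) (by positivity)
    simp only [hu]
    linarith
  have huR : ∀ n, u n ≤ R := fun n => by
    have h1 : 1 / ((n : ℝ) + 1) ≤ 1 := by
      rw [div_le_one (by positivity)]
      linarith [(Nat.cast_nonneg n : (0 : ℝ) ≤ n)]
    have : (R - r) * (1 / ((n : ℝ) + 1)) ≤ (R - r) * 1 := by
      gcongr
    simp only [hu]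
    linarith
  have hua : Antitone u := fun i j hij => by
    simp only [hu]
    gcongr
  have hut : Tendsto u atTop (nhds r) := by
    have := (tendsto_one_div_add_atTop_nhds_zero_nat (𝕜 := ℝ)).const_mul (R - r) |>.const_add r
    simpa only [mul_zero, add_zero] using this
  have hun : plaquette φ Ω r ⊆ ⋃ n, plaquette φ Ω (u n) := by
    intro x hx
    obtain ⟨ρ, h1, h2, h3⟩ := exists_gt_mem_plaquette hφ ho hc hr0 hrlt hne hx
    obtain ⟨n, hn⟩ := (hut.eventually (gt_mem_nhds h1)).exists
    exact mem_iUnion.2 ⟨n, plaquette_anti hφ Ω (hr0.trans (hur n).le) hn.le h3⟩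
  have hmon : Monotone fun n => plaquette φ Ω (u n) := fun i j hij =>
    plaquette_anti hφ Ω (hr0.trans (hur j).le) (hua hij)
  have hufin : volume (⋃ n, plaquette φ Ω (u n)) ≠ ∞ :=
    measure_ne_top_of_subset (iUnion_subset fun n => plaquette_subset Ω _) hb.measure_lt_top.ne
  have ht : Tendsto (fun n => volume.real (plaquette φ Ω (u n))) atTop
      (nhds (volume.real (⋃ n, plaquette φ Ω (u n)))) :=
    (ENNReal.tendsto_toReal hufin).comp (tendsto_measure_iUnion_atTop hmon)
  refine (measureReal_mono hun hufin).trans (le_of_tendsto' ht fun n => ?_)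
  by_contra! h
  have := le_csSup hbdd (show u n ∈ S from ⟨hr0.trans (hur n).le, huR n, h.le⟩)
  linarith [hur n]

theorem closure_densityPoints {E F : Set Plane} (h : E =ᵐ[volume] F) (ho : IsOpen F) :
    closure (densityPoints E) = closure F := by
  have hcongr : ∀ x r, volume (E ∩ Metric.ball x r) = volume (F ∩ Metric.ball x r) := fun x r =>
    measure_congr (h.inter (ae_eq_refl _))
  have hpos : ∀ (x : Plane) (r : ℝ), 0 < r → volume (Metric.ball x r) ≠ 0 := fun x r hr =>
    (Metric.measure_ball_pos volume x hr).ne'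
  refine subset_antisymm (closure_minimal ?_ isClosed_closure) (closure_mono ?_)
  · intro x hx
    by_contra hxF
    obtain ⟨ε, hε, hb⟩ := Metric.isOpen_iff.1 isClosed_closure.isOpen_compl x hxF
    have hz : Tendsto (fun r : ℝ => volume (E ∩ Metric.ball x r) / volume (Metric.ball x r))
        (nhdsWithin 0 (Ioi 0)) (nhds 0) := by
      refine tendsto_const_nhds.congr' ?_
      filter_upwards [nhdsWithin_le_nhds (gt_mem_nhds hε)] with r hr
      have : F ∩ Metric.ball x r = ∅ := by
        rw [← disjoint_iff_inter_eq_empty, Set.disjoint_left]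
        exact fun y hy hyb => hb (Metric.ball_subset_ball (le_of_lt hr) hyb) (subset_closure hy)
      rw [hcongr, this, measure_empty, ENNReal.zero_div]
    exact zero_ne_one (tendsto_nhds_unique hz hx)
  · intro x hx
    obtain ⟨ε, hε, hb⟩ := Metric.isOpen_iff.1 ho x hx
    refine tendsto_const_nhds.congr' ?_
    filter_upwards [nhdsWithin_le_nhds (gt_mem_nhds hε), self_mem_nhdsWithin] with r hr hr0
    have : F ∩ Metric.ball x r = Metric.ball x r :=
      inter_eq_right.2 ((Metric.ball_subset_ball (le_of_lt hr)).trans hb)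
    rw [hcongr, this, ENNReal.div_self (hpos x r hr0) measure_ball_lt_top.ne]

end Plaquette

section Cases
variable {φ : Plane → ℝ}

theorem wd_homothety (v x : Plane) {c : ℝ} (hc : 0 ≤ c) (K : Set Plane) :
    wd v (AffineMap.homothety x c '' K) = c * wd v K := by
  have h : crL v '' (AffineMap.homothety x c '' K) =
      AffineMap.homothety (crL v x) c '' (crL v '' K) := by
    simp only [image_image, AffineMap.homothety_apply, vsub_eq_sub, vadd_eq_add, map_add, map_smul,
      map_sub, smul_eq_mul]
  rw [wd, wd, h, measureReal_def, Measure.addHaar_image_homothety, ENNReal.toReal_mul,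
    Module.finrank_self, pow_one, abs_of_nonneg hc, ENNReal.toReal_ofReal hc]
  rfl

theorem MM_homothety (hφ : IsNorm φ) {K : Set Plane} (hc : IsCompact K) (hK : Convex ℝ K)
    (hne : K.Nonempty) (x : Plane) {c : ℝ} (h0 : 0 ≤ c) :
    MM φ (AffineMap.homothety x c '' K) = c * MM φ K := by
  have hcont : Continuous (AffineMap.homothety x c : Plane →ᵃ[ℝ] Plane) :=
    AffineMap.continuous_of_finiteDimensional _
  refine tendsto_nhds_unique
    (tendsto_zP hφ (hc.image hcont) (hK.affine_image (AffineMap.homothety x c)) (hne.image _)) ?_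
  refine ((tendsto_zP hφ hc hK hne).const_mul c).congr fun N => ?_
  simp only [zP, wd_homothety _ _ h0, ← List.sum_map_mul_left, mul_left_comm]

/-- A compact convex null set contains compact convex null sets of any smaller mixed area. -/
theorem exists_subset_MM_eq (hφ : IsNorm φ) {K : Set Plane} (hc : IsCompact K) (hK : Convex ℝ K)
    (hne : K.Nonempty) (h0 : volume.real K = 0) {a : ℝ} (ha : 0 ≤ a) (haK : a ≤ MM φ K) :
    ∃ L ⊆ K, IsCompact L ∧ Convex ℝ L ∧ L.Nonempty ∧ volume.real L = 0 ∧ MM φ L = a := by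
  obtain ⟨x, hx⟩ := hne
  rcases (MM_nonneg hφ hc hK ⟨x, hx⟩).eq_or_lt with hM | hM
  · exact ⟨K, subset_rfl, hc, hK, ⟨x, hx⟩, h0, by linarith⟩
  have hq0 : 0 ≤ a / MM φ K := by positivity
  have hq1 : a / MM φ K ≤ 1 := (div_le_one hM).2 haK
  have hsub : AffineMap.homothety x (a / MM φ K) '' K ⊆ K := by
    rintro _ ⟨y, hy, rfl⟩
    rw [AffineMap.homothety_eq_lineMap]
    exact hK.lineMap_mem hx hy ⟨hq0, hq1⟩
  refine ⟨_, hsub, hc.image (AffineMap.continuous_of_finiteDimensional _),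
    hK.affine_image (AffineMap.homothety x _), ⟨_, mem_image_of_mem _ hx⟩, ?_, ?_⟩
  · refine le_antisymm ?_ measureReal_nonneg
    rw [← h0]
    exact measureReal_mono hsub hc.measure_lt_top.ne
  · rw [MM_homothety hφ hc hK ⟨x, hx⟩ x hq0]
    field_simp

theorem IsIsopMinimizer.perLe {Ω E F : Set Plane} {m q : ℝ} (hφ : IsNorm φ)
    (hE : IsIsopMinimizer φ Ω m E) (hF : MeasurableSet F) (hFΩ : F ⊆ Ω)
    (hFm : volume.real F = m) (hq : PerLe φ F q) : PerLe φ E q := by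
  have h0 := hq.nonneg hφ
  rw [perLe_iff hE.1 h0]
  exact (hE.2.2.2 F hF hFΩ hFm).trans ((perLe_iff hF h0).1 hq)

theorem ae_eq_of_volume_real_le {A B : Set Plane} (hA : MeasurableSet A)
    (hBf : volume B ≠ ∞) (hAB : volume (A \ B) = 0)
    (hle : volume.real B ≤ volume.real A) : A =ᵐ[volume] B := by
  have h1 : A ≤ᵐ[volume] B := ae_le_set.2 hAB
  have hAf : volume A ≠ ∞ := ((measure_mono_ae h1).trans_lt hBf.lt_top).ne
  exact ae_eq_of_ae_subset_of_measure_ge h1 ((ENNReal.toReal_le_toReal hBf hAf).1 hle)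
    hA.nullMeasurableSet hBf

theorem ae_eq_of_volume_add_le {E C : Set Plane} (hE : MeasurableSet E) (hEf : volume E ≠ ∞)
    (hC : IsCompact C)
    (h : volume.real C + 2 * volume.real (E \ C) ≤ volume.real E) :
    E =ᵐ[volume] C ∧ volume.real C = volume.real E := by
  have h1 : volume.real E ≤ volume.real C + volume.real (E \ C) := by
    have h2 := measureReal_inter_add_sdiff (μ := volume) (s := E) hC.measurableSet hEf
    have h3 : volume.real (E ∩ C) ≤ volume.real C :=
      measureReal_mono inter_subset_right hC.measure_lt_top.ne
    linarith
  have h2 : 0 ≤ volume.real (E \ C) := measureReal_nonneg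
  have h3 : volume (E \ C) = 0 := by
    refine (measureReal_eq_zero_iff ?_).1 (by linarith)
    exact measure_ne_top_of_subset sdiff_subset hEf
  have := ae_eq_of_volume_real_le hE hC.measure_lt_top.ne h3 (by linarith)
  exact ⟨this, (measureReal_congr this).symm⟩

/-- If a competitor of the form `dil φ K r` with `|K| = |er φ Ω r|` is available, then every
minimizer is convex up to a null set and has a roll-in set of the same area. -/
theorem IsIsopMinimizer.exists_convex (hφ : IsNorm φ) {Ω E K : Set Plane} {m r : ℝ}
    (ho : IsOpen Ω) (hb : Bornology.IsBounded Ω) (hc : Convex ℝ Ω) (hne : Ω.Nonempty)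
    (hE : IsIsopMinimizer φ Ω m E) (hr : 0 < r) (hK : IsCompact K) (hKc : Convex ℝ K)
    (hKne : K.Nonempty) (hKΩ : dil φ K r ⊆ Ω) (hm : volume.real (dil φ K r) = m)
    (hk : volume.real K = volume.real (er φ Ω r)) (hlt : r ^ 2 * ww φ - volume.real K < m) :
    ∃ C, IsCompact C ∧ Convex ℝ C ∧ C ⊆ closure Ω ∧ E =ᵐ[volume] C ∧ volume.real C = m ∧
      volume.real (er φ C r) = volume.real (er φ Ω r) ∧
      r * MM φ C ≤ m + r ^ 2 * ww φ - volume.real K := by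
  have hp := hE.perLe hφ (isOpen_dil hφ K r).measurableSet hKΩ hm (perLe_dil hφ hK hKc hKne hr)
  have hq : r * (MM φ K + 2 * r * ww φ) = m + r ^ 2 * ww φ - volume.real K := by
    rw [volume_dil hφ hK hKc hKne hr] at hm
    linarith
  have hEm : volume.real E = m := hE.2.2.1
  have hEb : Bornology.IsBounded E := hb.subset hE.2.1
  have hw := ww_pos hφ
  have hD : IsCompact (closure Ω) := hb.isCompact_closure
  have hED : volume (E \ closure Ω) = 0 := by
    rw [sdiff_eq_empty.2 (hE.2.1.trans subset_closure), measure_empty]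
  rcases perimeterAlt hφ hr hD hc.closure hE.1 hEb hED hp with h | ⟨-, h⟩ |
    ⟨C, hC, hCc, hCD, h1, h2, h⟩
  · rw [hEm, hq] at h
    linarith
  · rw [hEm, hq, er_closure hφ ho hc hne, ← hk] at h
    nlinarith [mul_pos (pow_pos hr 2) hw]
  · have hB := bonnesen hφ hC hCc hr h2
    have hsub : er φ C r ⊆ er φ Ω r := by
      rw [← er_closure hφ ho hc hne]
      exact er_mono_left hCD r
    have hle : volume.real (er φ C r) ≤ volume.real (er φ Ω r) :=
      measureReal_mono hsub (isCompact_er hφ hb hr).measure_lt_top.ne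
    rw [hq] at h
    obtain ⟨h3, h4⟩ := ae_eq_of_volume_add_le hE.1 hEb.measure_lt_top.ne hC (by linarith)
    have h5 : 0 ≤ volume.real (E \ C) := measureReal_nonneg
    exact ⟨C, hC, hCc, hCD, h3, h4.trans hEm, le_antisymm hle (by linarith), by linarith⟩

theorem subset_closure_dil_er (hφ : IsNorm φ) {C : Set Plane} (hC : IsCompact C)
    (hCc : Convex ℝ C) {R : ℝ} (hR : 0 < R) (hlt : R ^ 2 * ww φ < volume.real C)
    (hM : R * MM φ C ≤ volume.real C + R ^ 2 * ww φ) (h0 : volume.real (er φ C R) = 0) :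
    (er φ C R).Nonempty ∧ C ⊆ closure (dil φ (er φ C R) R) := by
  have hw := ww_pos hφ
  have hpos : 0 < volume.real C := lt_trans (by positivity) hlt
  obtain ⟨s, hs, hsne, hsmax, -, hsM⟩ := exists_inradius_ineq hφ hC hCc hpos
  have hRs : R ≤ s := by
    by_contra! hsR
    have h1 : (R - s) * volume.real C ≤ (R - s) * (s * R * ww φ) := by nlinarith
    have h2 := le_of_mul_le_mul_left h1 (sub_pos.2 hsR)
    have h3 : s * R * ww φ ≤ R ^ 2 * ww φ := by
      rw [pow_two]
      gcongr
    linarith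
  have hne : (er φ C R).Nonempty := hsne.mono (er_anti_right C hRs)
  refine ⟨hne, fun x hx => mem_closure_dil_er hφ hC.isBounded hR fun N => ?_⟩
  set r := rad N * R with hr
  have hr0 : 0 < r := mul_pos (rad_pos N) hR
  have hrR : r < R := by nlinarith [rad_lt_one N]
  set ε := R - r with hε
  have hε0 : 0 < ε := sub_pos.2 hrR
  set K := er φ C r with hK
  have hKk : IsCompact K := isCompact_er hφ hC.isBounded hr0
  have hKc : Convex ℝ K := convex_er hCc r
  have hKne : K.Nonempty := hne.mono (er_anti_right C hrR.le)
  have hrε : r + ε = R := by simp [hε]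
  have hKK : (er φ K ε).Nonempty := by
    refine hne.mono ?_
    have := er_add_subset_er_er hφ (C := C) (r := r) (s := ε)
    rwa [hrε] at this
  have hKK0 : volume.real (er φ K ε) = 0 := by
    refine le_antisymm ?_ measureReal_nonneg
    rw [← h0]
    refine measureReal_mono ?_ (isCompact_er hφ hC.isBounded hR).measure_lt_top.ne
    have := er_er_subset hφ (C := C) hr0 hε0
    rwa [hrε] at this
  have e1 := le_volume_er hφ hC hCc hr0 hKne
  have e2 := le_volume_er hφ hKk hKc hε0 hKK
  rw [hKK0] at e2
  have hvol : volume.real C ≤ volume.real (dil φ K r) := by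
    rw [volume_dil hφ hKk hKc hKne hr0]
    set c := volume.real C
    set k := volume.real K
    set M := MM φ K
    have f1 : R * (c + r ^ 2 * ww φ - k) ≤ r * (c + R ^ 2 * ww φ) := by nlinarith
    have f2 : ε * (c - r * R * ww φ) ≤ R * k := by
      rw [hε]
      nlinarith
    have f3 : r * k + r * (ε ^ 2 * ww φ) ≤ r * (ε * M) := by nlinarith
    have f4 : ε * c ≤ ε * (k + r * M + r ^ 2 * ww φ) := by
      have g1 : ε * r ^ 2 * ww φ = ε * r * (R - ε) * ww φ := by
        rw [hε]
        ring
      have g2 : R * k = r * k + ε * k := by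
        rw [hε]
        ring
      nlinarith
    exact le_of_mul_le_mul_left f4 hε0
  have hdC : dil φ K r ⊆ C := dil_er_subset C r
  have hae := ae_eq_of_volume_real_le (isOpen_dil hφ K r).measurableSet hC.measure_lt_top.ne
    (by rw [sdiff_eq_empty.2 hdC, measure_empty]) hvol
  have hsub : C ⊆ closure (dil φ K r) := by
    refine Convex.subset_of_volume_diff_eq_zero hCc (interior_nonempty_of_volume_pos hCc hpos)
      isClosed_closure (measure_mono_null (sdiff_subset_sdiff_right subset_closure) ?_)
    exact ae_le_set.1 hae.symm.le
  obtain ⟨y, hy, hxy⟩ := exists_of_mem_closure_dil hφ hKk (hsub hx)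
  exact ⟨y, hy, hxy.trans hrR.le⟩

end Cases

section Characterization
variable {φ : Plane → ℝ}

theorem MM_singleton (hφ : IsNorm φ) (x : Plane) : MM φ {x} = 0 := by
  refine tendsto_nhds_unique (tendsto_zP hφ isCompact_singleton (convex_singleton x)
    (singleton_nonempty x)) ?_
  refine tendsto_const_nhds.congr fun N => ?_
  simp [zP, wd_singleton]

theorem dil_singleton (x : Plane) (r : ℝ) : dil φ {x} r = wulffBall φ x r := by
  ext y
  simp [dil, wulffBall]

/-- Small volumes: the minimizer is a Wulff ball. -/
theorem IsIsopMinimizer.exists_ae_eq_wulffBall (hφ : IsNorm φ) {Ω E : Set Plane} {m t : ℝ}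
    (ho : IsOpen Ω) (hb : Bornology.IsBounded Ω) (hc : Convex ℝ Ω) (hne : Ω.Nonempty)
    (hE : IsIsopMinimizer φ Ω m E) (ht : 0 < t) (htm : t ^ 2 * ww φ = m)
    (her : (er φ Ω t).Nonempty) : ∃ x ∈ Ω, E =ᵐ[volume] wulffBall φ x t := by
  have hw := ww_pos hφ
  have hm : 0 < m := htm ▸ mul_pos (pow_pos ht 2) hw
  obtain ⟨x0, hx0⟩ := her
  have hp := perLe_dil hφ isCompact_singleton (convex_singleton x0) (singleton_nonempty x0) ht
  rw [MM_singleton hφ, zero_add, dil_singleton] at hp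
  have hpE := hE.perLe hφ (isOpen_wulffBall hφ x0 t).measurableSet hx0
    (by rw [volume_wulffBall hφ x0 ht.le, ← htm]; rfl) hp
  have hEm : volume.real E = m := hE.2.2.1
  have hEb : Bornology.IsBounded E := hb.subset hE.2.1
  have hD : IsCompact (closure Ω) := hb.isCompact_closure
  have hED : volume (E \ closure Ω) = 0 := by
    rw [sdiff_eq_empty.2 (hE.2.1.trans subset_closure), measure_empty]
  have hr : 0 < 9 / 10 * t := by positivity
  have hq : 9 / 10 * t * (2 * t * ww φ) = 9 / 5 * m := by
    rw [← htm]
    ring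
  have hr2 : (9 / 10 * t) ^ 2 * ww φ = 81 / 100 * m := by
    rw [← htm]
    ring
  rcases perimeterAlt hφ hr hD hc.closure hE.1 hEb hED hpE with h | ⟨h, -⟩ |
    ⟨C, hC, hCc, hCD, -, h2, h⟩
  · rw [hEm, hq] at h
    linarith
  · rw [hEm, hr2] at h
    linarith
  rw [hq] at h
  rw [hr2] at h2
  have hcpos : 0 < volume.real C := by linarith
  have hX := wulff_ineq hφ hC hCc hcpos
  have hd0 : 0 ≤ volume.real (E \ C) := measureReal_nonneg
  have hdm : volume.real E ≤ volume.real C + volume.real (E \ C) := by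
    have h3 := measureReal_inter_add_sdiff (μ := volume) (s := E) hC.measurableSet
      hEb.measure_lt_top.ne
    have h4 : volume.real (E ∩ C) ≤ volume.real C :=
      measureReal_mono inter_subset_right hC.measure_lt_top.ne
    linarith
  have hCne : C.Nonempty := by
    by_contra! h3
    simp [h3] at hcpos
  have hM0 := MM_nonneg hφ hC hCc hCne
  rw [hEm] at hdm
  have hX2 : 81 / 25 * (volume.real C * m) ≤ (9 / 10 * t * MM φ C) ^ 2 := by
    have : (9 / 10 * t * MM φ C) ^ 2 = 81 / 100 * t ^ 2 * MM φ C ^ 2 := by ring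
    rw [this, ← htm]
    nlinarith [mul_le_mul_of_nonneg_left hX (sq_nonneg t)]
  have hX0 : 0 ≤ 9 / 10 * t * MM φ C := by positivity
  set X := 9 / 10 * t * MM φ C with hXdef
  set d := volume.real (E \ C) with hd
  have hX3 : X ^ 2 ≤ (9 / 5 * m - 2 * d) ^ 2 := pow_le_pow_left₀ hX0 (by linarith) 2
  have hcm : (m - d) * m ≤ volume.real C * m := by nlinarith
  have hdz : d = 0 := by
    by_contra hdne
    have hdpos : 0 < d := lt_of_le_of_ne hd0 (Ne.symm hdne)
    nlinarith [mul_pos hdpos hm]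
  have hcle : volume.real C ≤ m := by
    rw [hdz] at hX3
    have : volume.real C * m ≤ m * m := by nlinarith
    exact le_of_mul_le_mul_right this hm
  obtain ⟨hEC, hCm⟩ := ae_eq_of_volume_add_le hE.1 hEb.measure_lt_top.ne hC
    (by rw [← hd, hdz, hEm]; linarith)
  rw [hEm] at hCm
  have hM : t * MM φ C ≤ 2 * m := by
    rw [hXdef, hdz] at h
    linarith
  obtain ⟨s, hs, hsne, -, -, hsM⟩ := exists_inradius_ineq hφ hC hCc hcpos
  have hst : s = t := by
    rw [hCm] at hsM
    have h3 : t * (m + s ^ 2 * ww φ) ≤ s * (2 * m) := by nlinarith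
    have h4 : t * (ww φ * (s - t) ^ 2) ≤ 0 := by
      rw [← htm] at h3
      nlinarith
    have h5 : ww φ * (s - t) ^ 2 ≤ 0 := by
      by_contra! h6
      linarith [mul_pos ht h6]
    have h6 : (s - t) ^ 2 ≤ 0 := by
      by_contra! h7
      linarith [mul_pos hw h7]
    have h7 : s - t = 0 := pow_eq_zero_iff two_ne_zero |>.1 (le_antisymm h6 (sq_nonneg _))
    linarith
  rw [hst] at hsne
  obtain ⟨x, hx⟩ := hsne
  have hxC : wulffBall φ x t ⊆ C := hx
  have hBΩ : wulffBall φ x t ⊆ Ω :=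
    IsOpen.subset_of_subset_closure ho hc hne (isOpen_wulffBall hφ x t) (hxC.trans hCD)
  refine ⟨x, hBΩ (mem_wulffBall_self hφ x ht), hEC.trans ?_⟩
  refine (ae_eq_of_volume_real_le (isOpen_wulffBall hφ x t).measurableSet hC.measure_lt_top.ne
    (by rw [sdiff_eq_empty.2 hxC, measure_empty]) ?_).symm
  rw [volume_wulffBall hφ x ht.le, hCm, ← htm]
  rfl

/-- Large volumes: the minimizer is a plaquette of `Ω`. -/
theorem IsIsopMinimizer.ae_eq_plaquette (hφ : IsNorm φ) {Ω E : Set Plane} {m r R : ℝ}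
    (ho : IsOpen Ω) (hb : Bornology.IsBounded Ω) (hc : Convex ℝ Ω) (hne : Ω.Nonempty)
    (hE : IsIsopMinimizer φ Ω m E) (hr : 0 ≤ r) (hrR : r < R) (her : (er φ Ω R).Nonempty)
    (hm : volume.real (plaquette φ Ω r) = m) : E =ᵐ[volume] plaquette φ Ω r := by
  have hEm : volume.real E = m := hE.2.2.1
  rcases hr.eq_or_lt with rfl | hr0
  · rw [plaquette_zero] at hm ⊢
    refine ae_eq_of_volume_real_le hE.1 hb.measure_lt_top.ne
      (by rw [sdiff_eq_empty.2 hE.2.1, measure_empty]) (by rw [hEm, hm])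
  have hw := ww_pos hφ
  have hKc := convex_er (φ := φ) hc r
  have hK := isCompact_er hφ hb hr0
  have hKne : (er φ Ω r).Nonempty := her.mono (er_anti_right Ω hrR.le)
  obtain ⟨x0, hx0⟩ := her
  have hball : wulffBall φ x0 (R - r) ⊆ er φ Ω r :=
    er_add_subset_er_er hφ (r := r) (s := R - r) (by rwa [add_sub_cancel])
  have hRr : 0 < R - r := sub_pos.2 hrR
  have hKi : (interior (er φ Ω r)).Nonempty :=
    ⟨x0, interior_maximal hball (isOpen_wulffBall hφ _ _) (mem_wulffBall_self hφ x0 hRr)⟩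
  have hKpos : 0 < volume.real (er φ Ω r) := by
    have h1 : volume.real (wulffBall φ x0 (R - r)) ≤ volume.real (er φ Ω r) :=
      measureReal_mono hball hK.measure_lt_top.ne
    rw [volume_wulffBall hφ x0 hRr.le] at h1
    exact lt_of_lt_of_le (mul_pos (pow_pos hRr 2) hw) h1
  rw [plaquette_eq_dil hr0.ne'] at hm ⊢
  have hvol := volume_dil hφ hK hKc hKne hr0
  have hM0 := MM_nonneg hφ hK hKc hKne
  have hrM : 0 ≤ r * MM φ (er φ Ω r) := mul_nonneg hr hM0
  obtain ⟨C, hC, hCc, hCD, hEC, hCm, her', -⟩ := hE.exists_convex hφ ho hb hc hne hr0 hK hKc hKne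
    (dil_er_subset Ω r) hm rfl (by linarith)
  refine hEC.trans ?_
  have hCΩ : er φ C r ⊆ er φ Ω r := by
    rw [← er_closure hφ ho hc hne]
    exact er_mono_left hCD r
  have hae := ae_eq_of_volume_real_le (isCompact_er hφ hC.isBounded hr0).measurableSet
    hK.measure_lt_top.ne (by rw [sdiff_eq_empty.2 hCΩ, measure_empty]) her'.ge
  have hΩC : er φ Ω r ⊆ er φ C r :=
    Convex.subset_of_volume_diff_eq_zero hKc hKi (isCompact_er hφ hC.isBounded hr0).isClosed
      (ae_le_set.1 hae.symm.le)
  have hsub : dil φ (er φ Ω r) r ⊆ C := (dil_mono_left hΩC r).trans (dil_er_subset C r)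
  exact (ae_eq_of_volume_real_le (isOpen_dil hφ _ r).measurableSet hC.measure_lt_top.ne
    (by rw [sdiff_eq_empty.2 hsub, measure_empty]) (by rw [hCm, hm])).symm

/-- Intermediate volumes: the minimizer is a union of Wulff balls of the inradius. -/
theorem IsIsopMinimizer.exists_ae_eq_dil (hφ : IsNorm φ) {Ω E : Set Plane} {m R : ℝ}
    (ho : IsOpen Ω) (hb : Bornology.IsBounded Ω) (hc : Convex ℝ Ω) (hne : Ω.Nonempty)
    (hE : IsIsopMinimizer φ Ω m E) (hR : 0 < R) (her : (er φ Ω R).Nonempty)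
    (hmax : ∀ t, R < t → er φ Ω t = ∅) (hlt : R ^ 2 * ww φ < m)
    (hm : m ≤ volume.real (plaquette φ Ω R)) :
    ∃ K, Convex ℝ K ∧ E =ᵐ[volume] dil φ K R := by
  have hw := ww_pos hφ
  have hKc := convex_er (φ := φ) hc R
  have hK := isCompact_er hφ hb hR
  have hK0 : volume.real (er φ Ω R) = 0 := volume_er_eq_zero hφ hc hR hmax
  rw [plaquette_eq_dil hR.ne', volume_dil hφ hK hKc her hR, hK0] at hm
  obtain ⟨L, hLK, hL, hLc, hLne, hL0, hLM⟩ := exists_subset_MM_eq hφ hK hKc her hK0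
    (a := (m - R ^ 2 * ww φ) / R) (div_nonneg (by linarith) hR.le)
    (by rw [div_le_iff₀ hR]; linarith)
  have hLm : volume.real (dil φ L R) = m := by
    rw [volume_dil hφ hL hLc hLne hR, hL0, hLM]
    field_simp
    ring
  obtain ⟨C, hC, hCc, -, hEC, hCm, hC0, hCM⟩ := hE.exists_convex hφ ho hb hc hne hR hL hLc hLne
    ((dil_mono_left hLK R).trans (dil_er_subset Ω R)) hLm (hL0.trans hK0.symm) (by linarith)
  rw [hL0, sub_zero] at hCM
  obtain ⟨-, hsub⟩ := subset_closure_dil_er hφ hC hCc hR (by rw [hCm]; exact hlt)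
    (by rw [hCm]; exact hCM) (hC0.trans hK0)
  have hcv := convex_er (φ := φ) hCc R
  refine ⟨er φ C R, hcv, hEC.trans ?_⟩
  have h1 := (convex_dil hφ hcv R).ae_eq_closure
  have h2 : closure (dil φ (er φ C R) R) ≤ᵐ[volume] C :=
    h1.symm.le.trans (dil_er_subset C R).eventuallyLE
  exact (h2.antisymm hsub.eventuallyLE).symm.trans h1.symm

theorem eq_plaquette_dil (K : Set Plane) {r : ℝ} (hr : r ≠ 0) :
    dil φ K r = plaquette φ (dil φ K r) r := by
  rw [plaquette_eq_dil hr]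
  have h : K ⊆ er φ (dil φ K r) r := fun k hk y hy => ⟨k, hk, hy⟩
  exact subset_antisymm (dil_mono_left h r) (dil_er_subset _ r)

end Characterization

end PlanarIsoperimetry

/-- Characterization of minimizers of the constrained isoperimetric
problem (10) in a bounded convex open set `Ω ⊆ ℝ²`: writing `E'` for the set of
density-1 points of the minimizer `E`, (a) if `m > |Ω^{R_Ω}|` then `cl E' = cl Ω^{r_m}`
where `r_m ∈ [r_Ω, R_Ω]` satisfies `|Ω^{r_m}| = m`; (b) if
`R_Ω²·|W_φ| ≤ m ≤ |Ω^{R_Ω}|` then `cl E'` is the closure of a convex union of Wulff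
balls of radius `R_Ω`; (c) if `m ≤ R_Ω²·|W_φ|` then `cl E'` is a closed Wulff ball
of radius `√(m/|W_φ|)` centered at some `x ∈ Ω`. -/
theorem isop_minimizer_characterization (φ : (Fin 2 → ℝ) → ℝ) (hφ : IsNorm φ)
    (Ω : Set (Fin 2 → ℝ)) (hΩopen : IsOpen Ω) (hΩbdd : Bornology.IsBounded Ω)
    (hΩconv : Convex ℝ Ω) (hΩne : Ω.Nonempty)
    (m : ℝ) (hm0 : 0 ≤ m) (hm1 : m ≤ (volume Ω).toReal)
    (E : Set (Fin 2 → ℝ)) (hE : IsIsopMinimizer φ Ω m E) :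
    ((volume (plaquette φ Ω (maxInradius φ Ω))).toReal < m →
      ∃ r ∈ Icc (maxRollRadius φ Ω) (maxInradius φ Ω),
        (volume (plaquette φ Ω r)).toReal = m ∧
        closure (densityPoints E) = closure (plaquette φ Ω r)) ∧
    ((maxInradius φ Ω) ^ 2 * (volume (wulffBall φ 0 1)).toReal ≤ m →
      m ≤ (volume (plaquette φ Ω (maxInradius φ Ω))).toReal →
      ∃ F : Set (Fin 2 → ℝ), Convex ℝ F ∧ F = plaquette φ F (maxInradius φ Ω) ∧
        closure (densityPoints E) = closure F) ∧
    (m ≤ (maxInradius φ Ω) ^ 2 * (volume (wulffBall φ 0 1)).toReal →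
      ∃ x ∈ Ω, closure (densityPoints E) =
        closure (wulffBall φ x (Real.sqrt (m / (volume (wulffBall φ 0 1)).toReal)))) := by
  have hw := ww_pos hφ
  obtain ⟨hR, hRne, hRmax⟩ := maxInradius_spec hφ hΩopen hΩbdd hΩne
  refine ⟨fun h => ?_, fun h h' => ?_, fun h => ?_⟩
  · obtain ⟨r, hr0, hrR, hrm, hmax⟩ :=
      exists_plaquette_volume_eq hφ hΩopen hΩbdd hΩconv hR hRne h hm1
    refine ⟨r, ⟨Real.sSup_le ?_ hr0, hrR.le⟩, hrm, closure_densityPoints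
      (hE.ae_eq_plaquette hφ hΩopen hΩbdd hΩconv hΩne hr0 hrR hRne hrm)
      (isOpen_plaquette hφ hΩopen r)⟩
    rintro ρ ⟨hρ0, hρ⟩
    obtain ⟨hne, heq⟩ := plaquette_eq_self_of_rWCond hφ hΩopen hΩbdd hΩconv hΩne hρ0 hρ
    refine hmax ρ hρ0.le ?_ (by rw [heq]; exact hm1)
    by_contra! hlt
    rw [hRmax ρ hlt] at hne
    exact not_nonempty_empty hne
  · obtain ⟨K, hK, hEK⟩ : ∃ K, Convex ℝ K ∧ E =ᵐ[volume] dil φ K (maxInradius φ Ω) := by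
      rcases h.eq_or_lt with h1 | h1
      · obtain ⟨x, -, hx⟩ :=
          hE.exists_ae_eq_wulffBall hφ hΩopen hΩbdd hΩconv hΩne hR h1 hRne
        exact ⟨{x}, convex_singleton x, by rwa [dil_singleton]⟩
      · exact hE.exists_ae_eq_dil hφ hΩopen hΩbdd hΩconv hΩne hR hRne hRmax h1 h'
    exact ⟨_, convex_dil hφ hK _, eq_plaquette_dil K hR.ne',
      closure_densityPoints hEK (isOpen_dil hφ K _)⟩
  · change _ ≤ _ * ww φ at h
    change ∃ x ∈ Ω, _ = closure (wulffBall φ x (Real.sqrt (m / ww φ)))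
    rcases hm0.eq_or_lt with rfl | hm
    · obtain ⟨x, hx⟩ := hΩne
      refine ⟨x, hx, closure_densityPoints ?_ (isOpen_wulffBall hφ _ _)⟩
      rw [zero_div, Real.sqrt_zero, wulffBall_eq_empty hφ x le_rfl, ae_eq_empty]
      exact (measureReal_eq_zero_iff (hΩbdd.subset hE.2.1).measure_lt_top.ne).1 hE.2.2.1
    · have ht : Real.sqrt (m / ww φ) ^ 2 * ww φ = m := by
        rw [Real.sq_sqrt (by positivity), div_mul_cancel₀ _ hw.ne']
      have htR : Real.sqrt (m / ww φ) ≤ maxInradius φ Ω :=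
        Real.sqrt_le_iff.2 ⟨hR.le, by rwa [div_le_iff₀ hw]⟩
      obtain ⟨x, hx, hEx⟩ := hE.exists_ae_eq_wulffBall hφ hΩopen hΩbdd hΩconv hΩne
        (Real.sqrt_pos.2 (by positivity)) ht (hRne.mono (er_anti_right Ω htR))
      exact ⟨x, hx, closure_densityPoints hEx (isOpen_wulffBall hφ _ _)⟩

end
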